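/- arXiv:1308.5853 — 6 statements merged into one kernel-verified Lean document; each statement's English description precedes it below -/
import Mathlib

section
/- Let G be a countable locally nilpotent group acting in a Borel fashion on a standard Borel space X. Then the orbit equivalence relation E^X_G is hyperfinite. -/
/-- A finite Borel equivalence relation: a Borel equivalence relation all of whose
classes are finite. -/
def IsFiniteBorelEquivRel {X : Type*} [MeasurableSpace X] (E : X → X → Prop) : Prop :=
  Equivalence E ∧ MeasurableSet {p : X × X | E p.1 p.2} ∧ ∀ x : X, {y | E x y}.Finite

/-- A Borel equivalence relation is hyperfinite if it is the union of an increasing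
sequence of finite Borel equivalence relations. -/
def IsHyperfinite {X : Type*} [MeasurableSpace X] (E : X → X → Prop) : Prop :=
  ∃ F : ℕ → X → X → Prop,
    (∀ n, IsFiniteBorelEquivRel (F n)) ∧
    (∀ n x y, F n x y → F (n + 1) x y) ∧
    (∀ x y, E x y ↔ ∃ n, F n x y)

open scoped Pointwise commutatorElement

theorem Set.Finite.pow_of_group {H : Type*} [Group H] {S : Set H} (hS : S.Finite) (n : ℕ) :
    (S ^ n).Finite := by
  induction n with
  | zero => simp
  | succ n ih => rw [pow_succ]; exact ih.mul hS

/-- A subset of a group has polynomial growth if the sizes of its powers are polynomially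
bounded. -/
def HasPolyGrowth {H : Type*} [Group H] (S : Set H) : Prop :=
  ∃ C p : ℕ, ∀ n : ℕ, (S ^ n).ncard ≤ C * (n + 1) ^ p

/-- If the iterated commutators of `u` with `s` lie in `W` and die out after `m` steps, then the
conjugate of `u` by `s ^ a` is a product of polynomially many elements of `W`. -/
theorem pow_conj_mem_pow {H : Type*} [Group H] {W : Set H} (h1 : 1 ∈ W) (s : H) (m : ℕ) :
    ∀ u : H, (∀ j ≤ m, (fun v => ⁅s, v⁆)^[j] u ∈ W) → (fun v => ⁅s, v⁆)^[m] u = 1 →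
      ∀ a : ℕ, s ^ a * u * (s ^ a)⁻¹ ∈ W ^ ((a + 1) ^ m) := by
  induction m with
  | zero =>
    intro u _ hu a
    have hu : u = 1 := hu
    simpa [hu] using h1
  | succ m ih =>
    intro u hW hu a
    have hcomm := ih ⁅s, u⁆ (fun j hj => by simpa using hW (j + 1) (by omega)) (by simpa using hu)
    induction a with
    | zero => simpa using hW 0 (by omega)
    | succ a iha =>
      have hmul := Set.mul_mem_mul (hcomm a) iha
      rw [← pow_add] at hmul
      have hle : (a + 1) ^ m + (a + 1) ^ (m + 1) ≤ (a + 1 + 1) ^ (m + 1) := by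
        calc (a + 1) ^ m + (a + 1) ^ (m + 1) = (a + 1 + 1) * (a + 1) ^ m := by ring
          _ ≤ (a + 1 + 1) * (a + 1 + 1) ^ m := by gcongr; omega
          _ = (a + 1 + 1) ^ (m + 1) := by ring
      convert Set.pow_subset_pow_right h1 hle hmul using 1
      rw [commutatorElement_def, pow_succ]
      group

/-- Adding to `A` an element `s` such that the iterated commutators of `s` with `A` lie in a set of
polynomial growth and die out gives a set of polynomial growth. -/
theorem hasPolyGrowth_insert {H : Type*} [Group H] {A W : Set H} (hW : W.Finite) (h1 : 1 ∈ W)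
    (s : H) (c : ℕ) (hA : ∀ t ∈ A, ∀ j ≤ c, (fun v => ⁅s, v⁆)^[j] t ∈ W)
    (hc : ∀ t ∈ A, (fun v => ⁅s, v⁆)^[c] t = 1) (hgrowth : HasPolyGrowth W) :
    HasPolyGrowth (insert s A) := by
  obtain ⟨C, p, hgrowth⟩ := hgrowth
  have hsub : ∀ n : ℕ, (insert s A) ^ n ⊆
      Set.image2 (fun (a : ℕ) w => w * s ^ a) (Set.Iic n) (W ^ (n * (n + 1) ^ c)) := by
    intro n
    induction n with
    | zero => simp
    | succ n ih =>
      rw [pow_succ]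
      rintro _ ⟨g, hg, u, hu, rfl⟩
      obtain ⟨a, ha, w, hw, rfl⟩ := ih hg
      have ha : a ≤ n := ha
      have hle : n * (n + 1) ^ c + (n + 1) ^ c ≤ (n + 1) * (n + 1 + 1) ^ c := by
        rw [← Nat.succ_mul]
        gcongr
        omega
      rcases hu with rfl | hu
      · refine ⟨a + 1, by simpa using ha, w, Set.pow_subset_pow_right h1 ?_ hw, ?_⟩
        · exact (Nat.le_add_right _ _).trans hle
        · simp [pow_succ, mul_assoc]
      · have hconj := pow_conj_mem_pow h1 s c u (hA u hu) (hc u hu) a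
        have hconj' : s ^ a * u * (s ^ a)⁻¹ ∈ W ^ ((n + 1) ^ c) :=
          Set.pow_subset_pow_right h1 (by gcongr) hconj
        have hmul := Set.mul_mem_mul hw hconj'
        rw [← pow_add] at hmul
        refine ⟨a, by simp; omega, _, Set.pow_subset_pow_right h1 hle hmul, ?_⟩
        simp [mul_assoc]
  refine ⟨C, (c + 1) * p + 1, fun n => ?_⟩
  have hfin : (W ^ (n * (n + 1) ^ c)).Finite := hW.pow_of_group _
  calc ((insert s A) ^ n).ncard
      ≤ (Set.image2 (fun (a : ℕ) w => w * s ^ a) (Set.Iic n) (W ^ (n * (n + 1) ^ c))).ncard :=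
        Set.ncard_le_ncard (hsub n) ((Set.finite_Iic n).image2 _ hfin)
    _ ≤ (Set.Iic n ×ˢ (W ^ (n * (n + 1) ^ c))).ncard := by
        rw [← Set.image_uncurry_prod]
        exact Set.ncard_image_le ((Set.finite_Iic n).prod hfin)
    _ = (n + 1) * (W ^ (n * (n + 1) ^ c)).ncard := by
        rw [Set.ncard_prod, Set.ncard_eq_toFinset_card']
        simp
    _ ≤ (n + 1) * (C * (n * (n + 1) ^ c + 1) ^ p) := by gcongr; exact hgrowth _
    _ ≤ (n + 1) * (C * ((n + 1) ^ (c + 1)) ^ p) := by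
        have : n * (n + 1) ^ c + 1 ≤ (n + 1) ^ (c + 1) := by
          have := Nat.one_le_pow c (n + 1) (by omega)
          rw [pow_succ]
          nlinarith
        gcongr
    _ = C * (n + 1) ^ ((c + 1) * p + 1) := by rw [pow_succ _ (_ * p), pow_mul]; ring

theorem hasPolyGrowth_of_isNilpotent {H : Type*} [Group H] [Group.IsNilpotent H] {S : Set H}
    (hS : S.Finite) : HasPolyGrowth S := by
  obtain ⟨c, hc⟩ := Subgroup.nilpotent_iff_lowerCentralSeries.1 ‹Group.IsNilpotent H›
  set γ := (⊤ : Subgroup H).lowerCentralSeries with hγ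
  have hcomm : ∀ (s : H) (i : ℕ), ∀ u ∈ γ i, ⁅s, u⁆ ∈ γ (i + 1) := by
    intro s i u hu
    rw [hγ, Subgroup.lowerCentralSeries_succ, Subgroup.commutator_comm]
    exact Subgroup.commutator_mem_commutator (Subgroup.mem_top s) hu
  have hiter : ∀ (s : H) (j i : ℕ), ∀ u ∈ γ i, (fun v => ⁅s, v⁆)^[j] u ∈ γ (i + j) := by
    intro s j
    induction j with
    | zero => intro i u hu; exact hu
    | succ j ih =>
      intro i u hu
      rw [Function.iterate_succ_apply']
      exact hcomm s _ _ (ih i u hu)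
  have hanti : Antitone γ := Subgroup.lowerCentralSeries_antitone _
  have key : ∀ k i : ℕ, i + k = c → ∀ S : Set H, S.Finite → S ⊆ γ i → HasPolyGrowth S := by
    intro k
    induction k with
    | zero =>
      intro i hi S hS hSi
      refine ⟨1, 0, fun n => ?_⟩
      have hone : S ^ n ⊆ {1} := by
        have hsub : S ⊆ (1 : Set H) := by
          intro g hg
          have := hSi hg
          rw [show i = c by omega, hc] at this
          simpa using this
        exact (Set.pow_subset_pow_left hsub).trans_eq (by rw [one_pow, Set.singleton_one])
      simpa using Set.ncard_le_ncard hone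
    | succ k ih =>
      intro i hi S hS hSi
      suffices h : ∀ B : Set H, B.Finite → B ⊆ γ (i + 1) → HasPolyGrowth (S ∪ B) by
        simpa using h ∅ Set.finite_empty (Set.empty_subset _)
      induction S, hS using Set.Finite.induction_on with
      | empty => intro B hB hBi; simpa using ih (i + 1) (by omega) B hB hBi
      | @insert s A _ hA ihA =>
        intro B hB hBi
        have hAi : A ⊆ γ i := (Set.subset_insert s A).trans hSi
        have hABi : A ∪ B ⊆ γ i := Set.union_subset hAi (hBi.trans (hanti (Nat.le_succ i)))
        set B' : Set H :=
          {1} ∪ B ∪ ⋃ j ∈ Set.Iio c, (fun v => ⁅s, v⁆)^[j + 1] '' (A ∪ B) with hB'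
        have hB'fin : B'.Finite :=
          ((Set.finite_singleton 1).union hB).union
            ((Set.finite_Iio c).biUnion fun j _ => (hA.union hB).image _)
        have hB'i : B' ⊆ γ (i + 1) := by
          refine Set.union_subset (Set.union_subset (by simp) hBi) ?_
          refine Set.iUnion₂_subset fun j _ => ?_
          rintro _ ⟨t, ht, rfl⟩
          exact hanti (by omega) (hiter s (j + 1) i t (hABi ht))
        rw [Set.insert_union]
        refine hasPolyGrowth_insert (W := A ∪ B') (hA.union hB'fin) (by simp [hB']) s c ?_ ?_
          (ihA hAi B' hB'fin hB'i)
        · rintro t ht (_ | j) hj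
          · rcases ht with ht | ht
            · exact Or.inl ht
            · exact Or.inr (Or.inl (Or.inr ht))
          · exact Or.inr (Or.inr (Set.mem_biUnion (Set.mem_Iio.2 hj) ⟨t, ht, rfl⟩))
        · intro t ht
          have := hanti (Nat.le_add_left c i) (hiter s c i t (hABi ht))
          rwa [hc, Subgroup.mem_bot] at this
  exact key c 0 (by simp) S hS (by simp [hγ])

/-- A set of polynomial growth has powers of bounded doubling at arbitrarily large scales. -/
theorem HasPolyGrowth.exists_doubling {H : Type*} [Group H] {S : Set H} (hS : S.Finite)
    (h1 : 1 ∈ S) (h : HasPolyGrowth S) (m : ℕ) :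
    ∃ K : ℕ, ∀ r : ℕ, ∃ s, r ≤ s ∧ (S ^ (m * s)).ncard ≤ K * (S ^ s).ncard := by
  obtain ⟨C, p, h⟩ := h
  refine ⟨2 * (m + 1) ^ p, fun r => ?_⟩
  by_contra! hlt
  have hgrow : ∀ i : ℕ, (2 * (m + 1) ^ p) ^ i ≤ (S ^ ((m + 1) ^ i * r)).ncard := by
    intro i
    induction i with
    | zero =>
      rw [pow_zero]
      refine (Set.ncard_pos (hS.pow_of_group _)).2 ?_
      exact ⟨1, Set.one_mem_pow h1⟩
    | succ i ih =>
      calc (2 * (m + 1) ^ p) ^ (i + 1) = (2 * (m + 1) ^ p) * (2 * (m + 1) ^ p) ^ i := by ring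
        _ ≤ (2 * (m + 1) ^ p) * (S ^ ((m + 1) ^ i * r)).ncard := by gcongr
        _ ≤ (S ^ (m * ((m + 1) ^ i * r))).ncard :=
          (hlt _ (Nat.le_mul_of_pos_left r (by positivity))).le
        _ ≤ (S ^ ((m + 1) ^ (i + 1) * r)).ncard := by
          refine Set.ncard_le_ncard (Set.pow_subset_pow_right h1 ?_) (hS.pow_of_group _)
          calc m * ((m + 1) ^ i * r) ≤ (m + 1) * ((m + 1) ^ i * r) := by gcongr; omega
            _ = (m + 1) ^ (i + 1) * r := by ring
  have hbound : ∀ i : ℕ, 2 ^ i ≤ C * (r + 1) ^ p := by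
    intro i
    have hle : (2 * (m + 1) ^ p) ^ i ≤ C * (r + 1) ^ p * ((m + 1) ^ p) ^ i := by
      calc (2 * (m + 1) ^ p) ^ i ≤ C * ((m + 1) ^ i * r + 1) ^ p := (hgrow i).trans (h _)
        _ ≤ C * ((m + 1) ^ i * (r + 1)) ^ p := by
          have := Nat.one_le_pow i (m + 1) (by omega)
          gcongr
          nlinarith
        _ = C * (r + 1) ^ p * ((m + 1) ^ p) ^ i := by
          rw [mul_pow, ← pow_mul, ← pow_mul, mul_comm i p]; ring
    rw [mul_pow] at hle
    exact Nat.le_of_mul_le_mul_right hle (by positivity)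
  exact absurd (hbound (C * (r + 1) ^ p)) (Nat.not_le.2 Nat.lt_two_pow_self)

section Action

variable {G X : Type*} [Group G] [MulAction G X]

/-- `y` is reached from `x` by applying `r` elements of `S`. -/
def OrbitBall (S : Set G) (r : ℕ) (x y : X) : Prop := ∃ g ∈ S ^ r, g • x = y

theorem OrbitBall.refl {S : Set G} (h1 : 1 ∈ S) (r : ℕ) (x : X) : OrbitBall S r x x :=
  ⟨1, Set.one_mem_pow h1, one_smul _ _⟩

theorem OrbitBall.symm {S : Set G} (hinv : S⁻¹ = S) {r : ℕ} {x y : X} (h : OrbitBall S r x y) :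
    OrbitBall S r y x := by
  obtain ⟨g, hg, rfl⟩ := h
  refine ⟨g⁻¹, ?_, inv_smul_smul g x⟩
  rw [← hinv, inv_pow]
  simpa using hg

theorem OrbitBall.trans {S : Set G} {r s : ℕ} {x y z : X} (h : OrbitBall S r x y)
    (h' : OrbitBall S s y z) : OrbitBall S (r + s) x z := by
  obtain ⟨g, hg, rfl⟩ := h
  obtain ⟨g', hg', rfl⟩ := h'
  exact ⟨g' * g, by rw [add_comm, pow_add]; exact Set.mul_mem_mul hg' hg, mul_smul _ _ _⟩

theorem OrbitBall.mono {S T : Set G} (h1 : 1 ∈ S) (hST : S ⊆ T) {r s : ℕ} (hrs : r ≤ s) {x y : X}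
    (h : OrbitBall S r x y) : OrbitBall T s x y := by
  obtain ⟨g, hg, rfl⟩ := h
  exact ⟨g, Set.pow_subset_pow_left hST (Set.pow_subset_pow_right h1 hrs hg), rfl⟩

theorem OrbitBall.finite {S : Set G} (hS : S.Finite) (r : ℕ) (x : X) :
    {y | OrbitBall S r x y}.Finite :=
  ((hS.pow_of_group r).image (· • x)).subset fun _ ⟨g, hg, h⟩ => ⟨g, hg, h⟩

variable [MeasurableSpace X]

variable (G) in
/-- The restriction of the relation `R` to every orbit is Borel. -/
def BorelOnOrbits (R : X → X → Prop) : Prop := ∀ g : G, MeasurableSet {x | R x (g • x)}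

theorem BorelOnOrbits.measurableSet_smul_smul (hBorel : ∀ g : G, Measurable fun x : X => g • x)
    {R : X → X → Prop} (hR : BorelOnOrbits G R) (g h : G) :
    MeasurableSet {x : X | R (g • x) (h • x)} := by
  have := hBorel g (hR (h * g⁻¹))
  simpa [Set.preimage, mul_smul] using this

theorem BorelOnOrbits.measurableSet_prod [Countable G] [MeasurableEq X]
    (hBorel : ∀ g : G, Measurable fun x : X => g • x) {R : X → X → Prop}
    (hR : BorelOnOrbits G R) (hRorb : ∀ x y, R x y → ∃ g : G, g • x = y) :
    MeasurableSet {p : X × X | R p.1 p.2} := by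
  have heq : {p : X × X | R p.1 p.2} =
      ⋃ g : G, {p : X × X | g • p.1 = p.2} ∩ Prod.fst ⁻¹' {x | R x (g • x)} := by
    ext ⟨x, y⟩
    simp only [Set.mem_ofPred_eq, Set.mem_iUnion, Set.mem_inter_iff, Set.mem_preimage]
    constructor
    · intro h
      obtain ⟨g, rfl⟩ := hRorb x y h
      exact ⟨g, rfl, h⟩
    · rintro ⟨g, rfl, h⟩
      exact h
  rw [heq]
  exact MeasurableSet.iUnion fun g =>
    (measurableSet_eq_fun ((hBorel g).comp measurable_fst) measurable_snd).inter
      (measurable_fst (hR g))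

/-- For a finite set `T` of group elements, the space is a countable union of Borel sets none of
which contains two distinct points of the form `x` and `t • x` with `t ∈ T`. -/
theorem exists_borel_separated_cover [StandardBorelSpace X]
    (hBorel : ∀ g : G, Measurable fun x : X => g • x) {T : Set G} (hT : T.Finite) :
    ∃ A : ℕ → Set X, (∀ k, MeasurableSet (A k)) ∧
      (∀ k, ∀ x ∈ A k, ∀ t ∈ T, t • x ∈ A k → t • x = x) ∧ ∀ x, ∃ k, x ∈ A k := by
  obtain ⟨f, hf, hinj⟩ := MeasurableSpace.measurable_injection_nat_bool_of_countablySeparated X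
  obtain ⟨w, hw⟩ := exists_surjective_nat (List Bool)
  set B : ℕ → Set X := fun k => {x | ∀ i : Fin (w k).length, f x i = (w k).get i} with hB
  have hBmeas : ∀ k, MeasurableSet (B k) := fun k => by
    simp only [hB, Set.ofPred_forall]
    exact MeasurableSet.iInter fun i =>
      measurableSet_eq_fun ((measurable_pi_apply _).comp hf) measurable_const
  refine ⟨fun k => B k ∩ ⋂ t ∈ T, {x | t • x = x} ∪ (fun x => t • x) ⁻¹' (B k)ᶜ, fun k => ?_,
    fun k x hx t ht htx => ?_, fun x => ?_⟩
  · exact (hBmeas k).inter (MeasurableSet.biInter hT.countable fun t _ =>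
      (measurableSet_eq_fun (hBorel t) measurable_id).union (hBorel t (hBmeas k).compl))
  · rcases Set.mem_iInter₂.1 hx.2 t ht with h | h
    · exact h
    · exact absurd htx.1 h
  · have hsep : ∀ t : G, ∃ n, t • x ≠ x → ∃ i < n, f (t • x) i ≠ f x i := by
      intro t
      by_cases h : t • x = x
      · exact ⟨0, fun h' => absurd h h'⟩
      · obtain ⟨i, hi⟩ := Function.ne_iff.1 (hinj.ne h)
        exact ⟨i + 1, fun _ => ⟨i, i.lt_succ_self, hi⟩⟩
    choose n hn using hsep
    obtain ⟨N, hN⟩ := (hT.image n).bddAbove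
    obtain ⟨k, hk⟩ := hw (List.ofFn fun i : Fin N => f x i)
    have hmem : ∀ y, y ∈ B k ↔ ∀ i < N, f y i = f x i := by
      intro y
      simp only [hB, Set.mem_ofPred_eq]
      rw [hk]
      constructor
      · intro h i hi
        simpa using h ⟨i, by simpa using hi⟩
      · intro h i
        have hi : (i : ℕ) < N := by simpa using i.2
        simpa using h i hi
    refine ⟨k, (hmem x).2 fun _ _ => rfl, Set.mem_iInter₂.2 fun t ht => ?_⟩
    by_cases h : t • x = x
    · exact Or.inl h
    · refine Or.inr fun hB => ?_
      obtain ⟨i, hi, hne⟩ := hn t h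
      exact hne ((hmem _).1 hB i (hi.trans_le (hN ⟨t, ht, rfl⟩)))

/-- Every Borel set contains a maximal `T`-separated Borel subset. -/
theorem exists_borel_maximal_separated [StandardBorelSpace X]
    (hBorel : ∀ g : G, Measurable fun x : X => g • x) {T : Set G} (hT : T.Finite) (hinv : T⁻¹ = T)
    {Y : Set X} (hY : MeasurableSet Y) :
    ∃ Z ⊆ Y, MeasurableSet Z ∧ (∀ x ∈ Z, ∀ t ∈ T, t • x ∈ Z → t • x = x) ∧
      ∀ y ∈ Y, y ∈ Z ∨ ∃ t ∈ T, t • y ∈ Z := by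
  obtain ⟨A, hA, hsep, hcov⟩ := exists_borel_separated_cover hBorel hT
  let Z : ℕ → Set X := fun k => Nat.rec ∅
    (fun k W => W ∪ (Y ∩ A k ∩ ⋂ t ∈ T, (fun x => t • x) ⁻¹' Wᶜ)) k
  have hZs : ∀ k, Z (k + 1) = Z k ∪ (Y ∩ A k ∩ ⋂ t ∈ T, (fun x => t • x) ⁻¹' (Z k)ᶜ) :=
    fun _ => rfl
  have hmono : Monotone Z := monotone_nat_of_le_succ fun k => by
    rw [hZs]; exact Set.subset_union_left
  have hZY : ∀ k, Z k ⊆ Y := by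
    intro k
    induction k with
    | zero => exact Set.empty_subset _
    | succ k ih => rw [hZs]; exact Set.union_subset ih fun x hx => hx.1.1
  have hZmeas : ∀ k, MeasurableSet (Z k) := by
    intro k
    induction k with
    | zero => exact MeasurableSet.empty
    | succ k ih =>
      rw [hZs]
      exact ih.union ((hY.inter (hA k)).inter
        (MeasurableSet.biInter hT.countable fun t _ => hBorel t ih.compl))
  have hZsep : ∀ k, ∀ x ∈ Z k, ∀ t ∈ T, t • x ∈ Z k → t • x = x := by
    intro k
    induction k with
    | zero => intro x hx; exact absurd hx (Set.notMem_empty x)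
    | succ k ih =>
      rw [hZs]
      rintro x (hx | hx) t ht (htx | htx)
      · exact ih x hx t ht htx
      · have ht' : t⁻¹ ∈ T := by rw [← hinv]; simpa using ht
        have := Set.mem_iInter₂.1 htx.2 t⁻¹ ht'
        simp only [Set.mem_preimage, inv_smul_smul] at this
        exact absurd hx this
      · exact absurd htx (Set.mem_iInter₂.1 hx.2 t ht)
      · exact hsep k x hx.1.2 t ht htx.1.2
  refine ⟨⋃ k, Z k, Set.iUnion_subset hZY, MeasurableSet.iUnion hZmeas, ?_, fun y hy => ?_⟩
  · intro x hx t ht htx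
    obtain ⟨k, hk⟩ := Set.mem_iUnion.1 hx
    obtain ⟨k', hk'⟩ := Set.mem_iUnion.1 htx
    exact hZsep _ x (hmono (le_max_left k k') hk) t ht (hmono (le_max_right k k') hk')
  · obtain ⟨k, hk⟩ := hcov y
    rcases Classical.em (∃ t : G, t ∈ T ∧ t • y ∈ Z k) with ⟨t, ht, hty⟩ | h
    · exact Or.inr ⟨t, ht, Set.mem_iUnion.2 ⟨k, hty⟩⟩
    · refine Or.inl (Set.mem_iUnion.2 ⟨k + 1, ?_⟩)
      rw [hZs]
      exact Or.inr ⟨⟨hy, hk⟩, Set.mem_iInter₂.2 fun t ht hty => h ⟨t, ht, hty⟩⟩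

/-- A Borel partial equivalence relation on `X` whose classes have `S`-diameter at most `δ` and
such that distinct classes are at `S`-distance more than `r`. -/
structure IsSeparatedFamily (S : Set G) (r δ : ℕ) (U : X → X → Prop) : Prop where
  symm : ∀ x y, U x y → U y x
  trans : ∀ x y z, U x y → U y z → U x z
  borel : BorelOnOrbits G U
  bounded : ∀ x y, U x y → OrbitBall S δ x y
  gap : ∀ x y, U x x → U y y → OrbitBall S r x y → U x y

/-- If `S` has bounded doubling at arbitrarily large scales then the action has finite Borel
asymptotic dimension with respect to `S`. -/
theorem exists_separatedFamily_cover [StandardBorelSpace X]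
    (hBorel : ∀ g : G, Measurable fun x : X => g • x) {S : Set G} (hS : S.Finite) (h1 : 1 ∈ S)
    (hinv : S⁻¹ = S) {K : ℕ}
    (hK : ∀ r : ℕ, ∃ s, r ≤ s ∧ (S ^ (8 * s)).ncard ≤ K * (S ^ s).ncard) (r : ℕ) :
    ∃ (δ : ℕ) (U : ℕ → X → X → Prop), (∀ j, IsSeparatedFamily S r δ (U j)) ∧
      ∀ x, ∃ j ≤ K, ∀ y, OrbitBall S r x y → U j x y := by
  obtain ⟨s, hrs, hs⟩ := hK r
  have hinv' : ∀ n : ℕ, (S ^ n)⁻¹ = S ^ n := fun n => by rw [← inv_pow, hinv]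
  have hstep : ∀ W : {W : Set X // MeasurableSet W}, ∃ Z : {Z : Set X // MeasurableSet Z},
      (∀ z ∈ Z.1, ∀ g ∈ S ^ (2 * s), g • z ∉ W.1) ∧
      (∀ z ∈ Z.1, ∀ g ∈ S ^ (7 * s), g • z ∈ Z.1 → g • z = z) ∧
      ∀ x, (∀ g ∈ S ^ (2 * s), g • x ∉ W.1) → ∃ g ∈ S ^ (7 * s), g • x ∈ Z.1 := by
    rintro ⟨W, hW⟩
    obtain ⟨Z, hZY, hZ, hsep, hmax⟩ := exists_borel_maximal_separated hBorel
      (hS.pow_of_group (7 * s)) (hinv' _) (Y := ⋂ g ∈ S ^ (2 * s), (fun x => g • x) ⁻¹' Wᶜ)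
      (MeasurableSet.biInter (hS.pow_of_group _).countable fun g _ => hBorel g hW.compl)
    refine ⟨⟨Z, hZ⟩, fun z hz g hg => Set.mem_iInter₂.1 (hZY hz) g hg, hsep, fun x hx => ?_⟩
    rcases hmax x (Set.mem_iInter₂.2 hx) with h | h
    · exact ⟨1, Set.one_mem_pow h1, by simpa using h⟩
    · exact h
  choose M hMW hMsep hMmax using hstep
  let W : ℕ → {W : Set X // MeasurableSet W} := fun j =>
    Nat.rec ⟨∅, MeasurableSet.empty⟩ (fun _ W => ⟨W.1 ∪ (M W).1, W.2.union (M W).2⟩) j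
  have hWs : ∀ j, (W (j + 1)).1 = (W j).1 ∪ (M (W j)).1 := fun _ => rfl
  set Z : ℕ → Set X := fun j => (M (W j)).1 with hZdef
  have hWmono : Monotone fun j => (W j).1 := monotone_nat_of_le_succ fun j => by
    rw [hWs]; exact Set.subset_union_left
  have hZW : ∀ i j, i < j → Z i ⊆ (W j).1 := fun i j hij =>
    (show Z i ⊆ (W (i + 1)).1 by rw [hWs]; exact Set.subset_union_right).trans (hWmono hij)
  have hWZ : ∀ j, ∀ x ∈ (W j).1, ∃ i < j, x ∈ Z i := by
    intro j
    induction j with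
    | zero => intro x hx; exact absurd hx (Set.notMem_empty x)
    | succ j ih =>
      rw [hWs]
      rintro x (hx | hx)
      · obtain ⟨i, hi, h⟩ := ih x hx
        exact ⟨i, hi.trans j.lt_succ_self, h⟩
      · exact ⟨j, j.lt_succ_self, hx⟩
  have hsep : ∀ j, ∀ z ∈ Z j, ∀ z' ∈ Z j, OrbitBall S (7 * s) z z' → z = z' := by
    rintro j z hz _ hz' ⟨g, hg, rfl⟩
    exact (hMsep _ z hz g hg hz').symm
  have hcover : ∀ x, ∃ j ≤ K, ∃ z ∈ Z j, OrbitBall S (2 * s) x z := by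
    intro x
    by_contra! hno
    have hfar : ∀ j : Fin (K + 1), ∃ g ∈ S ^ (7 * s), g • x ∈ Z j := by
      intro j
      refine hMmax _ x fun g hg hgW => ?_
      obtain ⟨i, hi, hgi⟩ := hWZ _ _ hgW
      exact hno i (by omega) _ hgi ⟨g, hg, rfl⟩
    choose g hg hgZ using hfar
    have hne : ∀ i j : Fin (K + 1), i < j → ∀ a ∈ S ^ s, ∀ b ∈ S ^ s, a * g i ≠ b * g j := by
      intro i j hij a ha b hb hab
      refine hMW (W j) (g j • x) (hgZ j) (a⁻¹ * b) ?_ ?_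
      · rw [two_mul, pow_add]
        exact Set.mul_mem_mul (by rw [← hinv' s]; simpa using ha) hb
      · have : (a⁻¹ * b) • g j • x = g i • x := by
          rw [smul_smul, mul_assoc, ← hab, inv_mul_cancel_left]
        rw [this]
        exact hZW i j hij (hgZ i)
    have hinj : Set.InjOn (fun p : Fin (K + 1) × G => p.2 * g p.1) (Set.univ ×ˢ (S ^ s)) := by
      rintro ⟨i, a⟩ ⟨-, ha⟩ ⟨j, b⟩ ⟨-, hb⟩ hab
      rcases lt_trichotomy i j with hij | rfl | hij
      · exact absurd hab (hne i j hij a ha b hb)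
      · simpa using hab
      · exact absurd hab.symm (hne j i hij b hb a ha)
    have hle : (Set.univ ×ˢ (S ^ s) : Set (Fin (K + 1) × G)).ncard ≤ (S ^ (8 * s)).ncard := by
      refine Set.ncard_le_ncard_of_injOn _ ?_ hinj (hS.pow_of_group _)
      rintro ⟨i, a⟩ ⟨-, ha⟩
      rw [show 8 * s = s + 7 * s by ring, pow_add]
      exact Set.mul_mem_mul ha (hg i)
    rw [Set.ncard_prod, Set.ncard_univ, Nat.card_eq_fintype_card, Fintype.card_fin] at hle
    have hpos : 0 < (S ^ s).ncard :=
      (Set.ncard_pos (hS.pow_of_group _)).2 ⟨1, Set.one_mem_pow h1⟩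
    nlinarith
  refine ⟨3 * s + 3 * s, fun j x y => ∃ z ∈ Z j, OrbitBall S (3 * s) z x ∧ OrbitBall S (3 * s) z y,
    fun j => ⟨?_, ?_, ?_, ?_, ?_⟩, fun x => ?_⟩
  · rintro x y ⟨z, hz, hx, hy⟩
    exact ⟨z, hz, hy, hx⟩
  · rintro x y w ⟨z, hz, hx, hy⟩ ⟨z', hz', hy', hw⟩
    have := hsep j z hz z' hz'
      ((hy.trans (hy'.symm hinv)).mono h1 subset_rfl (by omega))
    exact ⟨z, hz, hx, this ▸ hw⟩
  · intro g
    have heq : {x | ∃ z ∈ Z j, OrbitBall S (3 * s) z x ∧ OrbitBall S (3 * s) z (g • x)} =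
        ⋃ a ∈ S ^ (3 * s), ⋃ k ∈ S ^ (3 * s),
          (fun x => a⁻¹ • x) ⁻¹' Z j ∩ {x | k • a⁻¹ • x = g • x} := by
      ext x
      simp only [Set.mem_ofPred_eq, Set.mem_iUnion, Set.mem_inter_iff, Set.mem_preimage,
        exists_prop]
      constructor
      · rintro ⟨z, hz, ⟨a, ha, rfl⟩, k, hk, hkx⟩
        exact ⟨a, ha, k, hk, by simpa using hz, by simpa using hkx⟩
      · rintro ⟨a, ha, k, hk, hz, hkx⟩
        exact ⟨_, hz, ⟨a, ha, smul_inv_smul a x⟩, k, hk, hkx⟩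
    rw [heq]
    exact MeasurableSet.biUnion (hS.pow_of_group _).countable fun a _ =>
      MeasurableSet.biUnion (hS.pow_of_group _).countable fun k _ =>
        (hBorel a⁻¹ (M (W j)).2).inter
          (measurableSet_eq_fun ((hBorel k).comp (hBorel a⁻¹)) (hBorel g))
  · rintro x y ⟨z, hz, hx, hy⟩
    exact (hx.symm hinv).trans hy
  · rintro x y ⟨z, hz, hx, -⟩ ⟨z', hz', hy, -⟩ hxy
    have := hsep j z hz z' hz'
      (((hx.trans hxy).trans (hy.symm hinv)).mono h1 subset_rfl (by omega))
    exact ⟨z, hz, hx, this ▸ hy⟩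
  · obtain ⟨j, hj, z, hz, hxz⟩ := hcover x
    refine ⟨j, hj, fun y hxy => ⟨z, hz, ?_, ?_⟩⟩
    · exact (hxz.symm hinv).mono h1 subset_rfl (by omega)
    · exact ((hxz.symm hinv).trans hxy).mono h1 subset_rfl (by omega)

end Action

section Join

variable {G X : Type*} [Group G] [MulAction G X]

/-- The relation generated by `F` and the classes of `Q`, when these are far apart. -/
def RelJoin (F Q : X → X → Prop) (x y : X) : Prop :=
  F x y ∨ ∃ x' y', F x x' ∧ Q x' y' ∧ F y' y

theorem RelJoin.of_right {F Q : X → X → Prop} (hF : ∀ x, F x x) {x y : X} (h : Q x y) :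
    RelJoin F Q x y :=
  Or.inr ⟨x, y, hF x, h, hF y⟩

theorem RelJoin.equivalence {S : Set G} {F Q : X → X → Prop} {w r δ : ℕ} [MeasurableSpace X]
    (h1 : 1 ∈ S) (hF : Equivalence F) (hFb : ∀ x y, F x y → OrbitBall S w x y)
    (hQ : IsSeparatedFamily S r δ Q) (hw : w ≤ r) : Equivalence (RelJoin F Q) := by
  refine ⟨fun x => Or.inl (hF.refl x), ?_, ?_⟩
  · rintro x y (h | ⟨x', y', h, h', h''⟩)
    · exact Or.inl (hF.symm h)
    · exact Or.inr ⟨y', x', hF.symm h'', hQ.symm _ _ h', hF.symm h⟩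
  · rintro x y z (h | ⟨x', y', h, h', h''⟩) (k | ⟨y₁, z', k, k', k''⟩)
    · exact Or.inl (hF.trans h k)
    · exact Or.inr ⟨y₁, z', hF.trans h k, k', k''⟩
    · exact Or.inr ⟨x', y', h, h', hF.trans h'' k⟩
    · refine Or.inr ⟨x', z', h, hQ.trans _ _ _ h' (hQ.trans _ _ _ ?_ k'), k''⟩
      exact hQ.gap _ _ (hQ.trans _ _ _ (hQ.symm _ _ h') h') (hQ.trans _ _ _ k' (hQ.symm _ _ k'))
        ((hFb _ _ (hF.trans h'' k)).mono h1 subset_rfl hw)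

theorem RelJoin.bounded {S : Set G} {F Q : X → X → Prop} {w δ : ℕ} (h1 : 1 ∈ S)
    (hFb : ∀ x y, F x y → OrbitBall S w x y) (hQ : ∀ x y, Q x y → OrbitBall S δ x y) (x y : X)
    (h : RelJoin F Q x y) : OrbitBall S (δ + 2 * w) x y := by
  obtain h | ⟨x', y', h, h', h''⟩ := h
  · exact (hFb _ _ h).mono h1 subset_rfl (by omega)
  · exact (((hFb _ _ h).trans (hQ _ _ h')).trans (hFb _ _ h'')).mono h1 subset_rfl (by omega)

theorem BorelOnOrbits.relJoin [MeasurableSpace X] [Countable G]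
    (hBorel : ∀ g : G, Measurable fun x : X => g • x) {F Q : X → X → Prop}
    (hF : BorelOnOrbits G F) (hQ : BorelOnOrbits G Q)
    (hForb : ∀ x y, F x y → ∃ g : G, g • x = y) (hQorb : ∀ x y, Q x y → ∃ g : G, g • x = y) :
    BorelOnOrbits G (RelJoin F Q) := by
  intro g
  have heq : {x | RelJoin F Q x (g • x)} = {x | F x (g • x)} ∪ ⋃ a : G, ⋃ c : G,
      {x | F ((1 : G) • x) (a • x)} ∩ {x | Q (a • x) (c • x)} ∩ {x | F (c • x) (g • x)} := by
    ext x
    simp only [RelJoin, Set.mem_ofPred_eq, Set.mem_union, Set.mem_iUnion, Set.mem_inter_iff,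
      one_smul]
    refine or_congr_right ⟨?_, ?_⟩
    · rintro ⟨x', y', h, h', h''⟩
      obtain ⟨a, rfl⟩ := hForb _ _ h
      obtain ⟨c, rfl⟩ := hQorb _ _ h'
      exact ⟨a, c * a, ⟨h, by rwa [mul_smul]⟩, by rwa [mul_smul]⟩
    · rintro ⟨a, c, ⟨h, h'⟩, h''⟩
      exact ⟨_, _, h, h', h''⟩
  rw [heq]
  exact (hF g).union (MeasurableSet.iUnion fun a => MeasurableSet.iUnion fun c =>
    ((hF.measurableSet_smul_smul hBorel 1 a).inter
      (hQ.measurableSet_smul_smul hBorel a c)).inter (hF.measurableSet_smul_smul hBorel c g))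

theorem OrbitBall.borelOnOrbits [MeasurableSpace X] [StandardBorelSpace X]
    (hBorel : ∀ g : G, Measurable fun x : X => g • x) {S : Set G} (hS : S.Finite) (r : ℕ) :
    BorelOnOrbits G (OrbitBall S r : X → X → Prop) := by
  intro g
  have heq : {x : X | OrbitBall S r x (g • x)} = ⋃ a ∈ S ^ r, {x | a • x = g • x} := by
    ext x
    simp [OrbitBall]
  rw [heq]
  exact MeasurableSet.biUnion (hS.pow_of_group _).countable fun a _ =>
    measurableSet_eq_fun (hBorel a) (hBorel g)

end Join

section Cover

variable (G X : Type*) [Group G] [MulAction G X] [MeasurableSpace X]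

/-- An exhaustion of `G` by finite symmetric sets `S b`, together with, for each of them, Borel
covers of `X` by `d b + 1` separated families at every scale. -/
structure CoverData where
  S : ℕ → Set G
  d : ℕ → ℕ
  δ : ℕ → ℕ → ℕ
  U : ℕ → ℕ → ℕ → X → X → Prop
  finite : ∀ b, (S b).Finite
  one_mem : ∀ b, 1 ∈ S b
  inv_eq : ∀ b, (S b)⁻¹ = S b
  mono : ∀ b, S b ⊆ S (b + 1)
  exhaust : ∀ g, ∃ b, g ∈ S b
  separated : ∀ b r j, IsSeparatedFamily (S b) r (δ b r) (U b r j)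
  cover : ∀ b r x, ∃ j ≤ d b, ∀ y, OrbitBall (S b) r x y → U b r j x y

namespace CoverData

variable {G X} (A : CoverData G X)

/-- The ball relation of radius `r` for the `b`-th generating set. -/
def N (b r : ℕ) : X → X → Prop := OrbitBall (A.S b) r

theorem N_refl (b r : ℕ) (x : X) : A.N b r x x := OrbitBall.refl (A.one_mem b) r x

variable {A} in
theorem N.symm {b r : ℕ} {x y : X} (h : A.N b r x y) : A.N b r y x :=
  OrbitBall.symm (A.inv_eq b) h

variable {A} in
theorem N.trans {b r s : ℕ} {x y z : X} (h : A.N b r x y) (h' : A.N b s y z) :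
    A.N b (r + s) x z :=
  OrbitBall.trans h h'

variable {A} in
theorem N.mono {b r s : ℕ} (hrs : r ≤ s) {x y : X} (h : A.N b r x y) : A.N b s x y :=
  OrbitBall.mono (A.one_mem b) subset_rfl hrs h

variable {A} in
theorem N.succ {b r s : ℕ} (hrs : r ≤ s) {x y : X} (h : A.N b r x y) : A.N (b + 1) s x y :=
  OrbitBall.mono (A.one_mem b) (A.mono b) hrs h

variable {A} in
theorem N.exists_smul {b r : ℕ} {x y : X} (h : A.N b r x y) : ∃ g : G, g • x = y :=
  let ⟨g, _, hg⟩ := h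
  ⟨g, hg⟩

/-- The pair consisting of the base radius and of the diameter bound at level `b`. -/
def scale : ℕ → ℕ × ℕ
  | 0 => (1, 0)
  | b + 1 =>
    let R := (scale b).1 * 4 ^ A.d (b + 1)
    let w := A.δ b R + 2 * (scale b).2 + 2 * (scale b).2
    (R + w + 1, w)

/-- The base radius at level `b`. -/
def γ (b : ℕ) : ℕ := (A.scale b).1

/-- The diameter bound for the relation obtained from the levels below `b`. -/
def w (b : ℕ) : ℕ := (A.scale b).2

/-- The largest radius used at level `b`. -/
def R (b : ℕ) : ℕ := A.γ b * 4 ^ A.d (b + 1)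

/-- The diameter bound for the relations of level `b`. -/
def D (b : ℕ) : ℕ := A.δ b (A.R b) + 2 * A.w b

/-- The decreasing sequence of radii used at level `b`. -/
def T (b l : ℕ) : ℕ := A.γ b * 4 ^ (A.d (b + 1) - l)

theorem w_succ (b : ℕ) : A.w (b + 1) = A.D b + 2 * A.w b := rfl

theorem γ_succ (b : ℕ) : A.γ (b + 1) = A.R b + A.w (b + 1) + 1 := rfl

theorem w_le_γ (b : ℕ) : A.w b ≤ A.γ b := by
  cases b with
  | zero => exact Nat.zero_le _
  | succ b => rw [γ_succ]; omega

theorem one_le_γ (b : ℕ) : 1 ≤ A.γ b := by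
  cases b with
  | zero => exact le_rfl
  | succ b => rw [γ_succ]; omega

theorem γ_le_T (b l : ℕ) : A.γ b ≤ A.T b l := Nat.le_mul_of_pos_right _ (by positivity)

theorem T_zero (b : ℕ) : A.T b 0 = A.R b := rfl

theorem T_anti (b : ℕ) {l m : ℕ} (h : l ≤ m) : A.T b m ≤ A.T b l :=
  Nat.mul_le_mul_left _ (Nat.pow_le_pow_right (by norm_num) (by omega))

theorem T_le_R (b l : ℕ) : A.T b l ≤ A.R b := A.T_zero b ▸ A.T_anti b (Nat.zero_le l)

theorem w_le_R (b : ℕ) : A.w b ≤ A.R b := (A.w_le_γ b).trans (A.γ_le_T b 0)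

theorem T_eq_four_mul {b l : ℕ} (h : l < A.d (b + 1)) : A.T b l = 4 * A.T b (l + 1) := by
  have : A.d (b + 1) - l = A.d (b + 1) - (l + 1) + 1 := by omega
  rw [T, T, this, pow_succ]
  ring

/-- The first index of level `b`. -/
def q : ℕ → ℕ
  | 0 => 0
  | b + 1 => q b + A.d b + 1

theorem q_succ (b : ℕ) : A.q (b + 1) = A.q b + A.d b + 1 := rfl

theorem q_strictMono : StrictMono A.q := strictMono_nat_of_lt_succ fun b => by rw [q_succ]; omega

/-- The level of an index. -/
def level (e : ℕ) : ℕ := Nat.findGreatest (fun b => A.q b ≤ e) e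

theorem le_level_iff {b e : ℕ} : b ≤ A.level e ↔ A.q b ≤ e := by
  constructor
  · intro h
    exact (A.q_strictMono.monotone h).trans
      (Nat.findGreatest_spec (P := fun b => A.q b ≤ e) (Nat.zero_le e) (Nat.zero_le e))
  · intro h
    exact Nat.le_findGreatest ((A.q_strictMono.id_le b).trans h) h

theorem level_eq {b e : ℕ} (h : A.q b ≤ e) (h' : e < A.q (b + 1)) : A.level e = b := by
  have h1 := A.le_level_iff.2 h
  have h2 : ¬ b + 1 ≤ A.level e := fun h => absurd (A.le_level_iff.1 h) (by omega)
  omega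

/-- The separated family attached to an index. -/
def family (e : ℕ) : X → X → Prop :=
  A.U (A.level e) (A.R (A.level e)) (e - A.q (A.level e))

open Classical in
/-- The indices in `[a, e)` whose relation does not contain the `r`-ball around `x`. -/
noncomputable def bad (h : ℕ → X → X → Prop) (b r a e : ℕ) (x : X) : Finset ℕ :=
  (Finset.Ico a e).filter fun f => ¬ ∀ y, A.N b r x y → h f x y

/-- The number of indices of level larger than `b` which are bad at the largest radius. -/
noncomputable def rank (h : ℕ → X → X → Prop) (b e : ℕ) (x : X) : ℕ :=
  (A.bad h b (A.R b) (A.q (b + 1)) e x).card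

/-- The indices which are bad at the radius following the one given by the rank. -/
noncomputable def core (h : ℕ → X → X → Prop) (b e : ℕ) (x : X) : Finset ℕ :=
  A.bad h b (A.T b (A.rank h b e x + 1)) (A.q b) e x

/-- The separated family protecting the points that already have `d b` bad indices. -/
def protect (h : ℕ → X → X → Prop) (b e : ℕ) (z w : X) : Prop :=
  ∃ x y, (A.rank h b e x < A.d (b + 1) ∧ (A.core h b e x).card = A.d b) ∧
    A.rank h b e y < A.d (b + 1) ∧ A.core h b e x = A.core h b e y ∧
    A.N b (A.T b (A.rank h b e x + 1)) x z ∧ A.N b (A.T b (A.rank h b e y + 1)) y w ∧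
    ∀ f ∈ Finset.Ico (A.q b) e, f ∉ A.core h b e x → h f x y

/-- The join of the protecting families of level less than `b`. -/
def protectJoin (h : ℕ → X → X → Prop) (e : ℕ) : ℕ → X → X → Prop
  | 0 => Eq
  | b + 1 => RelJoin (protectJoin h e b) (A.protect h b e)

/-- The relation of index `e` constructed from those of smaller index. -/
def next (h : ℕ → X → X → Prop) (e : ℕ) : X → X → Prop :=
  RelJoin (A.protectJoin h e (A.level e)) (A.family e)

theorem mem_bad {h : ℕ → X → X → Prop} {b r a e f : ℕ} {x : X} :
    f ∈ A.bad h b r a e x ↔ (a ≤ f ∧ f < e) ∧ ¬ ∀ y, A.N b r x y → h f x y := by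
  simp [bad]

theorem bad_congr {h h' : ℕ → X → X → Prop} {e : ℕ} (hh : ∀ f < e, h f = h' f) (b r a : ℕ) (x : X) :
    A.bad h b r a e x = A.bad h' b r a e x := by
  ext f
  simp only [mem_bad]
  refine and_congr_right fun hf => ?_
  rw [hh f hf.2]

theorem protect_congr {h h' : ℕ → X → X → Prop} {e : ℕ} (hh : ∀ f < e, h f = h' f) (b : ℕ) :
    A.protect h b e = A.protect h' b e := by
  have hr : A.rank h b e = A.rank h' b e := funext fun x => by
    simp only [rank, A.bad_congr hh]
  have hc : A.core h b e = A.core h' b e := funext fun x => by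
    simp only [core, A.bad_congr hh, hr]
  have hf : ∀ s : Finset ℕ, ∀ x y, (∀ f ∈ Finset.Ico (A.q b) e, f ∉ s → h f x y) ↔
      ∀ f ∈ Finset.Ico (A.q b) e, f ∉ s → h' f x y := fun s x y =>
    forall₂_congr fun f hf => by rw [hh f (Finset.mem_Ico.1 hf).2]
  funext z w
  simp only [protect, hr, hc, hf]

theorem next_congr {h h' : ℕ → X → X → Prop} {e : ℕ} (hh : ∀ f < e, h f = h' f) :
    A.next h e = A.next h' e := by
  have : ∀ b, A.protectJoin h e b = A.protectJoin h' e b := by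
    intro b
    induction b with
    | zero => rfl
    | succ b ih => simp only [protectJoin, ih, A.protect_congr hh]
  simp only [next, this]

/-- The sequence of finite relations. -/
def rel (e : ℕ) : X → X → Prop :=
  A.next (fun f => if f < e then rel f else Eq) e
termination_by e

theorem rel_eq (e : ℕ) : A.rel e = A.next A.rel e := by
  rw [rel]
  exact A.next_congr fun f hf => by simp [hf]

section Protect

variable {A} {h : ℕ → X → X → Prop} {b e : ℕ}

theorem bad_subset {b' r r' a a' e' : ℕ} {x : X}
    (hN : ∀ y, A.N b r x y → A.N b' r' x y) (ha : a' ≤ a) (he : e ≤ e') :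
    A.bad h b r a e x ⊆ A.bad h b' r' a' e' x := by
  intro f hf
  obtain ⟨⟨h1, h2⟩, h3⟩ := A.mem_bad.1 hf
  exact A.mem_bad.2 ⟨⟨ha.trans h1, h2.trans_le he⟩, fun hg => h3 fun y hy => hg y (hN y hy)⟩

theorem of_notMem_bad {r a f : ℕ} {x y : X} (hf : f ∈ Finset.Ico a e)
    (hb : f ∉ A.bad h b r a e x) (hy : A.N b r x y) : h f x y := by
  by_contra hn
  exact hb (A.mem_bad.2 ⟨Finset.mem_Ico.1 hf, fun hg => hn (hg y hy)⟩)

theorem core_eq_of_rank_le (hEq : ∀ f < e, Equivalence (h f)) {x y : X}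
    (hP : (A.bad h b (A.T b (A.rank h b e x)) (A.q b) e x).card ≤ A.d b)
    (hx : (A.core h b e x).card = A.d b) (hy : (A.core h b e y).card = A.d b)
    (hxr : A.rank h b e x < A.d (b + 1)) (hle : A.rank h b e x ≤ A.rank h b e y)
    (hxy : A.N b (3 * A.T b (A.rank h b e x + 1)) x y) :
    A.core h b e x = A.core h b e y ∧
      ∀ f ∈ Finset.Ico (A.q b) e, f ∉ A.core h b e x → h f x y := by
  have hT := A.T_eq_four_mul hxr
  have hxs : A.core h b e x = A.bad h b (A.T b (A.rank h b e x)) (A.q b) e x := by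
    refine Finset.eq_of_subset_of_card_le (bad_subset (fun _ h => h.mono ?_) le_rfl le_rfl) ?_
    · exact A.T_anti b (Nat.le_succ _)
    · rwa [hx]
  have hys : A.core h b e y = A.bad h b (A.T b (A.rank h b e x)) (A.q b) e x := by
    refine Finset.eq_of_subset_of_card_le ?_ (by rwa [hy])
    intro f hf
    by_contra hn
    obtain ⟨hfI, hfb⟩ := A.mem_bad.1 hf
    have hfI' : f ∈ Finset.Ico (A.q b) e := Finset.mem_Ico.2 hfI
    refine hfb fun z hz => ?_
    have := A.T_anti b (Nat.add_le_add_right hle 1)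
    exact (hEq f hfI.2).trans
      ((hEq f hfI.2).symm (of_notMem_bad hfI' hn (hxy.mono (by omega))))
      (of_notMem_bad hfI' hn ((hxy.trans hz).mono (by omega)))
  refine ⟨hxs.trans hys.symm, fun f hf hfx => ?_⟩
  rw [hxs] at hfx
  exact of_notMem_bad hf hfx (hxy.mono (by omega))

theorem core_eq_of_close (hEq : ∀ f < e, Equivalence (h f))
    (hP : ∀ x, (A.bad h b (A.T b (A.rank h b e x)) (A.q b) e x).card ≤ A.d b) {x y z w : X}
    (hx : (A.core h b e x).card = A.d b) (hy : (A.core h b e y).card = A.d b)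
    (hxr : A.rank h b e x < A.d (b + 1)) (hyr : A.rank h b e y < A.d (b + 1))
    (hz : A.N b (A.T b (A.rank h b e x + 1)) x z) (hw : A.N b (A.T b (A.rank h b e y + 1)) y w)
    (hzw : A.N b (A.γ b) z w) :
    A.core h b e x = A.core h b e y ∧
      ∀ f ∈ Finset.Ico (A.q b) e, f ∉ A.core h b e x → h f x y := by
  have hxy := (hz.trans hzw).trans hw.symm
  rcases le_total (A.rank h b e x) (A.rank h b e y) with hle | hle
  · have h1 := A.T_anti b (Nat.add_le_add_right hle 1)
    have h2 := A.γ_le_T b (A.rank h b e x + 1)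
    exact core_eq_of_rank_le hEq (hP x) hx hy hxr hle (hxy.mono (by omega))
  · have h1 := A.T_anti b (Nat.add_le_add_right hle 1)
    have h2 := A.γ_le_T b (A.rank h b e y + 1)
    obtain ⟨hc, hf⟩ := core_eq_of_rank_le hEq (hP y) hy hx hyr hle (hxy.symm.mono (by omega))
    exact ⟨hc.symm, fun f hfI hfx =>
      (hEq f (Finset.mem_Ico.1 hfI).2).symm (hf f hfI (by rwa [hc]))⟩

theorem protect_bounded (hEq : ∀ f < e, Equivalence (h f)) (hbe : A.q (b + 1) ≤ e)
    (hD : ∀ f, A.q b ≤ f → f < A.q (b + 1) → ∀ x y, h f x y → A.N b (A.D b) x y) (z w : X)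
    (hzw : A.protect h b e z w) : A.N b (A.D b) z w := by
  obtain ⟨x, y, ⟨-, hx⟩, -, hc, hz, hw, hf⟩ := hzw
  obtain ⟨f, hfI, hfx⟩ : ∃ f ∈ Finset.Ico (A.q b) (A.q (b + 1)), f ∉ A.core h b e x := by
    by_contra! hn
    have := Finset.card_le_card hn
    rw [Nat.card_Ico, hx, A.q_succ] at this
    omega
  obtain ⟨h1, h2⟩ := Finset.mem_Ico.1 hfI
  have hfe := hEq f (h2.trans_le hbe)
  have hfI' : f ∈ Finset.Ico (A.q b) e := Finset.mem_Ico.2 ⟨h1, h2.trans_le hbe⟩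
  have hfy : f ∉ A.core h b e y := hc ▸ hfx
  exact hD f h1 h2 z w (hfe.trans (hfe.symm (of_notMem_bad hfI' hfx hz))
    (hfe.trans (hf f hfI' hfx) (of_notMem_bad hfI' hfy hw)))

theorem measurable_bad (hBorel : ∀ f < e, BorelOnOrbits G (h f)) (r a : ℕ)
    (s : Finset ℕ) : Measurable fun x => A.bad h b r a e x = s := by
  have heq : (fun x => A.bad h b r a e x = s) =
      fun x => ∀ f : ℕ, ((a ≤ f ∧ f < e) ∧ ¬ ∀ g : G, g ∈ A.S b ^ r → h f x (g • x)) ↔ f ∈ s := by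
    funext x
    refine propext (Finset.ext_iff.trans (forall_congr' fun f => ?_))
    rw [A.mem_bad]
    simp [N, OrbitBall]
  rw [heq]
  refine Measurable.forall fun f => Measurable.iff ?_ measurable_const
  by_cases hf : f < e
  · refine measurable_const.and (Measurable.not ?_)
    have : MeasurableSet (⋂ g ∈ A.S b ^ r, {x | h f x (g • x)}) :=
      MeasurableSet.biInter ((A.finite b).pow_of_group r).countable fun g _ => hBorel f hf g
    rw [← measurableSet_setOfPred]
    convert this using 1
    ext x
    simp
  · simp [hf]

theorem measurable_rank_core (hBorel : ∀ f < e, BorelOnOrbits G (h f)) (k : ℕ) (s : Finset ℕ) :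
    Measurable fun x => A.rank h b e x = k ∧ A.core h b e x = s := by
  have heq : (fun x => A.rank h b e x = k ∧ A.core h b e x = s) =
      fun x => (∃ t : Finset ℕ, A.bad h b (A.R b) (A.q (b + 1)) e x = t ∧ t.card = k) ∧
        A.bad h b (A.T b (k + 1)) (A.q b) e x = s := by
    funext x
    simp only [exists_eq_left', core]
    refine propext (and_congr_right fun hr => ?_)
    rw [hr]
  rw [heq]
  exact (Measurable.exists fun t => (measurable_bad hBorel _ _ t).and measurable_const).and
    (measurable_bad hBorel _ _ s)

theorem protect_borel [Countable G] [StandardBorelSpace X]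
    (hG : ∀ g : G, Measurable fun x : X => g • x) (hBorel : ∀ f < e, BorelOnOrbits G (h f)) :
    BorelOnOrbits G (A.protect h b e) := by
  intro g
  have heq : (fun z => A.protect h b e z (g • z)) = fun z => ∃ (a c : G) (k m : ℕ) (s : Finset ℕ),
      ((k < A.d (b + 1) ∧ s.card = A.d b) ∧ m < A.d (b + 1)) ∧
      ((A.rank h b e (a • z) = k ∧ A.core h b e (a • z) = s) ∧
      (A.rank h b e (c • z) = m ∧ A.core h b e (c • z) = s)) ∧
      (A.N b (A.T b (k + 1)) (a • z) ((1 : G) • z) ∧ A.N b (A.T b (m + 1)) (c • z) (g • z)) ∧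
      ∀ f : ℕ, (f ∈ Finset.Ico (A.q b) e ∧ f ∉ s) → h f (a • z) (c • z) := by
    funext z
    refine propext ⟨?_, ?_⟩
    · rintro ⟨x, y, hx, hy, hc, hxz, hyw, hf⟩
      obtain ⟨a, rfl⟩ := hxz.symm.exists_smul
      obtain ⟨c, rfl⟩ := hyw.symm.exists_smul
      rw [smul_smul] at *
      exact ⟨a, c * g, _, _, _, ⟨hx, hy⟩, ⟨⟨rfl, rfl⟩, rfl, hc.symm⟩, ⟨by rwa [one_smul], hyw⟩,
        fun f h => hf f h.1 h.2⟩
    · rintro ⟨a, c, k, m, s, ⟨hx, hy⟩, ⟨⟨rfl, rfl⟩, rfl, hc⟩, ⟨hxz, hyw⟩, hf⟩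
      exact ⟨_, _, hx, hy, hc.symm, by rwa [one_smul] at hxz, hyw, fun f h h' => hf f ⟨h, h'⟩⟩
  have hN : ∀ r (a c : G), Measurable fun z : X => A.N b r (a • z) (c • z) := fun r a c =>
    measurableSet_setOfPred.1
      ((OrbitBall.borelOnOrbits hG (A.finite b) r).measurableSet_smul_smul hG a c)
  change MeasurableSet {z | A.protect h b e z (g • z)}
  rw [measurableSet_setOfPred, heq]
  refine Measurable.exists fun a => Measurable.exists fun c => Measurable.exists fun k =>
    Measurable.exists fun m => Measurable.exists fun s => measurable_const.and (Measurable.and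
      (((measurable_rank_core hBorel k s).comp (hG a)).and
        ((measurable_rank_core hBorel m s).comp (hG c)))
      (((hN _ a 1).and (hN _ c g)).and (Measurable.forall fun f => ?_)))
  by_cases hf : f < e
  · exact measurable_const.imp
      (measurableSet_setOfPred.1 ((hBorel f hf).measurableSet_smul_smul hG a c))
  · simp [hf]

theorem protect_isSeparatedFamily [Countable G] [StandardBorelSpace X]
    (hG : ∀ g : G, Measurable fun x : X => g • x) (hBorel : ∀ f < e, BorelOnOrbits G (h f))
    (hEq : ∀ f < e, Equivalence (h f))
    (hP : ∀ x, (A.bad h b (A.T b (A.rank h b e x)) (A.q b) e x).card ≤ A.d b)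
    (hbe : A.q (b + 1) ≤ e)
    (hD : ∀ f, A.q b ≤ f → f < A.q (b + 1) → ∀ x y, h f x y → A.N b (A.D b) x y) :
    IsSeparatedFamily (A.S b) (A.γ b) (A.D b) (A.protect h b e) where
  symm := by
    rintro z w ⟨x, y, hx, hy, hc, hz, hw, hf⟩
    exact ⟨y, x, ⟨hy, hc ▸ hx.2⟩, hx.1, hc.symm, hw, hz, fun f hfI hfy =>
      (hEq f (Finset.mem_Ico.1 hfI).2).symm (hf f hfI (hc ▸ hfy))⟩
  trans := by
    rintro z w v ⟨x, y, hx, hy, hc, hz, hw, hf⟩ ⟨y', u, hy', hu, hc', hw', hv, hf'⟩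
    obtain ⟨hcy, hfy⟩ := core_eq_of_close hEq hP (hc ▸ hx.2) hy'.2 hy hy'.1 hw hw' (A.N_refl _ _ _)
    refine ⟨x, u, hx, hu, hc.trans (hcy.trans hc'), hz, hv, fun f hfI hfx => ?_⟩
    have hfe := hEq f (Finset.mem_Ico.1 hfI).2
    have hfy' : f ∉ A.core h b e y := hc ▸ hfx
    exact hfe.trans (hf f hfI hfx) (hfe.trans (hfy f hfI hfy') (hf' f hfI (hcy ▸ hfy')))
  borel := protect_borel hG hBorel
  bounded := protect_bounded hEq hbe hD
  gap := by
    rintro z w ⟨x, -, hx, -, -, hz, -, -⟩ ⟨y, -, hy, -, -, hw, -, -⟩ hzw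
    obtain ⟨hc, hf⟩ := core_eq_of_close hEq hP hx.2 hy.2 hx.1 hy.1 hz hw hzw
    exact ⟨x, y, hx, hy.1, hc, hz, hw, hf⟩

end Protect

section Rel

/-- The bound on the number of bad indices of level at least `b` before `e`. -/
def FewBad (b e : ℕ) : Prop :=
  ∀ x, (A.bad A.rel b (A.T b (A.rank A.rel b e x)) (A.q b) e x).card ≤ A.d b

variable {A}

theorem protectJoin_refl (h : ℕ → X → X → Prop) (e b : ℕ) (x : X) : A.protectJoin h e b x x := by
  induction b with
  | zero => exact rfl
  | succ b ih => exact Or.inl ih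

theorem protectJoin_mono (h : ℕ → X → X → Prop) (e : ℕ) {b c : ℕ} (hbc : b ≤ c) {x y : X}
    (hxy : A.protectJoin h e b x y) : A.protectJoin h e c x y := by
  induction c, hbc using Nat.le_induction with
  | base => exact hxy
  | succ c _ ih => exact Or.inl ih

theorem rel_of_family {e : ℕ} {x y : X} (h : A.family e x y) : A.rel e x y := by
  rw [A.rel_eq]
  exact RelJoin.of_right (protectJoin_refl _ _ _) h

theorem rel_of_protect {b e : ℕ} (hb : A.q (b + 1) ≤ e) {x y : X}
    (h : A.protect A.rel b e x y) : A.rel e x y := by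
  rw [A.rel_eq]
  exact Or.inl (protectJoin_mono _ _ (A.le_level_iff.2 hb)
    (RelJoin.of_right (protectJoin_refl _ _ _) h))

theorem fewBad_of_le {b e : ℕ} (he : e ≤ A.q (b + 1)) : A.FewBad b e := by
  intro x
  have hr : A.rank A.rel b e x = 0 := by
    simp [rank, bad, Finset.Ico_eq_empty_of_le he]
  rw [hr, T_zero]
  obtain ⟨j, hj, hU⟩ := A.cover b (A.R b) x
  have hq := A.q_succ b
  have hsub : A.bad A.rel b (A.R b) (A.q b) e x ⊆
      (Finset.Ico (A.q b) (A.q (b + 1))).erase (A.q b + j) := by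
    intro f hf
    obtain ⟨hfI, hfb⟩ := A.mem_bad.1 hf
    refine Finset.mem_erase.2 ⟨?_, Finset.mem_Ico.2 ⟨hfI.1, hfI.2.trans_le he⟩⟩
    rintro rfl
    refine hfb fun y hy => rel_of_family ?_
    rw [family, A.level_eq hfI.1 (hfI.2.trans_le he), Nat.add_sub_cancel_left]
    exact hU y hy
  refine (Finset.card_le_card hsub).trans ?_
  rw [Finset.card_erase_of_mem (Finset.mem_Ico.2 (by omega)), Nat.card_Ico]
  omega

theorem bad_succ {h : ℕ → X → X → Prop} {b r a e : ℕ} {x : X}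
    (hg : ∀ y, A.N b r x y → h e x y) : A.bad h b r a (e + 1) x = A.bad h b r a e x := by
  ext f
  simp only [mem_bad]
  constructor
  · rintro ⟨⟨h1, h2⟩, h3⟩
    refine ⟨⟨h1, lt_of_le_of_ne (Nat.lt_succ_iff.1 h2) ?_⟩, h3⟩
    rintro rfl
    exact h3 hg
  · rintro ⟨⟨h1, h2⟩, h3⟩
    exact ⟨⟨h1, by omega⟩, h3⟩

theorem bad_succ_subset (h : ℕ → X → X → Prop) (b r a e : ℕ) (x : X) :
    A.bad h b r a (e + 1) x ⊆ insert e (A.bad h b r a e x) := by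
  intro f hf
  obtain ⟨⟨h1, h2⟩, h3⟩ := A.mem_bad.1 hf
  rcases eq_or_ne f e with rfl | hne
  · exact Finset.mem_insert_self _ _
  · exact Finset.mem_insert_of_mem (A.mem_bad.2 ⟨⟨h1, by omega⟩, h3⟩)

theorem FewBad.succ {b e : ℕ} (hEq : ∀ f < e, Equivalence (A.rel f)) (hb : A.q (b + 1) ≤ e)
    (hP : A.FewBad b e) (hP' : A.FewBad (b + 1) (e + 1)) : A.FewBad b (e + 1) := by
  intro x
  by_cases hg : ∀ y, A.N b (A.R b) x y → A.rel e x y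
  · have hr : A.rank A.rel b (e + 1) x = A.rank A.rel b e x := by rw [rank, rank, bad_succ hg]
    rw [hr, bad_succ fun y hy => hg y (hy.mono (A.T_le_R b _))]
    exact hP x
  · have hr : A.rank A.rel b (e + 1) x = A.rank A.rel b e x + 1 := by
      have heq : A.bad A.rel b (A.R b) (A.q (b + 1)) (e + 1) x =
          insert e (A.bad A.rel b (A.R b) (A.q (b + 1)) e x) := by
        refine (bad_succ_subset _ _ _ _ _ _).antisymm (Finset.insert_subset ?_ ?_)
        · exact A.mem_bad.2 ⟨⟨hb, e.lt_succ_self⟩, hg⟩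
        · exact bad_subset (fun _ h => h) le_rfl e.le_succ
      rw [rank, rank, heq, Finset.card_insert_of_notMem]
      exact fun h => lt_irrefl e (A.mem_bad.1 h).1.2
    have hlt : A.rank A.rel b e x < A.d (b + 1) := by
      have : A.rank A.rel b (e + 1) x ≤ A.d (b + 1) := by
        refine (Finset.card_le_card (bad_subset (fun y hy => ?_) le_rfl le_rfl)).trans (hP' x)
        refine hy.succ (le_trans ?_ (A.γ_le_T _ _))
        rw [γ_succ]
        omega
      omega
    rw [hr]
    have hle : (A.core A.rel b e x).card ≤ A.d b :=
      (Finset.card_le_card (bad_subset (fun _ h => h.mono (A.T_anti b (Nat.le_succ _)))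
        le_rfl le_rfl)).trans (hP x)
    rcases hle.lt_or_eq with hlt' | heq
    · exact ((Finset.card_le_card (bad_succ_subset _ _ _ _ _ _)).trans
        (Finset.card_insert_le _ _)).trans hlt'
    · rw [bad_succ fun y hy => rel_of_protect hb ?_]
      · exact hle
      · exact ⟨x, x, ⟨hlt, heq⟩, hlt, rfl, A.N_refl _ _ _, hy, fun f hf _ =>
          (hEq f (Finset.mem_Ico.1 hf).2).refl x⟩

theorem fewBad_succ {e : ℕ} (hEq : ∀ f < e, Equivalence (A.rel f)) (hP : ∀ b, A.FewBad b e)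
    (b : ℕ) : A.FewBad b (e + 1) := by
  obtain ⟨k, hk⟩ : ∃ k, e + 1 ≤ A.q (b + k + 1) :=
    ⟨e, (by omega : e + 1 ≤ b + e + 1).trans (A.q_strictMono.id_le _)⟩
  induction k generalizing b with
  | zero => exact fewBad_of_le hk
  | succ k ih =>
    rcases le_or_gt (e + 1) (A.q (b + 1)) with h | h
    · exact fewBad_of_le h
    · refine FewBad.succ hEq (Nat.lt_succ_iff.1 h) (hP b) (ih (b + 1) ?_)
      rwa [show b + 1 + k + 1 = b + (k + 1) + 1 by ring]

theorem rel_step [Countable G] [StandardBorelSpace X]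
    (hG : ∀ g : G, Measurable fun x : X => g • x) {e : ℕ}
    (hrel : ∀ f < e, Equivalence (A.rel f) ∧ BorelOnOrbits G (A.rel f) ∧
      ∀ x y, A.rel f x y → A.N (A.level f) (A.D (A.level f)) x y)
    (hP : ∀ b, A.FewBad b e) :
    Equivalence (A.rel e) ∧ BorelOnOrbits G (A.rel e) ∧
      ∀ x y, A.rel e x y → A.N (A.level e) (A.D (A.level e)) x y := by
  have hjoin : ∀ b ≤ A.level e, Equivalence (A.protectJoin A.rel e b) ∧
      BorelOnOrbits G (A.protectJoin A.rel e b) ∧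
      ∀ x y, A.protectJoin A.rel e b x y → A.N b (A.w b) x y := by
    intro b
    induction b with
    | zero =>
      refine fun _ => ⟨eq_equivalence, fun g => measurableSet_eq_fun measurable_id (hG g), ?_⟩
      rintro x _ rfl
      exact A.N_refl _ _ _
    | succ b ih =>
      intro hb
      obtain ⟨hE, hB, hN⟩ := ih (by omega)
      have hbe := A.le_level_iff.1 hb
      have hsep : IsSeparatedFamily (A.S b) (A.γ b) (A.D b) (A.protect A.rel b e) :=
        protect_isSeparatedFamily hG (fun f hf => (hrel f hf).2.1) (fun f hf => (hrel f hf).1)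
          (hP b) hbe fun f h1 h2 => by
            have := (hrel f (h2.trans_le hbe)).2.2
            rwa [A.level_eq h1 h2] at this
      refine ⟨RelJoin.equivalence (A.one_mem b) hE hN hsep (A.w_le_γ b),
        hB.relJoin hG hsep.borel (fun x y h => (hN x y h).exists_smul)
          fun x y h => N.exists_smul (A := A) (hsep.bounded x y h), fun x y h => ?_⟩
      have := RelJoin.bounded (A.one_mem b) hN hsep.bounded x y h
      exact N.succ (A := A) (A.w_succ b).ge this
  obtain ⟨hE, hB, hN⟩ := hjoin _ le_rfl
  have hsep := A.separated (A.level e) (A.R (A.level e)) (e - A.q (A.level e))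
  rw [A.rel_eq]
  exact ⟨RelJoin.equivalence (A.one_mem _) hE hN hsep (A.w_le_R _),
    hB.relJoin hG hsep.borel (fun x y h => (hN x y h).exists_smul)
      fun x y h => N.exists_smul (A := A) (hsep.bounded x y h),
    RelJoin.bounded (A.one_mem _) hN hsep.bounded⟩

theorem rel_spec [Countable G] [StandardBorelSpace X]
    (hG : ∀ g : G, Measurable fun x : X => g • x) (e : ℕ) :
    (∀ f < e, Equivalence (A.rel f) ∧ BorelOnOrbits G (A.rel f) ∧
      ∀ x y, A.rel f x y → A.N (A.level f) (A.D (A.level f)) x y) ∧ ∀ b, A.FewBad b e := by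
  induction e with
  | zero => exact ⟨fun f hf => absurd hf f.not_lt_zero, fun b => fewBad_of_le (Nat.zero_le _)⟩
  | succ e ih =>
    obtain ⟨hrel, hP⟩ := ih
    refine ⟨fun f hf => ?_, fewBad_succ (fun f hf => (hrel f hf).1) hP⟩
    rcases (Nat.lt_succ_iff.1 hf).lt_or_eq with hf' | rfl
    · exact hrel f hf'
    · exact rel_step hG hrel hP

theorem eventually_rel [Countable G] [StandardBorelSpace X]
    (hG : ∀ g : G, Measurable fun x : X => g • x) (g : G) (x : X) :
    ∃ n, ∀ e, n ≤ e → A.rel e x (g • x) := by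
  obtain ⟨b, hb⟩ := A.exhaust g
  have hgx : A.N b (A.γ b) x (g • x) :=
    ⟨g, Set.pow_subset_pow_right (A.one_mem b) (A.one_le_γ b) (by simpa using hb), rfl⟩
  have hfin : {f | A.q b ≤ f ∧ ¬ A.rel f x (g • x)}.Finite := by
    by_contra hinf
    obtain ⟨s, hs, hcard⟩ := Set.Infinite.exists_subset_card_eq hinf (A.d b + 1)
    obtain ⟨e, he⟩ := s.bddAbove
    have hsub : s ⊆ A.bad A.rel b (A.T b (A.rank A.rel b (e + 1) x)) (A.q b) (e + 1) x :=
      fun f hf => A.mem_bad.2 ⟨⟨(hs hf).1, Nat.lt_succ_of_le (he hf)⟩, fun h =>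
        (hs hf).2 (h _ (hgx.mono (A.γ_le_T b _)))⟩
    have := (Finset.card_le_card hsub).trans (((A.rel_spec hG (e + 1)).2 b) x)
    omega
  obtain ⟨m, hm⟩ := hfin.bddAbove
  refine ⟨max (A.q b) (m + 1), fun e he => ?_⟩
  by_contra hn
  have := hm ⟨(le_max_left _ _).trans he, hn⟩
  have := (le_max_right _ _).trans he
  omega

theorem isHyperfinite [Countable G] [StandardBorelSpace X] (A : CoverData G X)
    (hG : ∀ g : G, Measurable fun x : X => g • x) :
    IsHyperfinite fun x y : X => ∃ g : G, g • x = y := by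
  have hrel := fun e => (A.rel_spec hG (e + 1)).1 e e.lt_succ_self
  have hmeas := fun e => (hrel e).2.1.measurableSet_prod hG
    fun x y h => ((hrel e).2.2 x y h).exists_smul
  refine ⟨fun n x y => ∀ e, n ≤ e → A.rel e x y, fun n => ⟨⟨?_, ?_, ?_⟩, ?_, fun x => ?_⟩, ?_, ?_⟩
  · exact fun x e _ => (hrel e).1.refl x
  · exact fun h e he => (hrel e).1.symm (h e he)
  · exact fun h h' e he => (hrel e).1.trans (h e he) (h' e he)
  · simp only [Set.ofPred_forall]
    exact MeasurableSet.iInter fun e => MeasurableSet.iInter fun _ => hmeas e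
  · exact (OrbitBall.finite (A.finite _) _ x).subset fun y hy => (hrel n).2.2 x y (hy n le_rfl)
  · exact fun n x y h e he => h e (by omega)
  · refine fun x y => ⟨?_, ?_⟩
    · rintro ⟨g, rfl⟩
      exact eventually_rel hG g x
    · rintro ⟨n, hn⟩
      exact ((hrel n).2.2 x y (hn n le_rfl)).exists_smul

end Rel

end CoverData

end Cover

/-- A finite subset of a locally nilpotent group has polynomial growth. -/
theorem hasPolyGrowth_of_locally_nilpotent {G : Type*} [Group G]
    (hLocNilp : ∀ H : Subgroup G, H.FG → Group.IsNilpotent H) {S : Set G} (hS : S.Finite) :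
    HasPolyGrowth S := by
  have hH := hLocNilp (Subgroup.closure S) ((Subgroup.fg_iff _).2 ⟨S, rfl, hS⟩)
  have himage : (Subgroup.closure S).subtype '' (Subtype.val ⁻¹' S) = S :=
    Subtype.image_preimage_coe _ _ |>.trans (Set.inter_eq_right.2 Subgroup.subset_closure)
  obtain ⟨C, p, h⟩ := hasPolyGrowth_of_isNilpotent (H := Subgroup.closure S)
    (hS.preimage (f := Subtype.val) Subtype.val_injective.injOn)
  refine ⟨C, p, fun n => ?_⟩
  rw [← himage, ← Set.image_pow, Set.ncard_image_of_injective _ (Subgroup.subtype_injective _)]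
  exact h n

/-- Every Borel action of a countable locally nilpotent group admits cover data. -/
theorem nonempty_coverData {G X : Type*} [Group G] [Countable G]
    [MeasurableSpace X] [StandardBorelSpace X] [MulAction G X]
    (hBorel : ∀ g : G, Measurable fun x : X => g • x)
    (hLocNilp : ∀ H : Subgroup G, H.FG → Group.IsNilpotent H) : Nonempty (CoverData G X) := by
  obtain ⟨g, hg⟩ := exists_surjective_nat G
  let B : ℕ → Set G := fun b => insert 1 (g '' Set.Iic b)
  let S : ℕ → Set G := fun b => B b ∪ (B b)⁻¹
  have hfin : ∀ b, (S b).Finite := fun b =>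
    have hB : (B b).Finite := ((Set.finite_Iic b).image g).insert 1
    hB.union hB.inv
  have h1 : ∀ b, 1 ∈ S b := fun b => Or.inl (Set.mem_insert _ _)
  have hinv : ∀ b, (S b)⁻¹ = S b := fun b => by
    simp only [S, Set.union_inv, inv_inv, Set.union_comm]
  have hmono : ∀ b, S b ⊆ S (b + 1) := fun b => by
    have hB : B b ⊆ B (b + 1) :=
      Set.insert_subset_insert (Set.image_mono (Set.Iic_subset_Iic.2 b.le_succ))
    exact Set.union_subset_union hB (Set.inv_subset_inv.2 hB)
  have hex : ∀ a, ∃ b, a ∈ S b := fun a => by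
    obtain ⟨b, rfl⟩ := hg a
    exact ⟨b, Or.inl (Set.mem_insert_of_mem _ ⟨b, Set.self_mem_Iic, rfl⟩)⟩
  choose K hK using fun b =>
    (hasPolyGrowth_of_locally_nilpotent hLocNilp (hfin b)).exists_doubling (hfin b) (h1 b) 8
  choose δ U hsep hcov using fun b r =>
    exists_separatedFamily_cover hBorel (hfin b) (h1 b) (hinv b) (hK b) r
  exact ⟨⟨S, K, δ, U, hfin, h1, hinv, hmono, hex, hsep, hcov⟩⟩

/-- **Theorem 1.1.** If the countable locally nilpotent group `G` acts in a Borel fashion on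
the standard Borel space `X`, then the induced orbit equivalence relation is hyperfinite. -/
theorem orbit_hyperfinite_of_locally_nilpotent {G X : Type*} [Group G] [Countable G]
    [MeasurableSpace X] [StandardBorelSpace X] [MulAction G X]
    (hBorel : ∀ g : G, Measurable fun x : X => g • x)
    (hLocNilp : ∀ H : Subgroup G, H.FG → Group.IsNilpotent H) :
    IsHyperfinite fun x y : X => ∃ g : G, g • x = y := by
  obtain ⟨A⟩ := nonempty_coverData (X := X) hBorel hLocNilp
  exact A.isHyperfinite hBorel
end

section
/- Let G be a countable locally nilpotent group acting freely and continuously on a zero-dimensional Polish space X. Then the orbit equivalence relation E^X_G is continuously embeddable into E_0. -/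
open Set Topology
open scoped Pointwise

section Topological

variable {G X : Type*} [Group G] [TopologicalSpace X] [MulAction G X]

theorem exists_isClopen_separated_nhd [T2Space X]
    (hbasis : TopologicalSpace.IsTopologicalBasis {U : Set X | IsClopen U})
    (hcont : ∀ g : G, Continuous fun x : X => g • x)
    (hfree : ∀ (g : G) (x : X), g • x = x → g = 1) (F : Finset G) (x : X) :
    ∃ O : Set X, IsClopen O ∧ x ∈ O ∧ ∀ g ∈ F, g ≠ 1 → ∀ z ∈ O, g • z ∉ O := by
  classical
  have key : ∀ g : G, ∃ O : Set X, IsOpen O ∧ x ∈ O ∧ (g ≠ 1 → ∀ z ∈ O, g • z ∉ O) := by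
    intro g
    by_cases hg : g = 1
    · exact ⟨univ, isOpen_univ, mem_univ _, fun h => absurd hg h⟩
    · have hne : g • x ≠ x := fun h => hg (hfree g x h)
      obtain ⟨U, V, hU, hV, hxU, hxV, hUV⟩ := t2_separation hne
      refine ⟨V ∩ (fun z => g • z) ⁻¹' U, hV.inter (hU.preimage (hcont g)), ⟨hxV, hxU⟩, ?_⟩
      rintro - z hz hz'
      exact Set.disjoint_left.1 hUV hz.2 hz'.1
  choose O hO hxO hsep using key
  have hopen : IsOpen (⋂ g ∈ F, O g) := F.finite_toSet.isOpen_biInter fun g _ => hO g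
  obtain ⟨C, hC, hxC, hCO⟩ := hbasis.exists_subset_of_mem_open
    (show x ∈ ⋂ g ∈ F, O g by simpa using fun g _ => hxO g) hopen
  refine ⟨C, hC, hxC, fun g hg h1 z hz hz' => ?_⟩
  have h := fun w hw => mem_iInter₂.1 (hCO (a := w) hw) g hg
  exact hsep g h1 z (h z hz) (h _ hz')

theorem exists_isClopen_maximal_separated [T2Space X] [SecondCountableTopology X]
    (hbasis : TopologicalSpace.IsTopologicalBasis {U : Set X | IsClopen U})
    (hcont : ∀ g : G, Continuous fun x : X => g • x)
    (hfree : ∀ (g : G) (x : X), g • x = x → g = 1) (F : Finset G) (h1F : (1 : G) ∈ F)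
    (hF : ∀ g ∈ F, g⁻¹ ∈ F) (W : Set X) (hW : IsClopen W) :
    ∃ Y : Set X, IsClopen Y ∧ Y ⊆ W ∧ (∀ y ∈ Y, ∀ g ∈ F, g • y ∈ Y → g = 1) ∧
      ∀ x ∈ W, ∃ g ∈ F, g • x ∈ Y := by
  classical
  rcases isEmpty_or_nonempty X with hX | hX
  · exact ⟨∅, isClopen_empty, empty_subset _, by simp, fun x => isEmptyElim x⟩
  choose O hO hxO hsep using exists_isClopen_separated_nhd hbasis hcont hfree F
  obtain ⟨s, hs, hcov⟩ := TopologicalSpace.countable_cover_nhds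
    (f := O) fun x => (hO x).isOpen.mem_nhds (hxO x)
  have hsne : s.Nonempty := by
    by_contra h
    rw [Set.not_nonempty_iff_eq_empty] at h
    simp [h] at hcov
    exact Set.empty_ne_univ hcov
  obtain ⟨e, rfl⟩ := hs.exists_eq_range hsne
  let Z : ℕ → Set X := fun n => Nat.rec ∅
    (fun n Zn => Zn ∪ {x | x ∈ W ∩ O (e n) ∧ ∀ g ∈ F, g • x ∉ Zn}) n
  have hZs : ∀ n, Z (n + 1) = Z n ∪ {x | x ∈ W ∩ O (e n) ∧ ∀ g ∈ F, g • x ∉ Z n} :=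
    fun n => rfl
  have hmono : Monotone Z := monotone_nat_of_le_succ fun n => by
    rw [hZs]; exact subset_union_left
  have hZclopen : ∀ n, IsClopen (Z n) := by
    intro n
    induction n with
    | zero => exact isClopen_empty
    | succ n ih =>
      rw [hZs]
      refine ih.union ?_
      have : {x | x ∈ W ∩ O (e n) ∧ ∀ g ∈ F, g • x ∉ Z n} =
          (W ∩ O (e n)) ∩ ⋂ g ∈ F, (fun x => g • x) ⁻¹' (Z n)ᶜ := by
        ext x
        simp only [mem_inter_iff, mem_iInter, mem_preimage, mem_compl_iff, mem_ofPred_eq]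
      rw [this]
      exact (hW.inter (hO _)).inter
        (isClopen_biInter_finset fun g _ => ih.compl.preimage (hcont g))
  have hZsep : ∀ n, ∀ y ∈ Z n, ∀ g ∈ F, g • y ∈ Z n → g = 1 := by
    intro n
    induction n with
    | zero => intro y hy; exact absurd hy (notMem_empty y)
    | succ n ih =>
      intro y hy g hg hgy
      rw [hZs] at hy hgy
      rcases hy with hy | ⟨hy, hy'⟩ <;> rcases hgy with hgy | ⟨hgy, hgy'⟩
      · exact ih y hy g hg hgy
      · exact absurd (by simpa using hy) (hgy' g⁻¹ (hF g hg))
      · exact absurd hgy (hy' g hg)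
      · by_contra h
        exact hsep (e n) g hg h y hy.2 hgy.2
  have hYsep : ∀ y ∈ ⋃ n, Z n, ∀ g ∈ F, g • y ∈ ⋃ n, Z n → g = 1 := by
    intro y hy g hg hgy
    obtain ⟨n, hn⟩ := mem_iUnion.1 hy
    obtain ⟨k, hk⟩ := mem_iUnion.1 hgy
    exact hZsep (max n k) y (hmono (le_max_left _ _) hn) g hg (hmono (le_max_right _ _) hk)
  have hYW : ⋃ n, Z n ⊆ W := by
    refine iUnion_subset fun n => ?_
    induction n with
    | zero => exact empty_subset _
    | succ n ih => rw [hZs]; exact union_subset ih fun x hx => hx.1.1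
  have hYmax : ∀ x ∈ W, ∃ g ∈ F, g • x ∈ ⋃ n, Z n := by
    intro x hx
    have : x ∈ ⋃ y ∈ range e, O y := hcov ▸ mem_univ x
    simp only [mem_range, iUnion_exists, iUnion_iUnion_eq', mem_iUnion] at this
    obtain ⟨n, hn⟩ := this
    rcases Classical.em (∃ g : G, g ∈ F ∧ g • x ∈ Z n) with ⟨g, hg, hgx⟩ | h
    · exact ⟨g, hg, mem_iUnion.2 ⟨n, hgx⟩⟩
    · refine ⟨1, h1F, mem_iUnion.2 ⟨n + 1, ?_⟩⟩
      rw [hZs, one_smul]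
      exact Or.inr ⟨⟨hx, hn⟩, fun g hg hgx => h ⟨g, hg, hgx⟩⟩
  refine ⟨⋃ n, Z n, ⟨⟨?_⟩, isOpen_iUnion fun n => (hZclopen n).isOpen⟩, hYW, hYsep, hYmax⟩
  have : (⋃ n, Z n)ᶜ = Wᶜ ∪ ⋃ g ∈ {g | g ∈ F ∧ g ≠ 1}, (fun x => g • x) ⁻¹' ⋃ n, Z n := by
    ext x
    simp only [mem_compl_iff, mem_union, mem_ofPred_eq, mem_iUnion₂, mem_preimage]
    constructor
    · intro hx
      by_cases hxW : x ∈ W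
      · obtain ⟨g, hg, hgx⟩ := hYmax x hxW
        refine Or.inr ⟨g, ⟨hg, ?_⟩, hgx⟩
        rintro rfl
        rw [one_smul] at hgx
        exact hx hgx
      · exact Or.inl hxW
    · rintro (hx | ⟨g, ⟨hg, hg1⟩, hgx⟩) hxY
      · exact hx (hYW hxY)
      · exact hg1 (hYsep x hxY g hg hgx)
  rw [this]
  refine hW.compl.isOpen.union (isOpen_biUnion fun g _ => ?_)
  exact (isOpen_iUnion fun n => (hZclopen n).isOpen).preimage (hcont g)

theorem exists_isClopen_coloring [T2Space X] [SecondCountableTopology X] [DecidableEq G]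
    (hbasis : TopologicalSpace.IsTopologicalBasis {U : Set X | IsClopen U})
    (hcont : ∀ g : G, Continuous fun x : X => g • x)
    (hfree : ∀ (g : G) (x : X), g • x = x → g = 1) (A : Finset G) (h1A : (1 : G) ∈ A)
    (hA : A⁻¹ = A) (c : ℕ) (hc : (A ^ 7).card ≤ c * A.card) :
    ∃ Y : ℕ → Set X, (∀ i, IsClopen (Y i)) ∧
      (∀ i, ∀ y ∈ Y i, ∀ g ∈ A ^ 6, g • y ∈ Y i → g = 1) ∧
      ∀ x, ∃ i < c, ∃ y ∈ Y i, ∃ w ∈ A ^ 2, x = w • y := by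
  have hApow : ∀ n, ∀ g ∈ A ^ n, g⁻¹ ∈ A ^ n := fun n g hg => by
    rw [← Finset.mem_inv', ← inv_pow, hA]; exact hg
  choose mis hmis hmisW hmissep hmismax using
    exists_isClopen_maximal_separated hbasis hcont hfree (A ^ 6)
      (Finset.one_mem_pow h1A) (hApow 6)
  let V : ℕ → {V : Set X // IsClopen V} := fun n => Nat.rec ⟨∅, isClopen_empty⟩
    (fun _ V => ⟨V.1 ∪ ⋃ w ∈ A ^ 2, (fun x => w⁻¹ • x) ⁻¹' mis V.1ᶜ V.2.compl,
      V.2.union (isClopen_biUnion_finset fun w _ => (hmis _ _).preimage (hcont _))⟩) n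
  let Y : ℕ → Set X := fun n => mis (V n).1ᶜ (V n).2.compl
  have hVs : ∀ n, (V (n + 1)).1 = (V n).1 ∪ ⋃ w ∈ A ^ 2, (fun x => w⁻¹ • x) ⁻¹' Y n :=
    fun n => rfl
  have hmono : Monotone fun n => (V n).1 := monotone_nat_of_le_succ fun n => by
    rw [hVs]; exact subset_union_left
  have hmemV : ∀ n x, x ∈ (V n).1 → ∃ i < n, ∃ y ∈ Y i, ∃ w ∈ A ^ 2, x = w • y := by
    intro n
    induction n with
    | zero => intro x hx; exact absurd hx (notMem_empty x)
    | succ n ih =>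
      intro x hx
      rw [hVs] at hx
      rcases hx with hx | hx
      · obtain ⟨i, hi, h⟩ := ih x hx
        exact ⟨i, hi.trans n.lt_succ_self, h⟩
      · obtain ⟨w, hw, hx⟩ := mem_iUnion₂.1 hx
        exact ⟨n, n.lt_succ_self, _, hx, w, hw, by simp⟩
  refine ⟨Y, fun i => hmis _ _, fun i => hmissep _ _, fun x => hmemV c x ?_⟩
  by_contra hx
  have hex : ∀ i, ∃ g ∈ A ^ 6, i ≤ c → g • x ∉ (V i).1 ∧ (i < c → g • x ∈ Y i) := by
    intro i
    rcases lt_trichotomy i c with hi | rfl | hi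
    · obtain ⟨g, hg, hgx⟩ := hmismax (V i).1ᶜ (V i).2.compl x
        fun h => hx (hmono hi.le h)
      exact ⟨g, hg, fun _ => ⟨hmisW _ _ hgx, fun _ => hgx⟩⟩
    · exact ⟨1, Finset.one_mem_pow h1A, fun _ =>
        ⟨by simpa using hx, fun h => absurd h (lt_irrefl _)⟩⟩
    · exact ⟨1, Finset.one_mem_pow h1A, fun h => absurd h hi.not_ge⟩
  choose g hg hgx using hex
  have hne : ∀ i j, i < j → j ≤ c → ∀ a ∈ A, ∀ b ∈ A, a * g i ≠ b * g j := by
    intro i j hij hj a ha b hb hab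
    refine (hgx j hj).1 (hmono (Nat.succ_le_of_lt hij) ?_)
    simp only [Nat.succ_eq_add_one]
    rw [hVs]
    refine Or.inr (mem_iUnion₂.2 ⟨b⁻¹ * a, ?_, ?_⟩)
    · rw [sq]
      exact Finset.mul_mem_mul (by rw [← hA]; exact Finset.inv_mem_inv hb) ha
    · have : (b⁻¹ * a)⁻¹ • g j • x = g i • x := by
        rw [smul_smul]; congr 1
        rw [mul_inv_rev, inv_inv, mul_assoc, ← hab, inv_mul_cancel_left]
      simp only [mem_preimage]
      rw [this]
      exact (hgx i (hij.le.trans hj)).2 (hij.trans_le hj)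
  have hcard : ((Finset.range (c + 1)) ×ˢ A).card ≤ (A ^ 7).card := by
    refine Finset.card_le_card_of_injOn (fun p => p.2 * g p.1) ?_ ?_
    · rintro ⟨i, a⟩ hp
      simp only [Finset.coe_product, mem_prod, Finset.mem_coe] at hp
      rw [pow_succ']
      exact Finset.mul_mem_mul hp.2 (hg i)
    · rintro ⟨i, a⟩ hp ⟨j, b⟩ hq hab
      simp only [Finset.coe_product, mem_prod, Finset.mem_coe, Finset.mem_range,
        Nat.lt_succ_iff] at hp hq hab
      rcases lt_trichotomy i j with hij | rfl | hij
      · exact absurd hab (hne i j hij hq.1 a hp.2 b hq.2)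
      · rw [mul_right_cancel hab]
      · exact absurd hab.symm (hne j i hij hp.1 b hq.2 a hp.2)
  rw [Finset.card_product, Finset.card_range] at hcard
  have := Finset.card_pos.2 ⟨1, h1A⟩
  nlinarith

end Topological

section Doubling

open scoped Classical in
/-- Every finite subset of `H` lies in a finite symmetric set whose `p`-th power is at most
`c` times as large, where `c` depends on `p` only. -/
def HasUniformDoubling (H : Type*) [Group H] : Prop :=
  ∀ p : ℕ, ∃ c : ℕ, ∀ S : Finset H, ∃ A : Finset H, S ⊆ A ∧ (1 : H) ∈ A ∧ A⁻¹ = A ∧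
    (A ^ p).card ≤ c * A.card

theorem HasUniformDoubling.of_subsingleton (H : Type*) [Group H] [Subsingleton H] :
    HasUniformDoubling H := by
  classical
  exact fun p => ⟨1, fun S =>
    ⟨{1}, fun x _ => by simp [Subsingleton.elim x 1], by simp, by simp, by simp⟩⟩

theorem card_zpow_interval_pow_le {H : Type*} [Group H] [DecidableEq H] (z : H) (k p : ℕ) :
    (((Finset.Icc (-k : ℤ) k).image fun i : ℤ => z ^ i) ^ p).card ≤
      (2 * p + 1) * ((Finset.Icc (-k : ℤ) k).image fun i : ℤ => z ^ i).card := by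
  set C := (Finset.Icc (-k : ℤ) k).image fun i : ℤ => z ^ i with hC
  have hsub : C ^ p ⊆ ((Finset.Icc (-p : ℤ) p).image fun j : ℤ => z ^ (j * k)) * C := by
    induction p with
    | zero =>
      rw [pow_zero, Finset.one_subset, Finset.mem_mul]
      exact ⟨1, by simp, 1, Finset.mem_image.2 ⟨0, by simp, by simp⟩, by simp⟩
    | succ p ih =>
      rw [pow_succ]
      intro x hx
      obtain ⟨u, hu, v, hv, rfl⟩ := Finset.mem_mul.1 hx
      obtain ⟨a, ha, b, hb, rfl⟩ := Finset.mem_mul.1 (ih hu)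
      obtain ⟨j, hj, rfl⟩ := Finset.mem_image.1 ha
      obtain ⟨i, hi, rfl⟩ := Finset.mem_image.1 hb
      obtain ⟨l, hl, rfl⟩ := Finset.mem_image.1 hv
      rw [Finset.mem_Icc] at hj hi hl
      have key : ∀ j' i' : ℤ, -(p + 1 : ℤ) ≤ j' → j' ≤ p + 1 → -(k : ℤ) ≤ i' → i' ≤ k →
          j' * k + i' = j * k + i + l →
          z ^ (j * k) * z ^ i * z ^ l ∈
          ((Finset.Icc (-(p + 1 : ℕ) : ℤ) (p + 1 : ℕ)).image fun j : ℤ => z ^ (j * k)) * C := by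
        intro j' i' h1 h2 h3 h4 h5
        refine Finset.mem_mul.2 ⟨z ^ (j' * k), Finset.mem_image.2 ⟨j', ?_, rfl⟩, z ^ i',
          Finset.mem_image.2 ⟨i', Finset.mem_Icc.2 ⟨h3, h4⟩, rfl⟩, ?_⟩
        · rw [Finset.mem_Icc]; push_cast; constructor <;> linarith
        · rw [← zpow_add, h5, zpow_add, zpow_add]
      rcases lt_or_ge (i + l) (-k) with h | h
      · exact key (j - 1) (i + l + k) (by linarith) (by linarith) (by linarith) (by linarith)
          (by ring)
      · rcases lt_or_ge (k : ℤ) (i + l) with h' | h'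
        · exact key (j + 1) (i + l - k) (by linarith) (by linarith) (by linarith) (by linarith)
            (by ring)
        · exact key j (i + l) (by linarith) (by linarith) (by linarith) (by linarith) (by ring)
  calc (C ^ p).card ≤ _ := Finset.card_le_card hsub
    _ ≤ _ := Finset.card_mul_le
    _ ≤ (2 * p + 1) * C.card := by
      gcongr
      refine Finset.card_image_le.trans ?_
      rw [Int.card_Icc]
      omega

theorem HasUniformDoubling.of_central_zpowers {H Q : Type*} [Group H] [Group Q] (f : H →* Q)
    (hf : Function.Surjective f) (z : H) (hz : ∀ h : H, Commute z h)
    (hker : f.ker = Subgroup.zpowers z) (hQ : HasUniformDoubling Q) : HasUniformDoubling H := by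
  classical
  intro p
  obtain ⟨c, hc⟩ := hQ p
  refine ⟨c * (2 * (p + 1) + 1), fun S => ?_⟩
  obtain ⟨Q₀, hSQ, h1Q, hQinv, hQcard⟩ := hc (S.image f)
  let σ : Q → H := Function.surjInv hf
  have hσ : ∀ q, f (σ q) = q := Function.surjInv_eq hf
  let L₀ := Q₀.image σ
  let L := insert 1 ((L₀ ∪ S) ∪ (L₀ ∪ S)⁻¹)
  have hLinv : L⁻¹ = L := by
    ext x; simp [L, or_comm, or_assoc, or_left_comm]
  have hL₀f : ∀ x ∈ L₀ ∪ S, f x ∈ Q₀ := by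
    intro x hx
    rcases Finset.mem_union.1 hx with hx | hx
    · obtain ⟨q, hq, rfl⟩ := Finset.mem_image.1 hx
      rwa [hσ]
    · exact hSQ (Finset.mem_image_of_mem f hx)
  have hLf : L.image f ⊆ Q₀ := by
    intro q hq
    obtain ⟨x, hx, rfl⟩ := Finset.mem_image.1 hq
    simp only [L] at hx
    rcases Finset.mem_insert.1 hx with rfl | hx
    · simpa using h1Q
    · rcases Finset.mem_union.1 hx with hx | hx
      · exact hL₀f x hx
      · have := hL₀f _ (Finset.mem_inv'.1 hx)
        rw [map_inv] at this
        rwa [← hQinv, Finset.mem_inv']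
  have hLpf : (L ^ p).image f ⊆ Q₀ ^ p := by
    rw [Finset.image_pow]
    exact Finset.pow_subset_pow_left hLf
  -- differences inside the fibres of `L ^ p` are powers of `z` with bounded exponent
  have hk : ∃ k : ℕ, ∀ u ∈ L ^ p, ∀ v ∈ L ^ p, f u = f v →
      ∃ i : ℤ, i ∈ Finset.Icc (-k : ℤ) k ∧ u = v * z ^ i := by
    have : ∀ q : H × H, ∃ i : ℤ, f q.1 = f q.2 → q.1 = q.2 * z ^ i := by
      rintro ⟨u, v⟩
      by_cases h : f u = f v
      · have : v⁻¹ * u ∈ f.ker := by rw [MonoidHom.mem_ker]; simp [h]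
        rw [hker] at this
        obtain ⟨i, hi⟩ := Subgroup.mem_zpowers_iff.1 this
        exact ⟨i, fun _ => by simp [hi]⟩
      · exact ⟨0, fun h' => absurd h' h⟩
    choose i hi using this
    refine ⟨((L ^ p) ×ˢ (L ^ p)).sup fun q => (i q).natAbs, fun u hu v hv huv =>
      ⟨i (u, v), ?_, hi (u, v) huv⟩⟩
    have := Finset.le_sup (f := fun q => (i q).natAbs) (Finset.mk_mem_product hu hv)
    rw [Finset.mem_Icc]
    omega
  obtain ⟨k, hk⟩ := hk
  let C := (Finset.Icc (-k : ℤ) k).image fun i : ℤ => z ^ i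
  have h1C : (1 : H) ∈ C := Finset.mem_image.2 ⟨0, by simp, by simp⟩
  have hCinv : C⁻¹ = C := by
    ext x
    simp only [C, Finset.mem_inv', Finset.mem_image, Finset.mem_Icc]
    constructor <;> rintro ⟨i, hi, h⟩ <;> refine ⟨-i, by omega, ?_⟩ <;> simp [h]
  have hCf : ∀ x ∈ C, f x = 1 := by
    intro x hx
    obtain ⟨i, -, rfl⟩ := Finset.mem_image.1 hx
    have : z ∈ f.ker := hker ▸ Subgroup.mem_zpowers z
    rw [map_zpow, MonoidHom.mem_ker.1 this, one_zpow]
  have hCcomm : ∀ x ∈ C, ∀ h : H, x * h = h * x := by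
    intro x hx h
    obtain ⟨i, -, rfl⟩ := Finset.mem_image.1 hx
    exact ((hz h).zpow_left i)
  have hCL : Commute C L := by
    ext x
    simp only [Finset.mem_mul]
    constructor
    · rintro ⟨a, ha, b, hb, rfl⟩
      exact ⟨b, hb, a, ha, (hCcomm a ha b).symm⟩
    · rintro ⟨a, ha, b, hb, rfl⟩
      exact ⟨b, hb, a, ha, hCcomm b hb a⟩
  have h1L : (1 : H) ∈ L := Finset.mem_insert_self _ _
  refine ⟨L * C, ?_, ?_, ?_, ?_⟩
  · intro s hs
    exact Finset.mem_mul.2 ⟨s, by simp [L, hs], 1, h1C, mul_one s⟩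
  · exact Finset.mem_mul.2 ⟨1, h1L, 1, h1C, mul_one 1⟩
  · rw [mul_inv_rev, hLinv, hCinv]; exact hCL
  · have hτ : ∀ q : Q, ∃ u : H, q ∈ (L ^ p).image f → u ∈ L ^ p ∧ f u = q := by
      intro q
      by_cases h : q ∈ (L ^ p).image f
      · obtain ⟨u, hu⟩ := Finset.mem_image.1 h
        exact ⟨u, fun _ => hu⟩
      · exact ⟨1, fun h' => absurd h' h⟩
    choose τ hτ using hτ
    have hsub : (L * C) ^ p ⊆ ((L ^ p).image f).image τ * C ^ (p + 1) := by
      rw [hCL.symm.mul_pow, pow_succ']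
      intro x hx
      obtain ⟨u, hu, v, hv, rfl⟩ := Finset.mem_mul.1 hx
      have hq := Finset.mem_image_of_mem f hu
      obtain ⟨i, hi, hui⟩ := hk u hu _ (hτ _ hq).1 (hτ _ hq).2.symm
      refine Finset.mem_mul.2 ⟨τ (f u), Finset.mem_image_of_mem τ hq, z ^ i * v, ?_, ?_⟩
      · exact Finset.mul_mem_mul (Finset.mem_image_of_mem _ hi) hv
      · rw [← mul_assoc, ← hui]
    have hlow : Q₀.card * C.card ≤ (L * C).card := by
      rw [← Finset.card_product]
      refine Finset.card_le_card_of_injOn (fun q => σ q.1 * q.2) ?_ ?_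
      · rintro ⟨q, x⟩ hq
        simp only [Finset.coe_product, mem_prod, Finset.mem_coe] at hq
        refine Finset.mul_mem_mul ?_ hq.2
        simp only [L, L₀, Finset.mem_insert, Finset.mem_union]
        exact Or.inr (Or.inl (Or.inl (Finset.mem_image_of_mem σ hq.1)))
      · rintro ⟨q, x⟩ hq ⟨q', x'⟩ hq' h
        simp only [Finset.coe_product, mem_prod, Finset.mem_coe] at hq hq' h
        have h' := congrArg f h
        rw [map_mul, map_mul, hCf x hq.2, hCf x' hq'.2, hσ, hσ, mul_one, mul_one] at h'
        subst h'
        rw [mul_left_cancel h]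
    calc ((L * C) ^ p).card ≤ _ := Finset.card_le_card hsub
      _ ≤ _ := Finset.card_mul_le
      _ ≤ (Q₀ ^ p).card * ((2 * (p + 1) + 1) * C.card) :=
        Nat.mul_le_mul (Finset.card_image_le.trans (Finset.card_le_card hLpf))
          (card_zpow_interval_pow_le z k (p + 1))
      _ ≤ (c * Q₀.card) * ((2 * (p + 1) + 1) * C.card) := by gcongr
      _ = c * (2 * (p + 1) + 1) * (Q₀.card * C.card) := by ring
      _ ≤ _ := by gcongr

open scoped commutatorElement

theorem mem_comap_center_iff {G : Type*} [Group G] (N : Subgroup G) [N.Normal] (z : G) :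
    z ∈ (Subgroup.center (G ⧸ N)).comap (QuotientGroup.mk' N) ↔ ∀ g : G, ⁅z, g⁆ ∈ N := by
  rw [Subgroup.mem_comap, Subgroup.mem_center_iff]
  refine ⟨fun h g => ?_, fun h q => ?_⟩
  · rw [← QuotientGroup.eq_one_iff, ← QuotientGroup.mk'_apply, map_commutatorElement,
      commutatorElement_eq_one_iff_mul_comm]
    exact (h g).symm
  · obtain ⟨g, rfl⟩ := QuotientGroup.mk'_surjective N q
    have := h g
    rw [← QuotientGroup.eq_one_iff, ← QuotientGroup.mk'_apply, map_commutatorElement,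
      commutatorElement_eq_one_iff_mul_comm] at this
    exact this.symm

theorem normal_of_le_comap_center {G : Type*} [Group G] {N K : Subgroup G} [N.Normal]
    (hNK : N ≤ K) (hK : K ≤ (Subgroup.center (G ⧸ N)).comap (QuotientGroup.mk' N)) :
    K.Normal := by
  refine ⟨fun n hn g => ?_⟩
  have h := hNK (inv_mem ((mem_comap_center_iff N n).1 (hK hn) g))
  have : g * n * g⁻¹ = ⁅n, g⁆⁻¹ * n := by rw [commutatorElement_def]; group
  rw [this]
  exact mul_mem h hn

theorem HasUniformDoubling.of_quotient_sup_zpowers {G : Type*} [Group G] {N M : Subgroup G}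
    [N.Normal] [M.Normal] {z : G} (hM : M = N ⊔ Subgroup.zpowers z)
    (hz : z ∈ (Subgroup.center (G ⧸ N)).comap (QuotientGroup.mk' N))
    (h : HasUniformDoubling (G ⧸ M)) : HasUniformDoubling (G ⧸ N) := by
  have hNM : N ≤ M.comap (MonoidHom.id G) := by rw [Subgroup.comap_id, hM]; exact le_sup_left
  refine h.of_central_zpowers (QuotientGroup.map N M (MonoidHom.id G) hNM)
    (QuotientGroup.map_surjective_of_surjective N M (MonoidHom.id G)
      (by simpa using QuotientGroup.mk'_surjective M) hNM)
    (z : G ⧸ N) (fun q => (Subgroup.mem_center_iff.1 hz q).symm) ?_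
  rw [QuotientGroup.ker_map, Subgroup.comap_id, hM, Subgroup.map_sup, MonoidHom.map_zpowers]
  simp

theorem HasUniformDoubling.of_quotient_sup_closure {G : Type*} [Group G] (N : Subgroup G)
    [N.Normal] (T : Finset G)
    (hT : (T : Set G) ⊆ (Subgroup.center (G ⧸ N)).comap (QuotientGroup.mk' N))
    (M : Subgroup G) [M.Normal] (hM : M = N ⊔ Subgroup.closure T)
    (h : HasUniformDoubling (G ⧸ M)) : HasUniformDoubling (G ⧸ N) := by
  classical
  induction T using Finset.induction_on generalizing M with
  | empty =>
    obtain rfl : M = N := by simpa using hM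
    exact h
  | insert z T _ ih =>
    rw [Finset.coe_insert, insert_subset_iff] at hT
    have hNcenter : N ≤ (Subgroup.center (G ⧸ N)).comap (QuotientGroup.mk' N) := fun n hn => by
      rw [Subgroup.mem_comap, QuotientGroup.mk'_apply, (QuotientGroup.eq_one_iff n).2 hn]
      exact one_mem _
    have hK : N ⊔ Subgroup.closure T ≤
        (Subgroup.center (G ⧸ N)).comap (QuotientGroup.mk' N) :=
      sup_le hNcenter ((Subgroup.closure_le _).2 hT.2)
    have hKn : (N ⊔ Subgroup.closure (T : Set G)).Normal :=
      normal_of_le_comap_center le_sup_left hK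
    refine ih hT.2 _ rfl ?_
    refine HasUniformDoubling.of_quotient_sup_zpowers (M := M) (z := z) ?_ ?_ h
    · rw [hM, Finset.coe_insert, insert_eq, Subgroup.closure_union, sup_assoc,
        Subgroup.zpowers_eq_closure, sup_comm (Subgroup.closure {z})]
    · rw [mem_comap_center_iff]
      exact fun g => le_sup_left (a := N) ((mem_comap_center_iff N z).1 hT.1 g)

theorem lowerCentralSeries_le_comap_center {G : Type*} [Group G] (i : ℕ) :
    (⊤ : Subgroup G).lowerCentralSeries i ≤
      (Subgroup.center (G ⧸ (⊤ : Subgroup G).lowerCentralSeries (i + 1))).comap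
        (QuotientGroup.mk' _) := fun z hz =>
  (mem_comap_center_iff _ z).2 fun _ => Subgroup.commutator_mem_commutator hz (Subgroup.mem_top _)

theorem exists_finset_lowerCentralSeries_eq_sup {G : Type*} [Group G] [Group.FG G] (i : ℕ) :
    ∃ T : Finset G, (⊤ : Subgroup G).lowerCentralSeries i =
      (⊤ : Subgroup G).lowerCentralSeries (i + 1) ⊔ Subgroup.closure T := by
  classical
  obtain ⟨S, hS⟩ := Group.fg_def.1 ‹Group.FG G›
  induction i with
  | zero =>
    refine ⟨S, ?_⟩
    rw [hS, Subgroup.lowerCentralSeries_zero, sup_top_eq]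
  | succ i ih =>
    obtain ⟨T, hT⟩ := ih
    let T' : Finset G := (T ×ˢ S).image fun p => ⁅p.1, p.2⁆
    have hT'le : Subgroup.closure (T' : Set G) ≤ (⊤ : Subgroup G).lowerCentralSeries (i + 1) := by
      rw [Subgroup.closure_le]
      intro x hx
      obtain ⟨p, hp, rfl⟩ := Finset.mem_image.1 hx
      refine Subgroup.commutator_mem_commutator ?_ (Subgroup.mem_top _)
      rw [hT]
      exact Subgroup.mem_sup_right (Subgroup.subset_closure (Finset.mem_product.1 hp).1)
    have hNle : (⊤ : Subgroup G).lowerCentralSeries (i + 1 + 1) ⊔ Subgroup.closure (T' : Set G) ≤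
        (⊤ : Subgroup G).lowerCentralSeries (i + 1) :=
      sup_le (Subgroup.lowerCentralSeries_antitone _ (Nat.le_succ _)) hT'le
    refine ⟨T', le_antisymm ?_ hNle⟩
    set N := (⊤ : Subgroup G).lowerCentralSeries (i + 1 + 1) ⊔ Subgroup.closure (T' : Set G)
    have hNn : N.Normal := normal_of_le_comap_center le_sup_left
      (hNle.trans (lowerCentralSeries_le_comap_center (i + 1)))
    have hle : (⊤ : Subgroup G).lowerCentralSeries i ≤
        (Subgroup.center (G ⧸ N)).comap (QuotientGroup.mk' N) := by
      rw [hT]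
      refine sup_le (fun z hz => (mem_comap_center_iff N z).2 fun g => ?_)
        ((Subgroup.closure_le _).2 fun t ht => (mem_comap_center_iff N t).2 fun g => ?_)
      · exact Subgroup.mem_sup_left
          (Subgroup.commutator_mem_commutator hz (Subgroup.mem_top g))
      · have hg : g ∈ (Subgroup.centralizer {(t : G ⧸ N)}).comap (QuotientGroup.mk' N) := by
          have : Subgroup.closure (S : Set G) ≤
              (Subgroup.centralizer {(t : G ⧸ N)}).comap (QuotientGroup.mk' N) := by
            rw [Subgroup.closure_le]
            intro s hs
            rw [SetLike.mem_coe, Subgroup.mem_comap, Subgroup.mem_centralizer_singleton_iff]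
            have h : ⁅t, s⁆ ∈ N := Subgroup.mem_sup_right (Subgroup.subset_closure
              (Finset.mem_image.2 ⟨(t, s), Finset.mem_product.2 ⟨ht, hs⟩, rfl⟩))
            rw [← QuotientGroup.eq_one_iff, ← QuotientGroup.mk'_apply, map_commutatorElement,
              commutatorElement_eq_one_iff_mul_comm] at h
            exact h.symm
          rw [hS] at this
          exact this (Subgroup.mem_top g)
        rw [Subgroup.mem_comap, Subgroup.mem_centralizer_singleton_iff] at hg
        rw [← QuotientGroup.eq_one_iff, ← QuotientGroup.mk'_apply, map_commutatorElement,
          commutatorElement_eq_one_iff_mul_comm]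
        exact hg.symm
    rw [Subgroup.lowerCentralSeries_succ, Subgroup.commutator_le]
    exact fun z hz g _ => (mem_comap_center_iff N z).1 (hle hz) g

theorem HasUniformDoubling.of_isNilpotent (G : Type*) [Group G] [Group.FG G]
    [hG : Group.IsNilpotent G] : HasUniformDoubling G := by
  have hquot : ∀ i, HasUniformDoubling (G ⧸ (⊤ : Subgroup G).lowerCentralSeries i) := by
    intro i
    induction i with
    | zero =>
      have : Subsingleton (G ⧸ (⊤ : Subgroup G).lowerCentralSeries 0) :=
        QuotientGroup.subsingleton_quotient_top
      exact .of_subsingleton _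
    | succ i ih =>
      obtain ⟨T, hT⟩ := exists_finset_lowerCentralSeries_eq_sup (G := G) i
      refine ih.of_quotient_sup_closure _ T (fun t ht => ?_) _ hT
      refine lowerCentralSeries_le_comap_center i ?_
      rw [hT]
      exact Subgroup.mem_sup_right (Subgroup.subset_closure ht)
  obtain ⟨n, hn⟩ := Subgroup.nilpotent_iff_lowerCentralSeries.1 hG
  exact (hquot n).of_central_zpowers (QuotientGroup.mk' _) (QuotientGroup.mk'_surjective _) 1
    Commute.one_left (by rw [QuotientGroup.ker_mk', hn, Subgroup.zpowers_one_eq_bot])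

theorem exists_uniform_doubling {G : Type*} [Group G] [DecidableEq G] {H : Subgroup G}
    (hH : H.FG) (hHn : Group.IsNilpotent H) (p : ℕ) :
    ∃ c : ℕ, ∀ S : Finset G, (S : Set G) ⊆ H → ∃ A : Finset G, S ⊆ A ∧ (A : Set G) ⊆ H ∧
      (1 : G) ∈ A ∧ A⁻¹ = A ∧ (A ^ p).card ≤ c * A.card := by
  have : Group.FG H := (Group.fg_iff_subgroup_fg H).2 hH
  let _ : DecidableEq H := fun a b => Classical.propDecidable (a = b)
  obtain ⟨c, hc⟩ := HasUniformDoubling.of_isNilpotent H p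
  refine ⟨c, fun S hS => ?_⟩
  obtain ⟨A, hSA, h1A, hA, hcard⟩ := hc (S.preimage H.subtype H.subtype_injective.injOn)
  refine ⟨A.image H.subtype, fun s hs => ?_, ?_, ?_, ?_, ?_⟩
  · exact Finset.mem_image.2 ⟨⟨s, hS hs⟩, hSA (Finset.mem_preimage.2 hs), rfl⟩
  · intro x hx
    obtain ⟨y, -, rfl⟩ := Finset.mem_image.1 hx
    exact y.2
  · exact Finset.mem_image.2 ⟨1, h1A, rfl⟩
  · ext x
    simp only [Finset.mem_inv', Finset.mem_image]
    have key : ∀ y ∈ A, y⁻¹ ∈ A := fun y hy => by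
      rw [← hA]
      exact Finset.mem_inv'.2 (by simpa using hy)
    constructor <;> rintro ⟨y, hy, h⟩ <;> refine ⟨y⁻¹, key y hy, ?_⟩
    · rw [map_inv, h, inv_inv]
    · rw [map_inv, h]
  · rw [← Finset.image_pow,
      Finset.card_image_of_injective _ H.subtype_injective,
      Finset.card_image_of_injective _ H.subtype_injective]
    exact hcard

end Doubling

section Coding

variable {G X : Type*} [Group G] [TopologicalSpace X] [MulAction G X]

/-- A map that moves points along their orbits by elements of the finite set `K`, chosen in a
locally constant way. -/
def TameMap (K : Finset G) (s : X → X) : Prop :=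
  (∀ x, ∃ g ∈ K, s x = g • x) ∧ ∀ g : G, IsOpen {x | s x = g • x}

theorem TameMap.isClopen {K : Finset G} {s : X → X} (hs : TameMap K s)
    (hfree : ∀ (g : G) (x : X), g • x = x → g = 1) (g : G) : IsClopen {x | s x = g • x} := by
  refine ⟨⟨?_⟩, hs.2 g⟩
  have : {x | s x = g • x}ᶜ = ⋃ h ∈ {h : G | h ≠ g}, {x | s x = h • x} := by
    ext x
    simp only [mem_compl_iff, mem_ofPred_eq, mem_iUnion, exists_prop]
    constructor
    · intro hx
      obtain ⟨h, -, hh⟩ := hs.1 x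
      exact ⟨h, fun e => hx (e ▸ hh), hh⟩
    · rintro ⟨h, hne, hh⟩ hx
      refine hne (inv_mul_eq_one.1 (hfree _ x ?_)).symm
      rw [mul_smul, ← hh, hx, inv_smul_smul]
  rw [this]
  exact isOpen_biUnion fun h _ => hs.2 h

theorem TameMap.isOpen_preimage {K : Finset G} {s : X → X} (hs : TameMap K s)
    (hcont : ∀ g : G, Continuous fun x : X => g • x) {U : Set X} (hU : IsOpen U) :
    IsOpen (s ⁻¹' U) := by
  have : s ⁻¹' U = ⋃ g : G, {x | s x = g • x} ∩ (fun x => g • x) ⁻¹' U := by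
    ext x
    simp only [mem_preimage, mem_iUnion, mem_inter_iff, mem_ofPred_eq]
    constructor
    · intro hx
      obtain ⟨h, -, hh⟩ := hs.1 x
      exact ⟨h, hh, hh ▸ hx⟩
    · rintro ⟨g, hg, hx⟩
      rwa [hg]
  rw [this]
  exact isOpen_iUnion fun g => (hs.2 g).inter (hU.preimage (hcont g))

theorem TameMap.continuous {K : Finset G} {s : X → X} (hs : TameMap K s)
    (hcont : ∀ g : G, Continuous fun x : X => g • x) : Continuous s :=
  ⟨fun _ hU => hs.isOpen_preimage hcont hU⟩

theorem TameMap.id (hfree : ∀ (g : G) (x : X), g • x = x → g = 1) :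
    TameMap ({1} : Finset G) (id : X → X) := by
  refine ⟨fun x => ⟨1, by simp, by simp⟩, fun g => ?_⟩
  rcases eq_or_ne g 1 with rfl | hg
  · simp
  · convert isOpen_empty
    ext x
    simpa using fun h : x = g • x => hg (hfree g x h.symm)

theorem TameMap.comp [DecidableEq G] {K L : Finset G} {s r : X → X} (hs : TameMap K s)
    (hr : TameMap L r) (hcont : ∀ g : G, Continuous fun x : X => g • x) :
    TameMap (K * L) (s ∘ r) := by
  refine ⟨fun x => ?_, fun g => ?_⟩
  · obtain ⟨a, ha, hax⟩ := hr.1 x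
    obtain ⟨b, hb, hbx⟩ := hs.1 (r x)
    exact ⟨b * a, Finset.mul_mem_mul hb ha, by rw [mul_smul, ← hax, ← hbx]; rfl⟩
  · have : {x | (s ∘ r) x = g • x} =
        ⋃ a : G, {x | r x = a • x} ∩ r ⁻¹' {z | s z = (g * a⁻¹) • z} := by
      ext x
      simp only [mem_preimage, mem_iUnion, mem_inter_iff, mem_ofPred_eq, Function.comp_apply]
      constructor
      · intro hx
        obtain ⟨a, -, ha⟩ := hr.1 x
        exact ⟨a, ha, by rw [hx, ha, mul_smul, inv_smul_smul]⟩
      · rintro ⟨a, ha, hx⟩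
        rw [hx, ha, mul_smul, inv_smul_smul]
    rw [this]
    exact isOpen_iUnion fun a => (hr.2 a).inter (hr.isOpen_preimage hcont (hs.2 _))

theorem exists_continuous_code {ι : Type*} [Countable ι] {b : ι → Set X}
    (hb : ∀ i, IsClopen (b i)) :
    ∃ f : X → ℕ → Bool, Continuous f ∧ ∀ x y,
      (f x = f y → ∀ i, x ∈ b i ↔ y ∈ b i) ∧
      ((∀ᶠ k in Filter.atTop, f x k = f y k) ↔ {i | ¬(x ∈ b i ↔ y ∈ b i)}.Finite) := by
  classical
  obtain ⟨e, he⟩ := exists_injective_nat ι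
  let B : ℕ → Set X := fun k => ⋃ i ∈ {i | e i = k}, b i
  have hB : ∀ i, B (e i) = b i := fun i => by
    ext x
    simp [B, he.eq_iff]
  have hB' : ∀ k, k ∉ range e → B k = ∅ := fun k hk => by
    ext x
    simp only [B, mem_ofPred_eq, mem_iUnion, exists_prop, mem_empty_iff_false, iff_false]
    rintro ⟨i, hi, -⟩
    exact hk ⟨i, hi⟩
  have hBclopen : ∀ k, IsClopen (B k) := fun k => by
    by_cases hk : k ∈ range e
    · obtain ⟨i, rfl⟩ := hk
      rw [hB]; exact hb i
    · rw [hB' k hk]; exact isClopen_empty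
  have hind : ∀ x y k, (B k).boolIndicator x = (B k).boolIndicator y ↔ (x ∈ B k ↔ y ∈ B k) := by
    intro x y k
    by_cases hx : x ∈ B k <;> by_cases hy : y ∈ B k <;> simp [boolIndicator, hx, hy]
  refine ⟨fun x k => (B k).boolIndicator x,
    continuous_pi fun k => (continuous_boolIndicator_iff_isClopen _).2 (hBclopen k),
    fun x y => ⟨?_, ?_⟩⟩
  · intro h i
    rw [← hB i]
    exact (hind x y _).1 (congrFun h (e i))
  · rw [← Nat.cofinite_eq_atTop, Filter.eventually_cofinite,
      ← Set.finite_image_iff (f := e) he.injOn]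
    refine Iff.of_eq (congrArg _ ?_)
    ext k
    simp only [mem_ofPred_eq, mem_image, hind]
    constructor
    · intro h
      by_cases hk : k ∈ range e
      · obtain ⟨i, rfl⟩ := hk
        exact ⟨i, by rwa [hB] at h, rfl⟩
      · rw [hB' k hk] at h
        simp at h
    · rintro ⟨i, hi, rfl⟩
      rwa [hB]

theorem exists_isClopen_separating_seq [T1Space X] [SecondCountableTopology X]
    (hbasis : TopologicalSpace.IsTopologicalBasis {U : Set X | IsClopen U}) :
    ∃ O : ℕ → Set X, (∀ k, IsClopen (O k)) ∧ ∀ x y, (∀ k, x ∈ O k ↔ y ∈ O k) → x = y := by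
  obtain ⟨B, hB, hBc, hBb⟩ := hbasis.exists_countable
  obtain ⟨O, hO⟩ := (hBc.insert ∅).exists_eq_range (insert_nonempty ∅ B)
  refine ⟨O, fun k => ?_, fun x y h => ?_⟩
  · have : O k ∈ insert ∅ B := hO ▸ mem_range_self k
    rcases this with h | h
    · rw [h]; exact isClopen_empty
    · exact hB h
  · by_contra hxy
    obtain ⟨U, hU, hxU, hUy⟩ := hBb.exists_subset_of_mem_open
      (show x ∈ ({y}ᶜ : Set X) from hxy) isOpen_compl_singleton
    obtain ⟨k, rfl⟩ : U ∈ range O := hO ▸ mem_insert_of_mem _ hU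
    exact hUy ((h k).1 hxU) rfl

theorem exists_embedding_of_tameMaps [T1Space X] [SecondCountableTopology X] [Countable G]
    (hbasis : TopologicalSpace.IsTopologicalBasis {U : Set X | IsClopen U})
    (hcont : ∀ g : G, Continuous fun x : X => g • x)
    (hfree : ∀ (g : G) (x : X), g • x = x → g = 1)
    (s : ℕ → X → X) (K : ℕ → Finset G) (hs : ∀ n, TameMap (K n) (s n)) (h0 : ∀ x, s 0 x = x)
    (hconv : ∀ (g : G) (x : X), ∀ᶠ n in Filter.atTop, s n (g • x) = s n x) :
    ∃ f : X → (ℕ → Bool), Continuous f ∧ Function.Injective f ∧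
      ∀ x y : X, (∃ g : G, g • x = y) ↔ (∀ᶠ k in Filter.atTop, f x k = f y k) := by
  classical
  obtain ⟨O, hO, hOsep⟩ := exists_isClopen_separating_seq hbasis
  -- `W n` contains every element that can carry `s n x` back to `s N x` for some `N ≤ n`
  let W : ℕ → Finset G := fun n => (Finset.range (n + 1)).biUnion fun N => K N * (K n)⁻¹
  let Q : ℕ → Finset G := fun n => K (n + 1) * (K n)⁻¹
  let b : (ℕ × G × ℕ) ⊕ (ℕ × G) → Set X := Sum.elim
    (fun i => {x | i.2.1 ∈ W i.1 ∧ i.2.2 ≤ i.1 ∧ i.2.1 • s i.1 x ∈ O i.2.2})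
    (fun i => {x | i.2 ∈ Q i.1 ∧ s (i.1 + 1) x = i.2 • s i.1 x})
  have hb : ∀ i, IsClopen (b i) := by
    have hand : ∀ (p : Prop) (U : Set X), IsClopen U → IsClopen {x | p ∧ x ∈ U} := by
      intro p U hU
      by_cases hp : p <;> simp [hp, hU, isClopen_empty]
    rintro (⟨n, w, k⟩ | ⟨n, g⟩)
    · exact hand _ _ (hand _ _ ((hO k).preimage ((hcont w).comp ((hs n).continuous hcont))))
    · refine hand _ {x | s (n + 1) x = g • s n x} ?_
      have : {x | s (n + 1) x = g • s n x} =
          ⋃ a ∈ K n, {x | s n x = a • x} ∩ {x | s (n + 1) x = (g * a) • x} := by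
        ext x
        simp only [mem_ofPred_eq, mem_iUnion, exists_prop, mem_inter_iff]
        constructor
        · intro h
          obtain ⟨a, ha, hax⟩ := (hs n).1 x
          exact ⟨a, ha, hax, by rw [h, hax, mul_smul]⟩
        · rintro ⟨a, -, hax, h⟩
          rw [h, hax, mul_smul]
      rw [this]
      exact isClopen_biUnion_finset fun a _ =>
        ((hs n).isClopen hfree a).inter ((hs (n + 1)).isClopen hfree _)
  obtain ⟨f, hfc, hf⟩ := exists_continuous_code hb
  have hback : ∀ N x y, (∀ n ≥ N, (∀ w k, x ∈ b (.inl (n, w, k)) ↔ y ∈ b (.inl (n, w, k))) ∧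
      ∀ g, x ∈ b (.inr (n, g)) ↔ y ∈ b (.inr (n, g))) → s N x = s N y := by
    intro N x y h
    have hk : ∀ n ≥ N, ∃ k : G, s n x = k • s N x ∧ s n y = k • s N y := by
      intro n hn
      induction n, hn using Nat.le_induction with
      | base => exact ⟨1, by simp, by simp⟩
      | succ n hn ih =>
        obtain ⟨k, hkx, hky⟩ := ih
        obtain ⟨a, ha, hax⟩ := (hs n).1 x
        obtain ⟨a', ha', hax'⟩ := (hs (n + 1)).1 x
        have hx : x ∈ b (.inr (n, a' * a⁻¹)) :=
          ⟨Finset.mul_mem_mul ha' (Finset.inv_mem_inv ha), by simp [hax, hax', mul_smul]⟩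
        have hy := ((h n hn).2 _).1 hx
        exact ⟨a' * a⁻¹ * k, by rw [hx.2, mul_smul _ k, ← hkx], by rw [hy.2, mul_smul _ k, ← hky]⟩
    refine hOsep _ _ fun j => ?_
    let n := max N j
    obtain ⟨k, hkx, hky⟩ := hk n (le_max_left _ _)
    obtain ⟨a, ha, hax⟩ := (hs n).1 x
    obtain ⟨a', ha', hax'⟩ := (hs N).1 x
    have hka : k⁻¹ = a' * a⁻¹ := by
      have : (k * a' * a⁻¹) • s n x = s n x := by
        conv_lhs => rw [hax]
        rw [mul_smul, inv_smul_smul, mul_smul, ← hax', hkx]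
      have := hfree _ _ this
      rw [mul_assoc] at this
      exact inv_eq_of_mul_eq_one_right this
    have hW : k⁻¹ ∈ W n := by
      refine Finset.mem_biUnion.2 ⟨N, Finset.mem_range.2 ?_, ?_⟩
      · exact Nat.lt_succ_of_le (le_max_left _ _)
      · rw [hka]; exact Finset.mul_mem_mul ha' (Finset.inv_mem_inv ha)
    have := (h n (le_max_left _ _)).1 k⁻¹ j
    simp only [b, Sum.elim_inl, mem_ofPred_eq, hW, true_and, hkx, hky, inv_smul_smul] at this
    simpa [n] using this
  refine ⟨f, hfc, fun x y hxy => ?_, fun x y => ?_⟩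
  · have := hback 0 x y fun n _ => ⟨fun w k => (hf x y).1 hxy _, fun g => (hf x y).1 hxy _⟩
    rwa [h0, h0] at this
  rw [(hf x y).2]
  let stage : (ℕ × G × ℕ) ⊕ (ℕ × G) → ℕ := Sum.elim Prod.fst Prod.fst
  constructor
  · rintro ⟨g, rfl⟩
    obtain ⟨N, hN⟩ := Filter.eventually_atTop.1 (hconv g x)
    refine Set.Finite.subset (s := Sum.inl '' ((Finset.range (N + 1) ×ˢ
        ((Finset.range (N + 1)).biUnion W) ×ˢ Finset.range (N + 1) : Finset _) : Set _) ∪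
      Sum.inr '' ((Finset.range (N + 1) ×ˢ ((Finset.range (N + 1)).biUnion Q) : Finset _) : Set _))
      (((Finset.finite_toSet _).image _).union ((Finset.finite_toSet _).image _)) ?_
    rintro (⟨n, w, k⟩ | ⟨n, a⟩) h
    · refine Or.inl ⟨_, ?_, rfl⟩
      have hnN : n < N + 1 := by
        by_contra hn
        refine h ?_
        simp [b, hN n (by omega)]
      have hw : w ∈ W n ∧ k ≤ n := by
        by_contra hw
        refine h ?_
        simp only [b, Sum.elim_inl, mem_ofPred_eq, ← and_assoc, hw, false_and]
      simp only [Finset.coe_product, mem_prod, Finset.mem_coe, Finset.mem_range,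
        Finset.mem_biUnion]
      exact ⟨hnN, ⟨n, hnN, hw.1⟩, by omega⟩
    · refine Or.inr ⟨_, ?_, rfl⟩
      have hnN : n < N + 1 := by
        by_contra hn
        refine h ?_
        simp [b, hN n (by omega), hN (n + 1) (by omega)]
      have hw : a ∈ Q n := by
        by_contra hw
        refine h ?_
        simp only [b, Sum.elim_inr, mem_ofPred_eq, hw, false_and]
      simp only [Finset.coe_product, mem_prod, Finset.mem_coe, Finset.mem_range,
        Finset.mem_biUnion]
      exact ⟨hnN, ⟨n, hnN, hw⟩⟩
  · intro hfin
    obtain ⟨N, hN⟩ := (hfin.image stage).bddAbove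
    have := hback (N + 1) x y fun n hn =>
      ⟨fun w k => by_contra fun h =>
        absurd (hN (mem_image_of_mem stage h)) (by simp [stage]; omega),
        fun g => by_contra fun h => absurd (hN (mem_image_of_mem stage h)) (by simp [stage]; omega)⟩
    obtain ⟨a, -, ha⟩ := (hs (N + 1)).1 x
    obtain ⟨a', -, ha'⟩ := (hs (N + 1)).1 y
    exact ⟨a'⁻¹ * a, by rw [mul_smul, ← ha, this, ha', inv_smul_smul]⟩

end Coding

section Retraction

variable {G X : Type*} [Group G] [MulAction G X]

open scoped Classical in
/-- The retraction sending `w • y` to `y` whenever `y ∈ V w`, and fixing all other points. -/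
noncomputable def retract (V : G → Set X) (x : X) : X :=
  if h : ∃ w : G, w⁻¹ • x ∈ V w then h.choose⁻¹ • x else x

/-- A point is of the form `w • y` with `y ∈ V w` for at most one `w`. -/
def UniqueCode (V : G → Set X) : Prop :=
  ∀ (x : X) (w w' : G), w⁻¹ • x ∈ V w → w'⁻¹ • x ∈ V w' → w = w'

theorem retract_of_mem {V : G → Set X} (hV : UniqueCode V) {w : G} {x : X}
    (hx : w⁻¹ • x ∈ V w) : retract V x = w⁻¹ • x := by
  have h : ∃ w : G, w⁻¹ • x ∈ V w := ⟨w, hx⟩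
  rw [retract, dif_pos h, hV x _ _ h.choose_spec hx]

theorem retract_of_notMem {V : G → Set X} {x : X} (hx : ∀ w : G, w⁻¹ • x ∉ V w) :
    retract V x = x :=
  dif_neg fun ⟨w, h⟩ => hx w h

theorem tameMap_retract [TopologicalSpace X] {V : G → Set X} (hV : UniqueCode V)
    (hcont : ∀ g : G, Continuous fun x : X => g • x)
    (hfree : ∀ (g : G) (x : X), g • x = x → g = 1)
    (hclopen : ∀ w, IsClopen (V w)) {K : Finset G} (hK1 : (1 : G) ∈ K) (hK : ∀ w ∈ K, w⁻¹ ∈ K)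
    (hVK : ∀ w y, y ∈ V w → w ∈ K) : TameMap K (retract V) := by
  classical
  refine ⟨fun x => ?_, fun g => ?_⟩
  · by_cases h : ∃ w : G, w⁻¹ • x ∈ V w
    · obtain ⟨w, hw⟩ := h
      exact ⟨w⁻¹, hK w (hVK w _ hw), retract_of_mem hV hw⟩
    · exact ⟨1, hK1, by rw [retract_of_notMem fun w hw => h ⟨w, hw⟩, one_smul]⟩
  · have hpre : ∀ w : G, IsClopen ((fun x => w⁻¹ • x) ⁻¹' V w) :=
      fun w => (hclopen w).preimage (hcont _)
    have : {x | retract V x = g • x} = (fun x => (g⁻¹)⁻¹ • x) ⁻¹' V g⁻¹ ∪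
        if g = 1 then ⋂ w ∈ K, ((fun x => w⁻¹ • x) ⁻¹' V w)ᶜ else ∅ := by
      ext x
      by_cases h : ∃ w : G, w⁻¹ • x ∈ V w
      · obtain ⟨w, hw⟩ := h
        have hnot : x ∉ (if g = 1 then ⋂ w ∈ K, ((fun x => w⁻¹ • x) ⁻¹' V w)ᶜ else ∅ : Set X) := by
          split_ifs
          · intro hx
            exact mem_iInter₂.1 hx w (hVK w _ hw) hw
          · exact notMem_empty x
        simp only [mem_union, hnot, or_false, mem_preimage, mem_ofPred_eq]
        rw [retract_of_mem hV hw]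
        constructor
        · intro hx
          have : w = g⁻¹ := by
            refine eq_inv_of_mul_eq_one_left (hfree _ x ?_)
            rw [mul_smul, ← hx, smul_inv_smul]
          rwa [← this]
        · intro hx
          rw [hV x _ _ hw hx, inv_inv]
      · push Not at h
        have h' : (g⁻¹)⁻¹ • x ∉ V g⁻¹ := h _
        simp only [mem_union, mem_preimage, mem_ofPred_eq, h', false_or]
        rw [retract_of_notMem h]
        constructor
        · intro hx
          rw [if_pos (hfree g x hx.symm)]
          simpa using fun w _ => h w
        · intro hx
          split_ifs at hx with hg
          · rw [hg, one_smul]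
          · exact absurd hx (notMem_empty x)
    rw [this]
    refine (hpre g⁻¹).isOpen.union ?_
    split_ifs
    · exact (isClopen_biInter_finset fun w _ => (hpre w).compl).isOpen
    · exact isOpen_empty

end Retraction

section Dynamics

variable {G X : Type*} [Group G] [DecidableEq G] [TopologicalSpace X] [MulAction G X]

/-- The finite sets, and the clopen markers at their scales, used to build a sequence of tame
maps that eventually identify any two points of an orbit. -/
structure MarkerTower (G X : Type*) [Group G] [DecidableEq G] [TopologicalSpace X]
    [MulAction G X] where
  /-- number of colours at each level -/
  c : ℕ → ℕ
  /-- elements available before each level -/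
  D : ℕ → Finset G
  /-- the scale of each level -/
  A : ℕ → Finset G
  /-- the markers of each level and colour -/
  Y : ℕ → ℕ → Set X
  one_mem_D : ∀ m, 1 ∈ D m
  exists_mem_D : ∀ g, ∃ m, g ∈ D m
  one_mem_A : ∀ m, 1 ∈ A m
  inv_A : ∀ m, (A m)⁻¹ = A m
  pow_subset_A : ∀ m, (D m * D m ∪ (D m * D m)⁻¹) ^ (2 * (c (m + 1) + 1) + 1) ⊆ A m
  pow_subset_D : ∀ m, A m ^ (3 * c m + 4) ⊆ D (m + 1)
  isClopen_Y : ∀ m i, IsClopen (Y m i)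
  separated : ∀ m i, ∀ y ∈ Y m i, ∀ g ∈ A m ^ 6, g • y ∈ Y m i → g = 1
  covering : ∀ m x, ∃ i < c m, ∃ y ∈ Y m i, ∃ w ∈ A m ^ 2, x = w • y

namespace MarkerTower

variable (T : MarkerTower G X)

/-- The neighbourhood of the identity that has to stay inside a single blob. -/
def B (m : ℕ) : Finset G := T.D m * T.D m ∪ (T.D m * T.D m)⁻¹

theorem mul_mem_B {m : ℕ} {g h : G} (hg : g ∈ T.D m) (hh : h ∈ T.D m) : g * h ∈ T.B m :=
  Finset.mem_union_left _ (Finset.mul_mem_mul hg hh)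

theorem D_subset_B (m : ℕ) : T.D m ⊆ T.B m := fun g hg => by
  simpa using T.mul_mem_B hg (T.one_mem_D m)

theorem one_mem_B (m : ℕ) : 1 ∈ T.B m := T.D_subset_B m (T.one_mem_D m)

theorem inv_mem_B {m : ℕ} {g : G} (hg : g ∈ T.B m) : g⁻¹ ∈ T.B m := by
  have : (T.B m)⁻¹ = T.B m := by
    ext x
    simp only [B, Finset.mem_inv', Finset.mem_union, inv_inv, or_comm]
  rw [← this]
  exact Finset.inv_mem_inv hg

theorem B_pow_subset_A (m : ℕ) {k : ℕ} (hk : k ≤ 2 * (T.c (m + 1) + 1) + 1) :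
    T.B m ^ k ⊆ T.A m :=
  (Finset.pow_subset_pow_right (T.one_mem_B m) hk).trans (T.pow_subset_A m)

theorem B_subset_A (m : ℕ) : T.B m ⊆ T.A m := by
  simpa using T.B_pow_subset_A m (k := 1) (by omega)

theorem inv_mem_A_pow {m k : ℕ} {g : G} (hg : g ∈ T.A m ^ k) : g⁻¹ ∈ T.A m ^ k := by
  rw [← Finset.mem_inv', ← inv_pow, T.inv_A]
  exact hg

/-- The markers `y` of level `m` and colour `i` whose blob contains `w • y`, when the blob of `y`
has been enlarged `τ y` times. -/
def V (m i : ℕ) (τ : X → ℕ) (w : G) : Set X :=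
  {y | y ∈ T.Y m i ∧ w ∈ T.A m ^ 3 ∧ w ∈ T.B m ^ (2 * τ y + 1) * T.A m ^ 2}

theorem uniqueCode_V (m i : ℕ) (τ : X → ℕ) : UniqueCode (T.V m i τ) := by
  rintro x w w' ⟨hY, hw, -⟩ ⟨hY', hw', -⟩
  refine (inv_mul_eq_one.1 (T.separated m i _ hY (w'⁻¹ * w) ?_ ?_)).symm
  · rw [show 6 = 3 + 3 from rfl, pow_add]
    exact Finset.mul_mem_mul (T.inv_mem_A_pow hw') hw
  · rwa [mul_smul, smul_inv_smul]

theorem isClopen_V (m i : ℕ) {τ : X → ℕ} (hτ : Continuous τ) (w : G) :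
    IsClopen (T.V m i τ w) :=
  (T.isClopen_Y m i).inter ((isClopen_discrete
    {k : ℕ | w ∈ T.A m ^ 3 ∧ w ∈ T.B m ^ (2 * k + 1) * T.A m ^ 2}).preimage hτ)

/-- The composition of the retractions of level `m` for the first `i` colours. -/
noncomputable def levelMap (m : ℕ) (τ : X → ℕ) : ℕ → X → X
  | 0 => id
  | i + 1 => retract (T.V m i τ) ∘ levelMap m τ i

/-- The composition of the level maps for the first `m` levels. -/
noncomputable def iterMap (t : ℕ → X → ℕ) : ℕ → X → X
  | 0 => id
  | m + 1 => T.levelMap m (t m) (T.c m) ∘ iterMap t m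

open scoped Classical in
/-- The blob of `y` at level `m` grows at time `n` when the current map `iterMap` fails to be
constant around `y`. -/
noncomputable def state : ℕ → ℕ → X → ℕ
  | 0 => fun _ _ => 0
  | n + 1 => fun m y => state n m y +
      if m ≤ n ∧ ∃ w ∈ T.A m ^ 4,
        T.iterMap (state n) (n + 1) (w • y) ≠ T.iterMap (state n) (n + 1) y then 1 else 0

/-- The map obtained at time `n`. -/
noncomputable def finalMap (n : ℕ) : X → X := T.iterMap (T.state n) (n + 1)

/-- Some element of `K` moves `x` to a point on which the map obtained at time `n` takes another
value. -/
def Bad (K : Finset G) (n : ℕ) (x : X) : Prop :=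
  ∃ g ∈ K, T.finalMap n (g • x) ≠ T.finalMap n x

theorem state_succ_of_hit {m n : ℕ} {y : X} (hmn : m ≤ n)
    (h : T.Bad (T.A m ^ 4) n y) :
    T.state (n + 1) m y = T.state n m y + 1 := by
  simp only [state]
  exact congrArg _ (if_pos ⟨hmn, h⟩)

theorem state_le_succ (m n : ℕ) (y : X) : T.state n m y ≤ T.state (n + 1) m y :=
  Nat.le_add_right _ _

theorem tameMap_levelMap (hcont : ∀ g : G, Continuous fun x : X => g • x)
    (hfree : ∀ (g : G) (x : X), g • x = x → g = 1) (m : ℕ) {τ : X → ℕ} (hτ : Continuous τ) (i : ℕ) :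
    TameMap (T.A m ^ (3 * i)) (T.levelMap m τ i) := by
  induction i with
  | zero => exact TameMap.id hfree
  | succ i ih =>
    rw [show 3 * (i + 1) = 3 + 3 * i by ring, pow_add]
    refine TameMap.comp (tameMap_retract (T.uniqueCode_V m i τ) hcont hfree (T.isClopen_V m i hτ)
      (Finset.one_mem_pow (T.one_mem_A m)) (fun w => T.inv_mem_A_pow) fun w y hy => hy.2.1) ih hcont

theorem tameMap_iterMap (hcont : ∀ g : G, Continuous fun x : X => g • x)
    (hfree : ∀ (g : G) (x : X), g • x = x → g = 1)
    {t : ℕ → X → ℕ} (ht : ∀ m, Continuous (t m)) (m : ℕ) :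
    TameMap (T.D m) (T.iterMap t m) := by
  induction m with
  | zero =>
    exact ⟨fun x => ⟨1, T.one_mem_D 0, (one_smul G x).symm⟩, (TameMap.id hfree).2⟩
  | succ m ih =>
    have h := (T.tameMap_levelMap hcont hfree m (ht m) (T.c m)).comp ih hcont
    refine ⟨fun x => ?_, h.2⟩
    obtain ⟨g, hg, hgx⟩ := h.1 x
    refine ⟨g, T.pow_subset_D m (Finset.pow_subset_pow_right (T.one_mem_A m)
      (show 3 * T.c m + 1 ≤ 3 * T.c m + 4 by omega) ?_), hgx⟩
    rw [pow_succ]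
    exact Finset.mul_subset_mul_left ((T.D_subset_B m).trans (T.B_subset_A m)) hg

theorem continuous_state (hcont : ∀ g : G, Continuous fun x : X => g • x)
    (hfree : ∀ (g : G) (x : X), g • x = x → g = 1) (n m : ℕ) : Continuous (T.state n m) := by
  classical
  induction n generalizing m with
  | zero => exact continuous_const
  | succ n ih =>
    have hs := T.tameMap_iterMap hcont hfree ih (n + 1)
    set s := T.iterMap (T.state n) (n + 1)
    have heq : ∀ w : G, IsClopen {y | s (w • y) = s y} := by
      intro w
      have : {y | s (w • y) = s y} = ⋃ a ∈ T.D (n + 1),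
          {y | s y = a • y} ∩ (fun y => w • y) ⁻¹' {z | s z = (a * w⁻¹) • z} := by
        ext y
        simp only [mem_ofPred_eq, mem_iUnion, exists_prop, mem_inter_iff, mem_preimage]
        constructor
        · intro h
          obtain ⟨a, ha, hay⟩ := hs.1 y
          exact ⟨a, ha, hay, by rw [h, hay, mul_smul, inv_smul_smul]⟩
        · rintro ⟨a, -, hay, h⟩
          rw [h, hay, mul_smul, inv_smul_smul]
      rw [this]
      exact isClopen_biUnion_finset fun a _ =>
        (hs.isClopen hfree a).inter ((hs.isClopen hfree _).preimage (hcont w))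
    have hclopen : IsClopen {y | m ≤ n ∧ ∃ w ∈ T.A m ^ 4, s (w • y) ≠ s y} := by
      by_cases hmn : m ≤ n
      · have : {y | m ≤ n ∧ ∃ w ∈ T.A m ^ 4, s (w • y) ≠ s y} =
            ⋃ w ∈ T.A m ^ 4, {y | s (w • y) = s y}ᶜ := by
          ext y
          simp [hmn]
        rw [this]
        exact isClopen_biUnion_finset fun w _ => (heq w).compl
      · simp [hmn, isClopen_empty]
    refine (ih m).add (continuous_const.if ?_ continuous_const)
    intro y hy
    exact absurd (hclopen.frontier_eq.subset hy) (notMem_empty y)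

theorem tameMap_finalMap (hcont : ∀ g : G, Continuous fun x : X => g • x)
    (hfree : ∀ (g : G) (x : X), g • x = x → g = 1) (n : ℕ) : TameMap (T.D (n + 1)) (T.finalMap n) :=
  T.tameMap_iterMap hcont hfree (T.continuous_state hcont hfree n) (n + 1)

theorem levelMap_eq_of_le {m i j : ℕ} {τ : X → ℕ} {x y : X} (hij : i ≤ j)
    (h : T.levelMap m τ i x = T.levelMap m τ i y) : T.levelMap m τ j x = T.levelMap m τ j y := by
  induction j, hij using Nat.le_induction with
  | base => exact h
  | succ j _ ih => exact congrArg (retract (T.V m j τ)) ih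

theorem iterMap_eq_of_le {i j : ℕ} {t : ℕ → X → ℕ} {x y : X} (hij : i ≤ j)
    (h : T.iterMap t i x = T.iterMap t i y) : T.iterMap t j x = T.iterMap t j y := by
  induction j, hij using Nat.le_induction with
  | base => exact h
  | succ j _ ih => exact congrArg (T.levelMap j (t j) (T.c j)) ih

theorem levelMap_eq_self {m l : ℕ} {τ : X → ℕ} {z : X}
    (h : ∀ i < l, ∀ w : G, w⁻¹ • z ∉ T.V m i τ w) : T.levelMap m τ l z = z := by
  induction l with
  | zero => rfl
  | succ l ih =>
    simp only [levelMap, Function.comp_apply]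
    rw [ih fun i hi => h i (hi.trans l.lt_succ_self)]
    exact retract_of_notMem (h l l.lt_succ_self)

/-- A single blob of level `m` and colour `l` contains every point of `T.B m • x`. -/
def InBlob (m l : ℕ) (τ : X → ℕ) (x : X) : Prop :=
  ∃ y, ∀ b ∈ T.B m, ∃ w, b • x = w • y ∧ y ∈ T.V m l τ w

variable {T} in
theorem InBlob.mono {m l : ℕ} {τ τ' : X → ℕ} {x : X} (h : T.InBlob m l τ x) (hτ : τ ≤ τ') :
    T.InBlob m l τ' x := by
  obtain ⟨y, hy⟩ := h
  refine ⟨y, fun b hb => ?_⟩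
  obtain ⟨w, hw, hY, hA, hB⟩ := hy b hb
  refine ⟨w, hw, hY, hA, Finset.mul_subset_mul_right (Finset.pow_subset_pow_right (T.one_mem_B m)
    ?_) hB⟩
  have : τ y ≤ τ' y := hτ y
  omega

theorem exists_inBlob (m : ℕ) (τ : X → ℕ) (x : X) : ∃ l < T.c m, T.InBlob m l τ x := by
  obtain ⟨l, hl, y, hy, w, hw, rfl⟩ := T.covering m x
  refine ⟨l, hl, y, fun b hb => ⟨b * w, by rw [mul_smul], hy, ?_, ?_⟩⟩
  · rw [pow_succ']
    exact Finset.mul_mem_mul (T.B_subset_A m hb) hw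
  · refine Finset.mul_mem_mul (Finset.pow_subset_pow_right (T.one_mem_B m) (Nat.le_add_left 1 _) ?_)
      hw
    rwa [pow_one]

open scoped Classical in
theorem state_le_card (m n : ℕ) (y : X) : T.state n m y ≤
    ((Finset.Ico m n).filter fun j =>
      T.Bad (T.A m ^ 4) j y).card := by
  induction n with
  | zero => exact Nat.zero_le _
  | succ n ih =>
    by_cases h : m ≤ n ∧ T.Bad (T.A m ^ 4) n y
    · rw [T.state_succ_of_hit h.1 h.2, ← Finset.insert_Ico_right_eq_Ico_add_one h.1,
        Finset.filter_insert, if_pos h.2, Finset.card_insert_of_notMem (by simp)]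
      exact Nat.succ_le_succ ih
    · have : T.state (n + 1) m y = T.state n m y := by
        simp only [state]
        exact congrArg _ (if_neg h)
      rw [this]
      refine ih.trans (Finset.card_le_card (Finset.filter_subset_filter _ ?_))
      exact Finset.Ico_subset_Ico_right n.le_succ

theorem exists_lt_inBlob_of_bad (hcont : ∀ g : G, Continuous fun x : X => g • x)
    (hfree : ∀ (g : G) (x : X), g • x = x → g = 1) {m k l : ℕ} {x : X} (hmk : m ≤ k)
    (hl : l < T.c m) (hstate : ∀ y, T.state (k + 1) m y ≤ T.c (m + 1) + 1)
    (hblob : T.InBlob m l (T.state k m) x)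
    (hbad : T.Bad (T.D m) k x) :
    ∃ l' < l, T.InBlob m l' (T.state (k + 1) m) x := by
  obtain ⟨g, hg, hgx⟩ := hbad
  by_cases hmeet : ∃ l' < l, ∃ b ∈ T.B m, ∃ w : G, w⁻¹ • b • x ∈ T.V m l' (T.state k m) w
  · obtain ⟨l', hl', b, hb, w, hy, hwA, hwB⟩ := hmeet
    set y := w⁻¹ • b • x with hydef
    have hbx : b • x = w • y := by rw [hydef, smul_inv_smul]
    have hx : ∀ g : G, g • x = (g * b⁻¹ * w) • y := fun g => by
      rw [mul_smul, ← hbx, mul_smul, inv_smul_smul]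
    have hB2 : ∀ g ∈ T.B m, g * b⁻¹ ∈ T.B m ^ 2 := fun g hg => by
      rw [sq]; exact Finset.mul_mem_mul hg (T.inv_mem_B hb)
    have hA4 : ∀ g ∈ T.B m, g * b⁻¹ * w ∈ T.A m ^ 4 := fun g hg => by
      rw [pow_succ']
      exact Finset.mul_mem_mul (T.B_pow_subset_A m (by omega) (hB2 g hg)) hwA
    have hhit : T.Bad (T.A m ^ 4) k y := by
      by_contra hnot
      simp only [Bad] at hnot
      push Not at hnot
      refine hgx ?_
      have h1 := hnot _ (hA4 1 (T.one_mem_B m))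
      rw [← hx, one_smul] at h1
      rw [h1, hx g, hnot _ (hA4 g (T.D_subset_B m hg))]
    have ht := T.state_succ_of_hit hmk hhit
    refine ⟨l', hl', y, fun b' hb' => ⟨b' * b⁻¹ * w, hx b', hy, ?_, ?_⟩⟩
    all_goals
      obtain ⟨u, hu, v, hv, rfl⟩ := Finset.mem_mul.1 hwB
      have hmem : b' * b⁻¹ * u ∈ T.B m ^ (2 * T.state (k + 1) m y + 1) := by
        rw [ht, show 2 * (T.state k m y + 1) + 1 = 2 + (2 * T.state k m y + 1) by ring, pow_add]
        exact Finset.mul_mem_mul (hB2 b' hb') hu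
      rw [← mul_assoc]
    · rw [pow_succ']
      refine Finset.mul_mem_mul (T.B_pow_subset_A m ?_ hmem) hv
      have := hstate y
      omega
    · exact Finset.mul_mem_mul hmem hv
  · push Not at hmeet
    exfalso
    obtain ⟨y, hy⟩ := hblob
    have hbase : ∀ h ∈ T.D m, T.levelMap m (T.state k m) (l + 1)
        (T.iterMap (T.state k) m (h • x)) = y := by
      intro h hh
      obtain ⟨d, hd, hdx⟩ :=
        (T.tameMap_iterMap hcont hfree (T.continuous_state hcont hfree k) m).1 (h • x)
      rw [hdx, ← mul_smul]
      have hdh := T.mul_mem_B hd hh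
      simp only [levelMap, Function.comp_apply]
      rw [T.levelMap_eq_self fun i hi w => hmeet i hi _ hdh w]
      obtain ⟨w, hw, hV⟩ := hy _ hdh
      have hwy : w⁻¹ • (d * h) • x = y := by rw [hw, inv_smul_smul]
      rw [retract_of_mem (T.uniqueCode_V m l _) (w := w) (by rwa [hwy]), hwy]
    refine hgx (T.iterMap_eq_of_le (Nat.succ_le_succ hmk) ?_)
    refine T.levelMap_eq_of_le (Nat.succ_le_of_lt hl) ?_
    have h1 := hbase 1 (T.one_mem_D m)
    rw [one_smul] at h1
    rw [hbase g hg, h1]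

open scoped Classical in
theorem card_bad_le (hcont : ∀ g : G, Continuous fun x : X => g • x)
    (hfree : ∀ (g : G) (x : X), g • x = x → g = 1) (m d : ℕ) (x : X) :
    ((Finset.Ico m (m + d)).filter fun j =>
      T.Bad (T.D m) j x).card ≤ T.c m := by
  induction d generalizing m x with
  | zero => simp
  | succ d ih =>
    have hstate : ∀ k ≤ m + (d + 1), ∀ y, T.state k m y ≤ T.c (m + 1) + 1 := by
      intro k hk y
      refine (T.state_le_card m k y).trans ?_
      refine le_trans (Finset.card_le_card (t := insert m ((Finset.Ico (m + 1) (m + 1 + d)).filter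
        fun j => T.Bad (T.D (m + 1)) j y)) ?_)
        ((Finset.card_insert_le _ _).trans (Nat.succ_le_succ (ih (m + 1) y)))
      intro j hj
      obtain ⟨hj, w, hw, hwy⟩ := Finset.mem_filter.1 hj
      rw [Finset.mem_Ico] at hj
      rcases eq_or_lt_of_le hj.1 with rfl | hmj
      · exact Finset.mem_insert_self _ _
      · refine Finset.mem_insert_of_mem
          (Finset.mem_filter.2 ⟨Finset.mem_Ico.2 (by omega), w, ?_, hwy⟩)
        exact T.pow_subset_D m (Finset.pow_subset_pow_right (T.one_mem_A m) (by omega) hw)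
    have key : ∀ k, m ≤ k → k ≤ m + (d + 1) → ∃ l, l + ((Finset.Ico m k).filter fun j =>
        T.Bad (T.D m) j x).card < T.c m ∧
        T.InBlob m l (T.state k m) x := by
      intro k hmk
      induction k, hmk using Nat.le_induction with
      | base =>
        intro _
        obtain ⟨l, hl, h⟩ := T.exists_inBlob m (T.state m m) x
        exact ⟨l, by simpa using hl, h⟩
      | succ k hmk ihk =>
        intro hk
        obtain ⟨l, hl, hblob⟩ := ihk (by omega)
        rw [← Finset.insert_Ico_right_eq_Ico_add_one hmk, Finset.filter_insert]
        split_ifs with hbad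
        · obtain ⟨l', hl', h⟩ := T.exists_lt_inBlob_of_bad hcont hfree hmk (by omega)
            (hstate _ hk) hblob hbad
          refine ⟨l', ?_, h⟩
          rw [Finset.card_insert_of_notMem (by simp)]
          omega
        · exact ⟨l, hl, hblob.mono fun y => T.state_le_succ m k y⟩
    obtain ⟨l, hl, -⟩ := key (m + (d + 1)) (by omega) le_rfl
    omega

theorem eventually_finalMap_eq (hcont : ∀ g : G, Continuous fun x : X => g • x)
    (hfree : ∀ (g : G) (x : X), g • x = x → g = 1) (g : G) (x : X) :
    ∀ᶠ n in Filter.atTop, T.finalMap n (g • x) = T.finalMap n x := by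
  classical
  obtain ⟨m, hm⟩ := T.exists_mem_D g
  rw [← Nat.cofinite_eq_atTop, Filter.eventually_cofinite]
  by_contra hinf
  obtain ⟨S, hS, hcard⟩ :=
    (Set.Infinite.sdiff hinf (Finset.range m).finite_toSet).exists_subset_card_eq (T.c m + 1)
  have hsub : S ⊆ (Finset.Ico m (m + (S.sup id + 1))).filter fun j =>
      T.Bad (T.D m) j x := by
    intro j hj
    have hj' := hS hj
    have hle : j ≤ S.sup id := Finset.le_sup (f := id) hj
    have hmj : m ≤ j := by simpa using hj'.2
    exact Finset.mem_filter.2 ⟨Finset.mem_Ico.2 ⟨hmj, by omega⟩, g, hm, hj'.1⟩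
  have := (Finset.card_le_card hsub).trans (T.card_bad_le hcont hfree m _ x)
  omega

end MarkerTower

end Dynamics

theorem exists_markerTower {G X : Type*} [Group G] [Countable G] [DecidableEq G]
    [TopologicalSpace X] [T2Space X] [SecondCountableTopology X] [MulAction G X]
    (hbasis : TopologicalSpace.IsTopologicalBasis {U : Set X | IsClopen U})
    (hcont : ∀ g : G, Continuous fun x : X => g • x)
    (hfree : ∀ (g : G) (x : X), g • x = x → g = 1)
    (hLocNilp : ∀ H : Subgroup G, H.FG → Group.IsNilpotent H) :
    Nonempty (MarkerTower G X) := by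
  obtain ⟨γ, hγ⟩ := exists_surjective_nat G
  let H : ℕ → Subgroup G := fun m =>
    Subgroup.closure ((Finset.range (m + 1)).image γ : Finset G)
  have hHmono : ∀ m, H m ≤ H (m + 1) := fun m => Subgroup.closure_mono
    (Finset.coe_subset.2 (Finset.image_subset_image (Finset.range_mono (by omega))))
  have hγH : ∀ m, γ m ∈ H m := fun m => Subgroup.subset_closure
    (Finset.mem_image_of_mem γ (Finset.self_mem_range_succ m))
  have hHfg : ∀ m, (H m).FG := fun m => ⟨_, rfl⟩
  choose c hc using fun m => exists_uniform_doubling (hHfg m) (hLocNilp _ (hHfg m)) 7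
  have hpow : ∀ (m k : ℕ) (S : Finset G), (S : Set G) ⊆ H m →
      ((S ^ k : Finset G) : Set G) ⊆ H m := by
    intro m k S hS
    induction k with
    | zero => simp
    | succ k ih =>
      rw [pow_succ, Finset.coe_mul]
      rintro _ ⟨a, ha, b, hb, rfl⟩
      exact mul_mem (ih ha) (hS hb)
  have hA : ∀ (m : ℕ) (D : {D : Finset G // (D : Set G) ⊆ H m}), ∃ A : Finset G,
      (D.1 * D.1 ∪ (D.1 * D.1)⁻¹) ^ (2 * (c (m + 1) + 1) + 1) ⊆ A ∧ (A : Set G) ⊆ H m ∧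
      (1 : G) ∈ A ∧ A⁻¹ = A ∧ (A ^ 7).card ≤ c m * A.card := by
    intro m D
    have hDD : ∀ x ∈ D.1 * D.1, x ∈ H m := fun x hx => by
      obtain ⟨a, ha, b, hb, rfl⟩ := Finset.mem_mul.1 hx
      exact mul_mem (D.2 ha) (D.2 hb)
    refine hc m _ (hpow m _ _ fun x hx => ?_)
    rcases Finset.mem_union.1 hx with hx | hx
    · exact hDD x hx
    · exact inv_mem_iff.1 (hDD _ (Finset.mem_inv'.1 hx))
  choose A hBA hAH h1A hAinv hAcard using hA
  let D : ∀ m, {D : Finset G // (D : Set G) ⊆ H m} := fun m => Nat.rec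
    ⟨{1, γ 0}, by
      rw [Finset.coe_insert, Finset.coe_singleton, insert_subset_iff, singleton_subset_iff]
      exact ⟨one_mem _, hγH 0⟩⟩
    (fun m D => ⟨insert (γ (m + 1)) (A m D ^ (3 * c m + 4)), by
      rw [Finset.coe_insert, insert_subset_iff]
      exact ⟨hγH (m + 1), (hpow m _ _ (hAH m D)).trans (hHmono m)⟩⟩) m
  have hDs : ∀ m, (D (m + 1)).1 = insert (γ (m + 1)) (A m (D m) ^ (3 * c m + 4)) := fun m => rfl
  choose Y hYclopen hYsep hYcov using fun m =>
    exists_isClopen_coloring hbasis hcont hfree (A m (D m)) (h1A m _) (hAinv m _) (c m) (hAcard m _)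
  exact ⟨{
    c := c
    D := fun m => (D m).1
    A := fun m => A m (D m)
    Y := Y
    one_mem_D := fun m => by
      cases m with
      | zero => exact Finset.mem_insert_self _ _
      | succ m => exact Finset.mem_insert_of_mem (Finset.one_mem_pow (h1A m _))
    exists_mem_D := fun g => by
      obtain ⟨m, rfl⟩ := hγ g
      refine ⟨m, ?_⟩
      cases m with
      | zero => exact Finset.mem_insert_of_mem (Finset.mem_singleton_self _)
      | succ m => exact Finset.mem_insert_self _ _
    one_mem_A := fun m => h1A m _
    inv_A := fun m => hAinv m _
    pow_subset_A := fun m => hBA m _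
    pow_subset_D := fun m => Finset.subset_insert _ _
    isClopen_Y := hYclopen
    separated := hYsep
    covering := hYcov }⟩

/-- **Theorem 1.2.** If the countable locally nilpotent group `G` acts freely and
continuously on the zero-dimensional Polish space `X`, then the induced orbit equivalence
relation is continuously embeddable into `E_0`, the relation of eventual agreement on
Cantor space `2^ℕ`. -/
theorem orbit_embeds_in_E0_of_locally_nilpotent {G X : Type*} [Group G] [Countable G]
    [TopologicalSpace X] [PolishSpace X] [MulAction G X]
    (hbasis : TopologicalSpace.IsTopologicalBasis {U : Set X | IsClopen U})
    (hcont : ∀ g : G, Continuous fun x : X => g • x)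
    (hfree : ∀ (g : G) (x : X), g • x = x → g = 1)
    (hLocNilp : ∀ H : Subgroup G, H.FG → Group.IsNilpotent H) :
    ∃ f : X → (ℕ → Bool), Continuous f ∧ Function.Injective f ∧
      ∀ x y : X, (∃ g : G, g • x = y) ↔ (∀ᶠ k in Filter.atTop, f x k = f y k) := by
  classical
  obtain ⟨T⟩ := exists_markerTower hbasis hcont hfree hLocNilp
  refine exists_embedding_of_tameMaps hbasis hcont hfree
    (fun n => Nat.casesOn n id fun n => T.finalMap n)
    (fun n => Nat.casesOn n {1} fun n => T.D (n + 1)) (fun n => ?_) (fun x => rfl) fun g x => ?_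
  · cases n with
    | zero => exact TameMap.id hfree
    | succ n => exact T.tameMap_finalMap hcont hfree n
  · obtain ⟨N, hN⟩ := Filter.eventually_atTop.1 (T.eventually_finalMap_eq hcont hfree g x)
    refine Filter.eventually_atTop.2 ⟨N + 1, fun n hn => ?_⟩
    obtain ⟨k, rfl⟩ := Nat.exists_eq_add_of_le' (Nat.one_le_of_lt hn)
    exact hN k (Nat.le_of_succ_le_succ hn)
end

section
/- Let G be a countable group acting in a Borel fashion on a Polish space X, let F ⊆ G be finite and symmetric with 1_G ∈ F, and let Z ⊆ X be a Borel set such that F ∩ Stab(z) = {1_G} for every z ∈ Z. Then there exists a Borel set Y ⊆ Z such that (i) if y, y' ∈ Y are distinct, then there is no g ∈ F with g·y = y', and (ii) for every z ∈ Z there exist y ∈ Y and g ∈ F with g·y = z. Furthermore, if X is zero-dimensional, Z is clopen, and the action of G is continuous, then Y can be chosen to be clopen. -/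
/-- Greedy construction of an `F`-independent subset of `Z`: at stage `n`, add the points of
`Z ∩ A n` whose nontrivial `F`-translates avoid `A n` and whose `F`-translates avoid the
points chosen so far. -/
def greedyMarker {G X : Type*} [Group G] [MulAction G X] (F : Finset G) (Z : Set X)
    (A : ℕ → Set X) : ℕ → Set X
  | 0 => ∅
  | n + 1 => greedyMarker F Z A n ∪
      ((Z ∩ A n) ∩ ⋂ g ∈ F, {x | g ≠ 1 → g • x ∉ A n} ∩ {x | g • x ∉ greedyMarker F Z A n})

section greedyMarker

variable {G X : Type*} [Group G] [MulAction G X] {F : Finset G} {Z : Set X} {A : ℕ → Set X}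

theorem mem_greedyMarker_succ {n : ℕ} {x : X} :
    x ∈ greedyMarker F Z A (n + 1) ↔ x ∈ greedyMarker F Z A n ∨ ((x ∈ Z ∧ x ∈ A n) ∧
      ∀ g ∈ F, (g ≠ 1 → g • x ∉ A n) ∧ g • x ∉ greedyMarker F Z A n) := by
  simp [greedyMarker]

theorem greedyMarker_mono : Monotone (greedyMarker F Z A) :=
  monotone_nat_of_le_succ fun _ _ hx => mem_greedyMarker_succ.2 (Or.inl hx)

theorem greedyMarker_subset (n : ℕ) : greedyMarker F Z A n ⊆ Z := by
  induction n with
  | zero => simp [greedyMarker]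
  | succ n ih =>
    intro x hx
    rcases mem_greedyMarker_succ.1 hx with hx | hx
    exacts [ih hx, hx.1.1]

theorem greedyMarker_independent (hFsymm : ∀ g ∈ F, g⁻¹ ∈ F) (n : ℕ) :
    ∀ y ∈ greedyMarker F Z A n, ∀ g ∈ F, g ≠ 1 → g • y ∉ greedyMarker F Z A n := by
  induction n with
  | zero => simp [greedyMarker]
  | succ n ih =>
    intro y hy g hg hg1 hgy
    rcases mem_greedyMarker_succ.1 hy with hy | hy <;>
      rcases mem_greedyMarker_succ.1 hgy with hgy | hgy
    · exact ih y hy g hg hg1 hgy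
    · exact (hgy.2 g⁻¹ (hFsymm g hg)).2 (by simpa using hy)
    · exact (hy.2 g hg).2 hgy
    · exact (hy.2 g hg).1 hg1 hgy.1.2

theorem iUnion_greedyMarker_independent (hFsymm : ∀ g ∈ F, g⁻¹ ∈ F) :
    ∀ y ∈ ⋃ n, greedyMarker F Z A n, ∀ g ∈ F, g ≠ 1 → g • y ∉ ⋃ n, greedyMarker F Z A n := by
  intro y hy g hg hg1 hgy
  obtain ⟨m, hm⟩ := Set.mem_iUnion.1 hy
  obtain ⟨n, hn⟩ := Set.mem_iUnion.1 hgy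
  exact greedyMarker_independent hFsymm (max m n) y (greedyMarker_mono (le_max_left m n) hm)
    g hg hg1 (greedyMarker_mono (le_max_right m n) hn)

theorem iUnion_greedyMarker_pairwise (hFsymm : ∀ g ∈ F, g⁻¹ ∈ F) :
    ∀ y ∈ ⋃ n, greedyMarker F Z A n, ∀ y' ∈ ⋃ n, greedyMarker F Z A n, y ≠ y' →
      ∀ g ∈ F, g • y ≠ y' := by
  rintro y hy _ hy' hne g hg rfl
  exact iUnion_greedyMarker_independent hFsymm y hy g hg (by rintro rfl; simp at hne) hy'

theorem exists_smul_mem_iUnion_greedyMarker (hF1 : (1 : G) ∈ F)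
    (hA : ∀ z ∈ Z, ∃ n, z ∈ A n ∧ ∀ g ∈ F, g ≠ 1 → g • z ∉ A n) {z : X} (hz : z ∈ Z) :
    ∃ g ∈ F, g • z ∈ ⋃ n, greedyMarker F Z A n := by
  obtain ⟨n, hzn, hn⟩ := hA z hz
  by_cases h : ∃ g ∈ F, g • z ∈ greedyMarker F Z A n
  · obtain ⟨g, hg, hgz⟩ := h
    exact ⟨g, hg, Set.mem_iUnion.2 ⟨n, hgz⟩⟩
  · push Not at h
    refine ⟨1, hF1, Set.mem_iUnion.2 ⟨n + 1, mem_greedyMarker_succ.2 (Or.inr ?_)⟩⟩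
    rw [one_smul]
    exact ⟨⟨hz, hzn⟩, fun g hg => ⟨hn g hg, h g hg⟩⟩

theorem iUnion_greedyMarker_covers (hF1 : (1 : G) ∈ F) (hFsymm : ∀ g ∈ F, g⁻¹ ∈ F)
    (hA : ∀ z ∈ Z, ∃ n, z ∈ A n ∧ ∀ g ∈ F, g ≠ 1 → g • z ∉ A n) :
    ∀ z ∈ Z, ∃ y ∈ ⋃ n, greedyMarker F Z A n, ∃ g ∈ F, g • y = z := by
  intro z hz
  obtain ⟨g, hg, hgz⟩ := exists_smul_mem_iUnion_greedyMarker hF1 hA hz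
  exact ⟨g • z, hgz, g⁻¹, hFsymm g hg, inv_smul_smul g z⟩

theorem measurableSet_greedyMarker [MeasurableSpace X]
    (hmeas : ∀ g : G, Measurable fun x : X => g • x) (hZ : MeasurableSet Z)
    (hA : ∀ n, MeasurableSet (A n)) (n : ℕ) : MeasurableSet (greedyMarker F Z A n) := by
  induction n with
  | zero => exact MeasurableSet.empty
  | succ n ih =>
    refine ih.union ((hZ.inter (hA n)).inter (F.measurableSet_biInter fun g _ => ?_))
    exact ((MeasurableSet.const _).imp (hmeas g (hA n).compl)).inter (hmeas g ih.compl)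

theorem isClopen_greedyMarker [TopologicalSpace X]
    (hcont : ∀ g : G, Continuous fun x : X => g • x) (hZ : IsClopen Z)
    (hA : ∀ n, IsClopen (A n)) (n : ℕ) : IsClopen (greedyMarker F Z A n) := by
  induction n with
  | zero => exact isClopen_empty
  | succ n ih =>
    refine ih.union ((hZ.inter (hA n)).inter (F.finite_toSet.isClopen_biInter fun g _ => ?_))
    refine IsClopen.inter ?_ (ih.compl.preimage (hcont g))
    by_cases hg : g = 1
    · simp [hg, isClopen_univ]
    · simp only [ne_eq, hg, not_false_eq_true, true_imp_iff]
      exact (hA n).compl.preimage (hcont g)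

/-- The complement of the greedy marker set is covered by `Zᶜ` and the nontrivial `F`-translates
of the marker set, so openness of the marker set already yields closedness. -/
theorem isClopen_iUnion_greedyMarker [TopologicalSpace X] (hF1 : (1 : G) ∈ F)
    (hFsymm : ∀ g ∈ F, g⁻¹ ∈ F) (hcont : ∀ g : G, Continuous fun x : X => g • x)
    (hZ : IsClopen Z) (hclopen : ∀ n, IsClopen (A n))
    (hA : ∀ z ∈ Z, ∃ n, z ∈ A n ∧ ∀ g ∈ F, g ≠ 1 → g • z ∉ A n) :
    IsClopen (⋃ n, greedyMarker F Z A n) := by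
  have hopen : IsOpen (⋃ n, greedyMarker F Z A n) :=
    isOpen_iUnion fun n => (isClopen_greedyMarker hcont hZ hclopen n).isOpen
  refine ⟨⟨?_⟩, hopen⟩
  have hcompl : (⋃ n, greedyMarker F Z A n)ᶜ =
      Zᶜ ∪ ⋃ g ∈ {g | g ∈ F ∧ g ≠ 1}, (fun x => g • x) ⁻¹' ⋃ n, greedyMarker F Z A n := by
    ext x
    simp only [Set.mem_compl_iff, Set.mem_union, Set.mem_iUnion₂, Set.mem_ofPred_eq,
      Set.mem_preimage, exists_prop]
    constructor
    · intro hx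
      by_cases hxZ : x ∈ Z
      · obtain ⟨g, hg, hgx⟩ := exists_smul_mem_iUnion_greedyMarker hF1 hA hxZ
        exact Or.inr ⟨g, ⟨hg, by rintro rfl; exact hx (by simpa using hgx)⟩, hgx⟩
      · exact Or.inl hxZ
    · rintro (hx | ⟨g, ⟨hg, hg1⟩, hgx⟩) hxY
      · exact hx (Set.iUnion_subset greedyMarker_subset hxY)
      · exact iUnion_greedyMarker_independent hFsymm x hxY g hg hg1 hgx
  rw [hcompl]
  exact hZ.compl.isOpen.union (isOpen_biUnion fun g _ => hopen.preimage (hcont g))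

/-- A topological basis of a second countable T₁ space contains a sequence whose members
isolate each point of `Z` from its nontrivial `F`-translates. -/
theorem exists_seq_basis_isolating [TopologicalSpace X] [SecondCountableTopology X] [T1Space X]
    {B : Set (Set X)} (hB : TopologicalSpace.IsTopologicalBasis B) (hne : B.Nonempty)
    (hstab : ∀ z ∈ Z, ∀ g ∈ F, g • z = z → g = 1) :
    ∃ A : ℕ → Set X, (∀ n, A n ∈ B) ∧
      ∀ z ∈ Z, ∃ n, z ∈ A n ∧ ∀ g ∈ F, g ≠ 1 → g • z ∉ A n := by
  choose! S hSB hSc hSU using fun u hu => hB.exists_countable_biUnion_of_isOpen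
    (TopologicalSpace.isOpen_of_mem_countableBasis (α := X) (s := u) hu)
  obtain ⟨b, hb⟩ := hne
  set C : Set (Set X) := insert b (⋃ u ∈ TopologicalSpace.countableBasis X, S u)
  have hCc : C.Countable :=
    ((TopologicalSpace.countable_countableBasis X).biUnion hSc).insert b
  have hCB : C ⊆ B := Set.insert_subset hb (Set.iUnion₂_subset hSB)
  obtain ⟨A, hA⟩ := hCc.exists_eq_range (Set.insert_nonempty _ _)
  refine ⟨A, fun n => hCB (hA ▸ Set.mem_range_self n), fun z hz => ?_⟩
  have hfin : {x | ∃ g ∈ F, g ≠ 1 ∧ g • z = x}.Finite :=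
    (F.finite_toSet.image (· • z)).subset fun x ⟨g, hg, _, hx⟩ => ⟨g, hg, hx⟩
  obtain ⟨u, hu, hzu, huO⟩ := (TopologicalSpace.isBasis_countableBasis X).exists_subset_of_mem_open
    (a := z) (fun ⟨g, hg, hg1, hgz⟩ => hg1 (hstab z hz g hg hgz)) hfin.isClosed.isOpen_compl
  obtain ⟨a, ha, hza⟩ := Set.mem_iUnion₂.1 (hSU u hu ▸ hzu)
  have hau : a ⊆ u := (Set.subset_biUnion_of_mem (u := id) ha).trans (hSU u hu).ge
  obtain ⟨n, rfl⟩ : a ∈ Set.range A :=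
    hA ▸ Set.mem_insert_of_mem b (Set.mem_biUnion hu ha)
  exact ⟨n, hza, fun g hg hg1 hgz => huO (hau hgz) ⟨g, hg, hg1, rfl⟩⟩

end greedyMarker

/-- **Lemma 3.1 (Basic marker lemma).**
Let `G` be a countable group acting in a Borel fashion on a Polish space `X`, let
`F ⊆ G` be finite and symmetric with `1 ∈ F`, and let `Z ⊆ X` be a Borel set such that
`F ∩ Stab(z) = {1}` for every `z ∈ Z`. Then there is a Borel set `Y ⊆ Z` such that
(i) distinct points of `Y` are not `F`-translates of one another, and
(ii) every `z ∈ Z` is an `F`-translate of some `y ∈ Y`.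
Moreover, if `X` is zero-dimensional, `Z` is clopen and the action is continuous, then `Y`
can be chosen clopen. -/
theorem marker_lemma {G X : Type*} [Group G] [Countable G]
    [TopologicalSpace X] [PolishSpace X] [MeasurableSpace X] [BorelSpace X] [MulAction G X]
    (hBorel : ∀ g : G, Measurable fun x : X => g • x)
    (F : Finset G) (hF1 : (1 : G) ∈ F) (hFsymm : ∀ g ∈ F, g⁻¹ ∈ F)
    (Z : Set X) (hZ : MeasurableSet Z)
    (hstab : ∀ z ∈ Z, ∀ g ∈ F, g • z = z → g = 1) :
    (∃ Y : Set X, MeasurableSet Y ∧ Y ⊆ Z ∧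
      (∀ y ∈ Y, ∀ y' ∈ Y, y ≠ y' → ∀ g ∈ F, g • y ≠ y') ∧
      (∀ z ∈ Z, ∃ y ∈ Y, ∃ g ∈ F, g • y = z)) ∧
    (TopologicalSpace.IsTopologicalBasis {U : Set X | IsClopen U} → IsClopen Z →
      (∀ g : G, Continuous fun x : X => g • x) →
      ∃ Y : Set X, IsClopen Y ∧ Y ⊆ Z ∧
        (∀ y ∈ Y, ∀ y' ∈ Y, y ≠ y' → ∀ g ∈ F, g • y ≠ y') ∧
        (∀ z ∈ Z, ∃ y ∈ Y, ∃ g ∈ F, g • y = z)) := by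
  have key : ∀ {B : Set (Set X)}, TopologicalSpace.IsTopologicalBasis B → Set.univ ∈ B →
      ∃ A : ℕ → Set X, (∀ n, A n ∈ B) ∧
        ∀ z ∈ Z, ∃ n, z ∈ A n ∧ ∀ g ∈ F, g ≠ 1 → g • z ∉ A n :=
    fun hB hu => exists_seq_basis_isolating hB ⟨_, hu⟩ hstab
  constructor
  · obtain ⟨A, hAo, hA⟩ := key TopologicalSpace.isTopologicalBasis_opens isOpen_univ
    exact ⟨⋃ n, greedyMarker F Z A n,
      .iUnion (measurableSet_greedyMarker hBorel hZ fun n => (hAo n).measurableSet),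
      Set.iUnion_subset greedyMarker_subset, iUnion_greedyMarker_pairwise hFsymm,
      iUnion_greedyMarker_covers hF1 hFsymm hA⟩
  · intro hB hZc hcont
    obtain ⟨A, hAc, hA⟩ := key hB isClopen_univ
    exact ⟨⋃ n, greedyMarker F Z A n,
      isClopen_iUnion_greedyMarker hF1 hFsymm hcont hZc hAc hA,
      Set.iUnion_subset greedyMarker_subset, iUnion_greedyMarker_pairwise hFsymm,
      iUnion_greedyMarker_covers hF1 hFsymm hA⟩
end

section
/- Let G be a countable group acting in a Borel fashion on a Polish space X, and let Y ⊆ X be a non-empty Borel set. If F ⊆ G is finite and symmetric with 1_G ∈ F and F ∩ Stab(y) = {1_G} for every y ∈ Y, then there is a partition of Y into finitely many pairwise disjoint Borel sets Y = Y_1 ⊔ ⋯ ⊔ Y_k such that for all 1 ≤ i ≤ k and all distinct y, y' ∈ Y_i, there is no g ∈ F with g·y = y'. Furthermore, if X is zero-dimensional, Y is clopen, and the action of G is continuous, then the Y_i can be chosen to be clopen. -/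
open MeasureTheory TopologicalSpace

section GreedyColoring

variable {G X : Type*} [SMul G X]

/-- The greedy coloring along a rank function `r`: a point of `Y` receives the least color not
already used by its `F`-translates in `Y` of strictly smaller rank. -/
noncomputable def greedyColor (F : Finset G) (Y : Set X) (r : X → ℕ) (y : X) : ℕ :=
  sInf {i | ∀ g ∈ F, g • y ∈ Y → ∀ _ : r (g • y) < r y, greedyColor F Y r (g • y) ≠ i}
termination_by r y

/-- The colors available to `y` in the greedy coloring. -/
def availableColors (F : Finset G) (Y : Set X) (r : X → ℕ) (y : X) : Set ℕ :=
  {i | ∀ g ∈ F, g • y ∈ Y → r (g • y) < r y → greedyColor F Y r (g • y) ≠ i}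

variable (F : Finset G) (Y : Set X) (r : X → ℕ)

lemma greedyColor_eq_sInf (y : X) :
    greedyColor F Y r y = sInf (availableColors F Y r y) := by
  rw [greedyColor]
  rfl

lemma exists_mem_availableColors_le_card (y : X) :
    ∃ i ∈ availableColors F Y r y, i ≤ F.card := by
  classical
  obtain ⟨i, hi, hiF⟩ : ∃ i ∈ Finset.range (F.card + 1),
      i ∉ F.image fun g => greedyColor F Y r (g • y) :=
    Finset.exists_mem_notMem_of_card_lt_card
      (Finset.card_image_le.trans_lt (by simp))
  refine ⟨i, fun g hg _ _ h => hiF (Finset.mem_image.2 ⟨g, hg, h⟩), ?_⟩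
  exact Nat.lt_succ_iff.1 (Finset.mem_range.1 hi)

lemma greedyColor_le_card (y : X) : greedyColor F Y r y ≤ F.card := by
  obtain ⟨i, hi, hle⟩ := exists_mem_availableColors_le_card F Y r y
  rw [greedyColor_eq_sInf]
  exact (Nat.sInf_le hi).trans hle

lemma greedyColor_mem_availableColors (y : X) :
    greedyColor F Y r y ∈ availableColors F Y r y := by
  obtain ⟨i, hi, -⟩ := exists_mem_availableColors_le_card F Y r y
  rw [greedyColor_eq_sInf]
  exact Nat.sInf_mem ⟨i, hi⟩

lemma greedyColor_eq_iff (y : X) (i : ℕ) :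
    greedyColor F Y r y = i ↔
      i ∈ availableColors F Y r y ∧ ∀ j < i, j ∉ availableColors F Y r y := by
  constructor
  · rintro rfl
    refine ⟨greedyColor_mem_availableColors F Y r y, fun j hj => ?_⟩
    rw [greedyColor_eq_sInf] at hj
    exact Nat.notMem_of_lt_sInf hj
  · rintro ⟨hi, hmin⟩
    refine le_antisymm ?_ (not_lt.1 fun h => hmin _ h (greedyColor_mem_availableColors F Y r y))
    rw [greedyColor_eq_sInf]
    exact Nat.sInf_le hi

/-- If the levels of the rank function belong to an algebra of sets that is invariant under the
action, then so do the color classes within each level. -/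
lemma greedyColor_level_mem {𝒜 : Set (Set X)} (h𝒜 : IsSetAlgebra 𝒜)
    (hpre : ∀ g : G, ∀ A ∈ 𝒜, (fun x : X => g • x) ⁻¹' A ∈ 𝒜)
    (hr : ∀ n, {y | y ∈ Y ∧ r y = n} ∈ 𝒜) (n i : ℕ) :
    {y | y ∈ Y ∧ r y = n ∧ greedyColor F Y r y = i} ∈ 𝒜 := by
  induction n using Nat.strong_induction_on generalizing i with
  | _ n ih =>
    let D : ℕ → Set X := fun j => ⋂ g ∈ F, ⋂ m ∈ Finset.range n, ((fun x : X => g • x) ⁻¹'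
      {y | y ∈ Y ∧ r y = m ∧ greedyColor F Y r y = j})ᶜ
    have hD : ∀ j, D j ∈ 𝒜 := fun j =>
      h𝒜.biInter_mem _ fun g _ => h𝒜.biInter_mem _ fun m hm =>
        h𝒜.compl_mem (hpre g _ (ih m (Finset.mem_range.1 hm) j))
    have hiff : ∀ y, r y = n → ∀ j, y ∈ D j ↔ j ∈ availableColors F Y r y := by
      rintro y rfl j
      simp only [D, Set.mem_iInter, Finset.mem_range, Set.mem_compl_iff, Set.mem_preimage,
        Set.mem_ofPred_eq, availableColors]
      exact ⟨fun h g hg hY hlt hc => h g hg _ hlt ⟨hY, rfl, hc⟩,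
        fun h g hg m hm hc => h g hg hc.1 (hc.2.1 ▸ hm) hc.2.2⟩
    have hmem : {y | y ∈ Y ∧ r y = n} ∩ (D i ∩ ⋂ j ∈ Finset.range i, (D j)ᶜ) ∈ 𝒜 :=
      h𝒜.inter_mem (hr n) (h𝒜.inter_mem (hD i)
        (h𝒜.biInter_mem _ fun j _ => h𝒜.compl_mem (hD j)))
    convert hmem using 1
    ext y
    simp only [Set.mem_inter_iff, Set.mem_iInter, Finset.mem_range, Set.mem_compl_iff,
      Set.mem_ofPred_eq, greedyColor_eq_iff]
    rw [← and_assoc]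
    exact and_congr_right fun hy => by simp only [hiff y hy.2]

end GreedyColoring

lemma greedyColor_smul_ne {G X : Type*} [Group G] [MulAction G X] {F : Finset G} {Y : Set X}
    {r : X → ℕ} (hFsymm : ∀ g ∈ F, g⁻¹ ∈ F) {y : X} {g : G} (hg : g ∈ F) (hy : y ∈ Y)
    (hgy : g • y ∈ Y) (hr : r (g • y) ≠ r y) :
    greedyColor F Y r (g • y) ≠ greedyColor F Y r y := by
  rcases hr.lt_or_gt with hlt | hlt
  · exact greedyColor_mem_availableColors F Y r y g hg hgy hlt
  · have := greedyColor_mem_availableColors F Y r (g • y) g⁻¹ (hFsymm g hg)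
    rw [inv_smul_smul] at this
    exact (this hy hlt).symm

/-- Given a countable basis contained in an invariant algebra of sets, there is a rank function
on `Y` whose levels are in the algebra and which separates each point of `Y` from its nontrivial
`F`-translates. -/
lemma exists_rank_of_isTopologicalBasis {G X : Type*} [Group G] [MulAction G X]
    [TopologicalSpace X] [T1Space X] {𝒜 : Set (Set X)} (h𝒜 : IsSetAlgebra 𝒜)
    (hpre : ∀ g : G, ∀ A ∈ 𝒜, (fun x : X => g • x) ⁻¹' A ∈ 𝒜)
    {B : Set (Set X)} (hB : IsTopologicalBasis B) (hBc : B.Countable) (hB𝒜 : B ⊆ 𝒜)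
    {Y : Set X} (hY : Y ∈ 𝒜) {F : Finset G}
    (hstab : ∀ y ∈ Y, ∀ g ∈ F, g • y = y → g = 1) :
    ∃ r : X → ℕ, (∀ n, {y | y ∈ Y ∧ r y = n} ∈ 𝒜) ∧
      ∀ y ∈ Y, ∀ g ∈ F, g ≠ 1 → g • y ∈ Y → r (g • y) ≠ r y := by
  classical
  obtain ⟨U, hU⟩ := (hBc.insert ∅).exists_eq_range (Set.insert_nonempty _ _)
  have hU𝒜 : ∀ n, U n ∈ 𝒜 := fun n => by
    rcases hU ▸ Set.mem_range_self n with h | h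
    · exact h ▸ h𝒜.empty_mem
    · exact hB𝒜 h
  let V : ℕ → Set X := fun n =>
    (Y ∩ U n) ∩ ⋂ g ∈ F.erase 1, ((fun x : X => g • x) ⁻¹' U n)ᶜ
  have hV𝒜 : ∀ n, V n ∈ 𝒜 := fun n =>
    h𝒜.inter_mem (h𝒜.inter_mem hY (hU𝒜 n))
      (h𝒜.biInter_mem _ fun g _ => h𝒜.compl_mem (hpre g _ (hU𝒜 n)))
  have hcover : ∀ y ∈ Y, ∃ n, y ∈ V n := by
    intro y hy
    have hopen : IsOpen ((((F.erase 1).image fun g => g • y : Finset X) : Set X)ᶜ) :=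
      (Finset.finite_toSet _).isClosed.isOpen_compl
    have hmem : y ∈ (((F.erase 1).image fun g => g • y : Finset X) : Set X)ᶜ := by
      simp only [Set.mem_compl_iff, Finset.mem_coe, Finset.mem_image, Finset.mem_erase]
      rintro ⟨g, ⟨hg1, hg⟩, h⟩
      exact hg1 (hstab y hy g hg h)
    obtain ⟨W, hWB, hyW, hW⟩ := hB.exists_subset_of_mem_open hmem hopen
    obtain ⟨n, rfl⟩ : W ∈ Set.range U := hU ▸ Set.mem_insert_of_mem _ hWB
    refine ⟨n, ⟨hy, hyW⟩, Set.mem_iInter₂.2 fun g hg hgW => hW hgW ?_⟩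
    exact Finset.mem_coe.2 (Finset.mem_image_of_mem (fun g => g • y) hg)
  have hspec : ∀ y ∈ Y, y ∈ V (sInf {n | y ∈ V n}) := fun y hy => Nat.sInf_mem (hcover y hy)
  refine ⟨fun y => sInf {n | y ∈ V n}, fun n => ?_, fun y hy g hg hg1 hgy h => ?_⟩
  · convert h𝒜.sdiff_mem (hV𝒜 n) (h𝒜.biUnion_mem (Finset.range n) fun m _ => hV𝒜 m) using 1
    ext y
    simp only [Set.mem_ofPred_eq, Set.mem_sdiff, Set.mem_iUnion, Finset.mem_range, not_exists]
    constructor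
    · rintro ⟨hy, rfl⟩
      exact ⟨hspec y hy, fun m hm => Nat.notMem_of_lt_sInf hm⟩
    · rintro ⟨hyn, hmin⟩
      exact ⟨hyn.1.1, le_antisymm (Nat.sInf_le hyn)
        (not_lt.1 fun hlt => hmin _ hlt (hspec y hyn.1.1))⟩
  · have hgV := (hspec (g • y) hgy).1.2
    dsimp only at h
    rw [h] at hgV
    exact Set.mem_iInter₂.1 (hspec y hy).2 g (Finset.mem_erase.2 ⟨hg1, hg⟩) hgV

/-- Given a countable basis contained in an invariant algebra of sets, a set `Y` of the algebra
splits into finitely many `F`-separated pieces, each of which is a countable union of sets of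
the algebra. -/
lemma exists_separated_partition {G X : Type*} [Group G] [MulAction G X]
    [TopologicalSpace X] [T1Space X] {𝒜 : Set (Set X)} (h𝒜 : IsSetAlgebra 𝒜)
    (hpre : ∀ g : G, ∀ A ∈ 𝒜, (fun x : X => g • x) ⁻¹' A ∈ 𝒜)
    {B : Set (Set X)} (hB : IsTopologicalBasis B) (hBc : B.Countable) (hB𝒜 : B ⊆ 𝒜)
    {Y : Set X} (hY : Y ∈ 𝒜) {F : Finset G} (hFsymm : ∀ g ∈ F, g⁻¹ ∈ F)
    (hstab : ∀ y ∈ Y, ∀ g ∈ F, g • y = y → g = 1) :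
    ∃ (k : ℕ) (P : Fin k → Set X),
      (∀ i, ∃ A : ℕ → Set X, (∀ n, A n ∈ 𝒜) ∧ P i = ⋃ n, A n) ∧
      (∀ i j, i ≠ j → Disjoint (P i) (P j)) ∧
      (⋃ i, P i) = Y ∧
      (∀ i, ∀ y ∈ P i, ∀ y' ∈ P i, y ≠ y' → ∀ g ∈ F, g • y ≠ y') := by
  obtain ⟨r, hr, hsep⟩ := exists_rank_of_isTopologicalBasis h𝒜 hpre hB hBc hB𝒜 hY hstab
  refine ⟨F.card + 1, fun i => {y | y ∈ Y ∧ greedyColor F Y r y = i}, fun i =>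
    ⟨_, fun n => greedyColor_level_mem F Y r h𝒜 hpre hr n i, ?_⟩, fun i j hij => ?_, ?_, ?_⟩
  · ext y
    simp
  · exact Set.disjoint_left.2 fun y hi hj => hij (Fin.ext (hi.2.symm.trans hj.2))
  · ext y
    simp only [Set.mem_iUnion, Set.mem_ofPred_eq]
    exact ⟨fun ⟨_, hy, _⟩ => hy, fun hy =>
      ⟨⟨_, Nat.lt_succ_of_le (greedyColor_le_card F Y r y)⟩, hy, rfl⟩⟩
  · rintro i y ⟨hy, hc⟩ _ ⟨hgy, hc'⟩ hne g hg rfl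
    have hg1 : g ≠ 1 := by
      rintro rfl
      exact hne (one_smul G y).symm
    exact greedyColor_smul_ne hFsymm hg hy hgy (hsep y hy g hg hg1 hgy) (hc'.trans hc.symm)

/-- If disjoint open sets have a closed union, then each of them is clopen. -/
lemma isClopen_of_iUnion_eq {ι X : Type*} [TopologicalSpace X] {P : ι → Set X} {Y : Set X}
    (hopen : ∀ i, IsOpen (P i)) (hdisj : ∀ i j, i ≠ j → Disjoint (P i) (P j))
    (hP : ⋃ i, P i = Y) (hY : IsClosed Y) (i : ι) : IsClopen (P i) := by
  refine ⟨?_, hopen i⟩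
  have heq : P i = Y \ ⋃ (j) (_ : j ≠ i), P j := by
    ext y
    simp only [← hP, Set.mem_sdiff, Set.mem_iUnion, not_exists]
    constructor
    · exact fun h => ⟨⟨i, h⟩, fun j hj hyj => Set.disjoint_left.1 (hdisj j i hj) hyj h⟩
    · rintro ⟨⟨j, hj⟩, h⟩
      by_cases hji : j = i
      · exact hji ▸ hj
      · exact (h j hji hj).elim
  rw [heq]
  exact hY.sdiff (isOpen_iUnion fun j => isOpen_iUnion fun _ => hopen j)

/-- **Corollary 3.2 (finite Borel partition into `F`-separated pieces).**
Let `G` be a countable group acting in a Borel fashion on a Polish space `X` and let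
`Y ⊆ X` be a nonempty Borel set. If `F ⊆ G` is finite and symmetric with `1 ∈ F` and
`F ∩ Stab(y) = {1}` for all `y ∈ Y`, then `Y` can be partitioned into finitely many pairwise
disjoint Borel sets `Y = Y_1 ⊔ ⋯ ⊔ Y_k` such that no piece contains two distinct points that
are `F`-translates of one another. Moreover, if `X` is zero-dimensional, `Y` is clopen and
the action is continuous, the pieces can be chosen clopen. -/
theorem marker_partition {G X : Type*} [Group G] [Countable G]
    [TopologicalSpace X] [PolishSpace X] [MeasurableSpace X] [BorelSpace X] [MulAction G X]
    (hBorel : ∀ g : G, Measurable fun x : X => g • x)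
    (Y : Set X) (hYne : Y.Nonempty) (hY : MeasurableSet Y)
    (F : Finset G) (hF1 : (1 : G) ∈ F) (hFsymm : ∀ g ∈ F, g⁻¹ ∈ F)
    (hstab : ∀ y ∈ Y, ∀ g ∈ F, g • y = y → g = 1) :
    (∃ (k : ℕ) (P : Fin k → Set X),
      (∀ i, MeasurableSet (P i)) ∧
      (∀ i j, i ≠ j → Disjoint (P i) (P j)) ∧
      (⋃ i, P i) = Y ∧
      (∀ i, ∀ y ∈ P i, ∀ y' ∈ P i, y ≠ y' → ∀ g ∈ F, g • y ≠ y')) ∧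
    (TopologicalSpace.IsTopologicalBasis {U : Set X | IsClopen U} → IsClopen Y →
      (∀ g : G, Continuous fun x : X => g • x) →
      ∃ (k : ℕ) (P : Fin k → Set X),
        (∀ i, IsClopen (P i)) ∧
        (∀ i j, i ≠ j → Disjoint (P i) (P j)) ∧
        (⋃ i, P i) = Y ∧
        (∀ i, ∀ y ∈ P i, ∀ y' ∈ P i, y ≠ y' → ∀ g ∈ F, g • y ≠ y')) := by
  refine ⟨?_, fun hbasis hYc hcont => ?_⟩
  · have h𝒜 : IsSetAlgebra {A : Set X | MeasurableSet A} :=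
      ⟨MeasurableSet.empty, fun _ h => h.compl, fun _ _ h h' => h.union h'⟩
    obtain ⟨k, P, hP, hrest⟩ := exists_separated_partition h𝒜 (fun g _ hA => hBorel g hA)
      (isBasis_countableBasis X) (countable_countableBasis X)
      (fun _ hU => (isOpen_of_mem_countableBasis hU).measurableSet) hY hFsymm hstab
    refine ⟨k, P, fun i => ?_, hrest⟩
    obtain ⟨A, hA, hPA⟩ := hP i
    exact hPA ▸ MeasurableSet.iUnion hA
  · have h𝒜 : IsSetAlgebra {A : Set X | IsClopen A} :=
      ⟨isClopen_empty, fun _ h => h.compl, fun _ _ h h' => h.union h'⟩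
    obtain ⟨B, hB𝒜, hBc, hB⟩ := hbasis.exists_countable
    obtain ⟨k, P, hP, hdisj, hunion, hsep⟩ := exists_separated_partition h𝒜
      (fun g _ hA => hA.preimage (hcont g)) hB hBc hB𝒜 hYc hFsymm hstab
    refine ⟨k, P, isClopen_of_iUnion_eq (fun i => ?_) hdisj hunion hYc.isClosed,
      hdisj, hunion, hsep⟩
    obtain ⟨A, hA, hPA⟩ := hP i
    exact hPA ▸ isOpen_iUnion fun n => (hA n).isOpen
end

section
/- Let a countable group G act freely and continuously on a zero-dimensional Polish space X. Let E be a finite G-clopen equivalence relation on X and suppose there is a finite set K ⊆ G such that [x]_E ⊆ K·x for all x ∈ X. Then there is a continuous and G-clopen selector S for E, i.e. a continuous function S : X → X such that {x : S(x) = g·x} is clopen for every g ∈ G, x E S(x) for all x, and for all x, y ∈ X, x E y iff S(x) = S(y). -/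
open Topology in
/-- For a free action by homeomorphisms on a zero-dimensional Hausdorff space and a finite `K`,
every point has a clopen neighbourhood that is moved off itself by all of `K \ {1}`. -/
lemma exists_isClopen_forall_smul_notMem {G X : Type*} [Group G] [TopologicalSpace X] [T2Space X]
    [MulAction G X]
    (hbasis : TopologicalSpace.IsTopologicalBasis {U : Set X | IsClopen U})
    (hcont : ∀ g : G, Continuous fun x : X => g • x)
    (hfree : ∀ (g : G) (x : X), g • x = x → g = 1) (K : Finset G) (x : X) :
    ∃ U : Set X, IsClopen U ∧ x ∈ U ∧ ∀ k ∈ K, k ≠ 1 → ∀ y ∈ U, k • y ∉ U := by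
  have hopen : ∀ k : G, ∃ W : Set X, W ∈ 𝓝 x ∧ (k ≠ 1 → ∀ y ∈ W, k • y ∉ W) := by
    intro k
    by_cases hk : k = 1
    · exact ⟨Set.univ, Filter.univ_mem, fun h => absurd hk h⟩
    · obtain ⟨A, B, hA, hB, hkA, hxB, hAB⟩ := t2_separation fun h => hk (hfree k x h)
      refine ⟨B ∩ (fun y => k • y) ⁻¹' A, Filter.inter_mem (hB.mem_nhds hxB)
        ((hA.preimage (hcont k)).mem_nhds hkA), fun _ y hy hy' => ?_⟩
      exact Set.disjoint_left.mp hAB hy.2 hy'.1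
  choose W hW hWk using hopen
  obtain ⟨U, hU, hxU, hUW⟩ := hbasis.mem_nhds_iff.mp
    ((Filter.biInter_finset_mem K).mpr fun k _ => hW k)
  refine ⟨U, hU, hxU, fun k hk hk1 y hy hky => hWk k hk1 y ?_ ?_⟩
  · exact Set.mem_iInter₂.mp (hUW hy) k hk
  · exact Set.mem_iInter₂.mp (hUW hky) k hk

/-- The Schreier graph of a free action with respect to a finite set has a continuous
`ℕ`-colouring. -/
lemma exists_continuous_nat_coloring {G X : Type*} [Group G] [TopologicalSpace X] [T2Space X]
    [SecondCountableTopology X] [MulAction G X]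
    (hbasis : TopologicalSpace.IsTopologicalBasis {U : Set X | IsClopen U})
    (hcont : ∀ g : G, Continuous fun x : X => g • x)
    (hfree : ∀ (g : G) (x : X), g • x = x → g = 1) (K : Finset G) :
    ∃ c : X → ℕ, Continuous c ∧ ∀ x, ∀ k ∈ K, c (k • x) = c x → k • x = x := by
  classical
  choose U hU hxU hUK using exists_isClopen_forall_smul_notMem hbasis hcont hfree K
  obtain ⟨s, hs, hcover⟩ := TopologicalSpace.countable_cover_nhds
    fun x => (hU x).isOpen.mem_nhds (hxU x)
  rcases isEmpty_or_nonempty X with hX | ⟨⟨x₀⟩⟩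
  · exact ⟨fun _ => 0, continuous_const, fun x => (hX.false x).elim⟩
  have hne : s.Nonempty := by
    have hx₀ : x₀ ∈ ⋃ x ∈ s, U x := hcover ▸ Set.mem_univ x₀
    obtain ⟨z, hz, -⟩ := Set.mem_iUnion₂.mp hx₀
    exact ⟨z, hz⟩
  obtain ⟨f, rfl⟩ := hs.exists_eq_range hne
  have hex : ∀ x, ∃ n, x ∈ U (f n) := fun x => by
    have hx : x ∈ ⋃ z ∈ Set.range f, U z := hcover ▸ Set.mem_univ x
    simpa using hx
  refine ⟨fun x => Nat.find (hex x), continuous_discrete_rng.mpr fun n => ?_,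
    fun x k hk hc => ?_⟩
  · have hpre : (fun x => Nat.find (hex x)) ⁻¹' {n} =
        U (f n) ∩ ⋂ m ∈ Finset.range n, (U (f m))ᶜ := by
      ext x
      simp [Nat.find_eq_iff]
    rw [hpre]
    exact (hU _).isOpen.inter (isOpen_biInter_finset fun m _ => (hU _).compl.isOpen)
  · by_contra hne
    have hk1 : k ≠ 1 := fun h => hne (by rw [h, one_smul])
    refine hUK _ k hk hk1 x (Nat.find_spec (hex x)) ?_
    beta_reduce at hc
    rw [← hc]
    exact Nat.find_spec (hex (k • x))

/-- **Lemma 3.6 (continuous `G`-clopen selectors).**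
Let the countable group `G` act freely and continuously on the zero-dimensional Polish
space `X`. Let `E` be a finite `G`-clopen equivalence relation on `X` and suppose there is a
finite `K ⊆ G` with `[x]_E ⊆ K·x` for all `x`. Then there is a continuous `G`-clopen
selector `S` for `E`: a continuous map `S : X → X` with `{x | S x = g • x}` clopen for all
`g`, `x E S(x)` for all `x`, and `x E y ↔ S x = S y`. -/
theorem continuous_selector {G X : Type*} [Group G] [Countable G]
    [TopologicalSpace X] [PolishSpace X] [MulAction G X]
    (hbasis : TopologicalSpace.IsTopologicalBasis {U : Set X | IsClopen U})
    (hcont : ∀ g : G, Continuous fun x : X => g • x)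
    (hfree : ∀ (g : G) (x : X), g • x = x → g = 1)
    (E : X → X → Prop) (hE : Equivalence E)
    (hfin : ∀ x : X, {y | E x y}.Finite)
    (hGclopen : ∀ g : G, IsClopen {x : X | E x (g • x)})
    (K : Finset G) (hK : ∀ x y : X, E x y → ∃ g ∈ K, g • x = y) :
    ∃ S : X → X, Continuous S ∧
      (∀ g : G, IsClopen {x : X | S x = g • x}) ∧
      (∀ x, E x (S x)) ∧
      (∀ x y, E x y ↔ S x = S y) := by
  obtain ⟨c, hc, hcK⟩ := exists_continuous_nat_coloring hbasis hcont hfree K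
  have hinj : ∀ x y, E x y → c y = c x → y = x := by
    intro x y hxy h
    obtain ⟨k, hk, rfl⟩ := hK x y hxy
    exact hcK x k hk h
  have hmin : ∀ x, ∃ y, E x y ∧ ∀ z, E x z → c y ≤ c z := fun x => by
    obtain ⟨y, hy, hle⟩ := (hfin x).exists_minimalFor c _ ⟨x, hE.refl x⟩
    exact ⟨y, hy, fun z hz => (le_total (c y) (c z)).elim id (hle hz)⟩
  choose S hS hSmin using hmin
  have huniq : ∀ x y, E x y → (∀ z, E x z → c y ≤ c z) → S x = y := fun x y hy hle =>
    hinj y (S x) (hE.trans (hE.symm hy) (hS x)) (le_antisymm (hSmin x y hy) (hle _ (hS x)))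
  have hclopen : ∀ g : G, IsClopen {x : X | S x = g • x} := by
    intro g
    have hset : {x : X | S x = g • x} = {x | E x (g • x)} ∩
        ⋂ k ∈ K, ({x | E x (k • x)}ᶜ ∪ {x | c (g • x) ≤ c (k • x)}) := by
      ext x
      simp only [Set.mem_ofPred_eq, Set.mem_inter_iff, Set.mem_iInter, Set.mem_union,
        Set.mem_compl_iff, ← imp_iff_not_or]
      constructor
      · intro h
        exact ⟨h ▸ hS x, fun k _ hk => h ▸ hSmin x _ hk⟩
      · rintro ⟨hg, hle⟩
        refine huniq x _ hg fun z hz => ?_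
        obtain ⟨k, hk, rfl⟩ := hK x z hz
        exact hle k hk hz
    rw [hset]
    refine (hGclopen g).inter (K.finite_toSet.isClopen_biInter fun k _ =>
      (hGclopen k).compl.union ?_)
    exact (isClopen_discrete {p : ℕ × ℕ | p.1 ≤ p.2}).preimage
      ((hc.comp (hcont g)).prodMk (hc.comp (hcont k)))
  refine ⟨S, ?_, hclopen, hS, fun x y => ⟨fun h => ?_, fun h => ?_⟩⟩
  · refine continuous_iff_continuousAt.mpr fun x => ?_
    obtain ⟨g, -, hg⟩ := hK x (S x) (hS x)
    refine (hcont g).continuousAt.congr ?_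
    filter_upwards [(hclopen g).isOpen.mem_nhds hg.symm] with y hy using hy.symm
  · exact huniq x (S y) (hE.trans h (hS y)) fun z hz => hSmin y z (hE.trans (hE.symm h) hz)
  · exact hE.trans (hS x) (h ▸ hE.symm (hS y))
end

section
/- Let a countable group G act freely and continuously on a zero-dimensional Polish space X. Let F_1, F_2, … be a sequence of finite G-clopen equivalence relations on X, and suppose there are finite sets K_n ⊆ G such that [x]_{F_n} ⊆ K_n·x for all n ≥ 1 and all x ∈ X. Define F by: x F y iff there is m ∈ ℕ such that x F_n y for all n ≥ m. Then there is a continuous embedding of F into E_0. -/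
open Filter Topology

/-- A second countable T₀ space with a clopen base injects continuously into Cantor space. -/
theorem exists_continuous_injective_cantor {X : Type*} [TopologicalSpace X] [T0Space X]
    [SecondCountableTopology X]
    (hbasis : TopologicalSpace.IsTopologicalBasis {U : Set X | IsClopen U}) :
    ∃ e : X → ℕ → Bool, Continuous e ∧ Function.Injective e := by
  classical
  obtain ⟨B, hBsub, hBc, hB⟩ := hbasis.exists_countable
  rcases B.eq_empty_or_nonempty with rfl | hne
  · exact ⟨fun _ _ => false, continuous_const, fun x y _ => hB.eq_iff.2 (by simp)⟩
  obtain ⟨U, rfl⟩ := hBc.exists_eq_range hne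
  have hU : ∀ n, IsClopen (U n) := fun n => hBsub ⟨n, rfl⟩
  refine ⟨fun x n => decide (x ∈ U n), continuous_pi fun n => ?_, fun x y hxy => ?_⟩
  · exact (continuous_bool_rng true).2 (by simpa [Set.preimage] using hU n)
  · refine hB.eq_iff.2 ?_
    rintro _ ⟨n, rfl⟩
    simpa using congrFun hxy n

theorem continuous_cantorFunction {c : ℝ} (h0 : 0 ≤ c) (h1 : c < 1) :
    Continuous (Cardinal.cantorFunction c) := by
  refine continuous_tsum (u := fun n => c ^ n) (fun n => ?_)
    (summable_geometric_of_lt_one h0 h1) fun n f => ?_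
  · exact (continuous_of_discreteTopology (f := fun b : Bool => cond b (c ^ n) 0)).comp
      (continuous_apply n)
  · cases h : f n
    · simpa [h] using pow_nonneg h0 n
    · simp [h, abs_of_nonneg h0]

/-- Finite blocks of continuous bits can be concatenated into one point of Cantor space. -/
theorem exists_continuous_concat {X : Type*} [TopologicalSpace X] {ι : ℕ → Type*}
    [∀ n, Finite (ι n)] (b : ∀ n, ι n → X → Bool) (hb : ∀ n i, Continuous (b n i)) :
    ∃ f : X → ℕ → Bool, Continuous f ∧
      (∀ x y, f x = f y → ∀ n i, b n i x = b n i y) ∧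
      ∀ x y, (∀ᶠ k in atTop, f x k = f y k) ↔ ∀ᶠ n in atTop, ∀ i, b n i x = b n i y := by
  obtain ⟨j, hj⟩ := exists_injective_nat (Σ n, ι n)
  set f : X → ℕ → Bool :=
    fun x => Function.extend j (fun p : Σ n, ι n => b p.1 p.2 x) fun _ => false with hf
  have hfj : ∀ x p, f x (j p) = b p.1 p.2 x := fun x p => hj.extend_apply _ _ p
  refine ⟨f, continuous_pi fun k => ?_, fun x y hxy n i => ?_, fun x y => ?_⟩
  · by_cases hk : ∃ p, j p = k
    · obtain ⟨p, rfl⟩ := hk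
      simpa only [hfj] using hb p.1 p.2
    · simpa only [hf, Function.extend_apply' _ _ _ hk] using continuous_const
  · rw [← hfj x ⟨n, i⟩, hxy, hfj]
  · constructor
    · intro h
      rw [← Nat.cofinite_eq_atTop, eventually_cofinite] at h ⊢
      refine ((h.preimage hj.injOn).image Sigma.fst).subset ?_
      intro n hn
      simp only [Set.mem_ofPred_eq, not_forall] at hn
      obtain ⟨i, hi⟩ := hn
      exact ⟨⟨n, i⟩, by simpa [hfj] using hi, rfl⟩
    · intro h
      rw [← Nat.cofinite_eq_atTop, eventually_cofinite] at h ⊢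
      refine (Set.Finite.biUnion h fun n _ => Set.finite_range fun i : ι n => j ⟨n, i⟩).subset ?_
      intro k hk
      by_cases hk' : ∃ p, j p = k
      · obtain ⟨⟨n, i⟩, rfl⟩ := hk'
        refine Set.mem_biUnion (x := n) (fun hall => hk ?_) ⟨i, rfl⟩
        simpa [hfj] using hall i
      · exact absurd (by simp only [hf, Function.extend_apply' _ _ _ hk']) hk

section Action

variable {G X : Type*} [Group G] [MulAction G X]

theorem smul_left_cancel_of_free (hfree : ∀ (g : G) (x : X), g • x = x → g = 1) {g h : G} {x : X}
    (hgh : g • x = h • x) : g = h := by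
  refine (inv_mul_eq_one.1 (hfree (h⁻¹ * g) x ?_)).symm
  rw [mul_smul, hgh, inv_smul_smul]

variable [TopologicalSpace X]

theorem continuous_smul_of_isLocallyConstant (hcont : ∀ g : G, Continuous fun x : X => g • x)
    {a : X → G} (ha : IsLocallyConstant a) : Continuous fun x => a x • x := by
  refine continuous_iff_continuousAt.2 fun x => ?_
  refine ((hcont (a x)).continuousAt (x := x)).congr ?_
  filter_upwards [ha.eventually_eq x] with y hy
  rw [hy]

/-- A `G`-clopen equivalence relation whose classes are uniformly bounded by a finite subset of
`G` has a continuous selector, given by a locally constant cocycle: in each class choose the point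
with the least image under a continuous injection into `ℝ`. -/
theorem exists_isLocallyConstant_selector (hcont : ∀ g : G, Continuous fun x : X => g • x)
    (hfree : ∀ (g : G) (x : X), g • x = x → g = 1)
    {r : X → ℝ} (hr : Continuous r) (hrinj : Function.Injective r)
    {F : X → X → Prop} (hF : Equivalence F) (hclopen : ∀ g : G, IsClopen {x : X | F x (g • x)})
    {K : Finset G} (hK : ∀ x y : X, F x y → ∃ g ∈ K, g • x = y) :
    ∃ a : X → G, IsLocallyConstant a ∧ (∀ x, a x ∈ K) ∧
      ∀ x y, F x y ↔ a x • x = a y • y := by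
  classical
  have hmin : ∀ x, ∃ g ∈ K, F x (g • x) ∧ ∀ h ∈ K, F x (h • x) → r (g • x) ≤ r (h • x) := by
    intro x
    obtain ⟨g₀, hg₀, hx⟩ := hK x x (hF.refl x)
    obtain ⟨g, hg, hle⟩ := (K.filter fun g => F x (g • x)).exists_min_image (fun g => r (g • x))
      ⟨g₀, by simp [hg₀, hx, hF.refl x]⟩
    simp only [Finset.mem_filter] at hg hle
    exact ⟨g, hg.1, hg.2, fun h hh hFh => hle h ⟨hh, hFh⟩⟩
  choose a haK haF hale using hmin
  have hfiber : ∀ x g, g ∈ K → F x (g • x) →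
      (∀ h ∈ K, h ≠ g → F x (h • x) → r (g • x) < r (h • x)) → a x = g := by
    intro x g hg hgF hlt
    by_contra hne
    exact absurd (hlt (a x) (haK x) hne (haF x)) (hale x g hg hgF).not_gt
  have hlt : ∀ x, ∀ h ∈ K, h ≠ a x → F x (h • x) → r (a x • x) < r (h • x) := by
    intro x h hh hne hFh
    refine (hale x h hh hFh).lt_of_ne fun heq => hne ?_
    exact (smul_left_cancel_of_free hfree (hrinj heq)).symm
  refine ⟨a, ?_, haK, fun x y => ⟨fun hxy => ?_, fun hxy => ?_⟩⟩
  · refine (IsLocallyConstant.iff_eventually_eq a).2 fun x => ?_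
    have hev : ∀ᶠ z in 𝓝 x, ∀ h ∈ K, h ≠ a x → F z (h • z) → r (a x • z) < r (h • z) := by
      refine (Finset.eventually_all K).2 fun h hh => ?_
      by_cases hne : h = a x
      · simp [hne]
      by_cases hFh : F x (h • x)
      · filter_upwards [(hr.comp (hcont (a x))).continuousAt.eventually_lt
          (hr.comp (hcont h)).continuousAt (hlt x h hh hne hFh)] with z hz _ _ using hz
      · filter_upwards [(hclopen h).compl.isOpen.mem_nhds hFh] with z hz _ hz' using absurd hz' hz
    filter_upwards [hev, (hclopen (a x)).isOpen.mem_nhds (haF x)] with z hz hzF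
    exact hfiber z (a x) (haK x) hzF hz
  · have key : ∀ x y, F x y → r (a x • x) ≤ r (a y • y) := by
      intro x y hxy
      obtain ⟨g, hg, hgy⟩ := hK x (a y • y) (hF.trans hxy (haF y))
      rw [← hgy]
      exact hale x g hg (by rw [hgy]; exact hF.trans hxy (haF y))
    exact hrinj (le_antisymm (key x y hxy) (key y x (hF.symm hxy)))
  · exact hF.trans (haF x) (hxy ▸ hF.symm (haF y))

/-- A sequence of continuous selectors `x ↦ a n x • x` starting with the identity yields a
continuous embedding into `E₀` of the relation "the `n`-th selectors eventually agree". -/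
theorem exists_embedding_of_selectors (hcont : ∀ g : G, Continuous fun x : X => g • x)
    (hfree : ∀ (g : G) (x : X), g • x = x → g = 1)
    {e : X → ℕ → Bool} (he : Continuous e) (heinj : Function.Injective e)
    {a : ℕ → X → G} (ha : ∀ n, IsLocallyConstant (a n)) (ha0 : ∀ x, a 0 x = 1)
    {K : ℕ → Finset G} (haK : ∀ n x, a n x ∈ K n) :
    ∃ f : X → ℕ → Bool, Continuous f ∧ Function.Injective f ∧
      ∀ x y, (∀ᶠ n in atTop, a n x • x = a n y • y) ↔ ∀ᶠ k in atTop, f x k = f y k := by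
  classical
  let D : ℕ → Finset G := fun n =>
    (Finset.range (n + 2)).biUnion fun m => Finset.image₂ (fun u v => u * v⁻¹) (K m) (K n)
  have hD : ∀ {m n}, m ≤ n + 1 → ∀ x, a m x * (a n x)⁻¹ ∈ D n := fun {m n} hmn x =>
    Finset.mem_biUnion.2 ⟨m, Finset.mem_range.2 (by omega),
      Finset.mem_image₂_of_mem (haK m x) (haK n x)⟩
  -- Block `n` records the transition between consecutive selected points, and the first `n` bits
  -- of all `D n`-translates of the `n`-th selected point.
  let b : ∀ n, (D n ⊕ D n × Fin n) → X → Bool := fun n i x =>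
    Sum.elim (fun g => decide (a (n + 1) x * (a n x)⁻¹ = g.1))
      (fun p => e (p.1.1 • a n x • x) p.2) i
  have hb : ∀ n i, Continuous (b n i) := by
    rintro n (g | ⟨g, i⟩)
    · exact (((ha (n + 1)).mul (ha n).inv).comp fun h => decide (h = g.1)).continuous
    · exact (continuous_apply i.1).comp (he.comp ((hcont g.1).comp
        (continuous_smul_of_isLocallyConstant hcont (ha n))))
  have hcocycle : ∀ m x y, (∀ n ≥ m, ∀ i, b n i x = b n i y) → ∀ n ≥ m,
      a m x * (a n x)⁻¹ = a m y * (a n y)⁻¹ := by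
    intro m x y h n hn
    induction n, hn using Nat.le_induction with
    | base => simp
    | succ n hn ih =>
      have hstep : a (n + 1) y * (a n y)⁻¹ = a (n + 1) x * (a n x)⁻¹ := by
        simpa [b] using h n hn (Sum.inl ⟨_, hD le_rfl x⟩)
      calc a m x * (a (n + 1) x)⁻¹
          = a m x * (a n x)⁻¹ * (a (n + 1) x * (a n x)⁻¹)⁻¹ := by group
        _ = a m y * (a n y)⁻¹ * (a (n + 1) y * (a n y)⁻¹)⁻¹ := by rw [ih, hstep]
        _ = a m y * (a (n + 1) y)⁻¹ := by group
  have hdecode : ∀ m x y, (∀ n ≥ m, ∀ i, b n i x = b n i y) → a m x • x = a m y • y := by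
    intro m x y h
    refine heinj (funext fun i => ?_)
    have hn : m ≤ max m (i + 1) := le_max_left _ _
    have hi : i < max m (i + 1) := (Nat.lt_succ_self i).trans_le (le_max_right _ _)
    generalize max m (i + 1) = n at hn hi
    have hbit := h n hn (Sum.inr (⟨_, hD (hn.trans n.le_succ) x⟩, ⟨i, hi⟩))
    have hsmul : ∀ z, (a m z * (a n z)⁻¹) • a n z • z = a m z • z := fun z => by
      rw [smul_smul, inv_mul_cancel_right]
    simp only [b, Sum.elim_inr] at hbit
    rwa [hsmul, hcocycle m x y h n hn, hsmul] at hbit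
  have hencode : ∀ n x y, a n x • x = a n y • y → a (n + 1) x • x = a (n + 1) y • y →
      ∀ i, b n i x = b n i y := by
    intro n x y hn hn1
    have htrans : a (n + 1) x * (a n x)⁻¹ = a (n + 1) y * (a n y)⁻¹ := by
      refine smul_left_cancel_of_free hfree (x := a n x • x) ?_
      rw [smul_smul, inv_mul_cancel_right, hn1, hn, smul_smul, inv_mul_cancel_right]
    rintro (g | ⟨g, i⟩)
    · simp only [b, Sum.elim_inl, htrans]
    · simp only [b, Sum.elim_inr, hn]
  obtain ⟨f, hf, hfinj, hfE⟩ := exists_continuous_concat b hb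
  refine ⟨f, hf, fun x y hxy => ?_, fun x y => ?_⟩
  · simpa [ha0] using hdecode 0 x y fun n _ => hfinj x y hxy n
  · rw [hfE]
    constructor
    · intro h
      filter_upwards [h, (tendsto_add_atTop_nat 1).eventually h] with n hn hn1
      exact hencode n x y hn hn1
    · intro h
      obtain ⟨m, hm⟩ := eventually_atTop.1 h
      exact eventually_atTop.2 ⟨m, fun n hn => hdecode n x y fun k hk => hm k (hn.trans hk)⟩

end Action


/-- **Lemma 3.7 (Gao–Jackson: embedding the eventual intersection into `E_0`).**
Let the countable group `G` act freely and continuously on the zero-dimensional Polish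
space `X`. Let `F_1, F_2, …` be finite `G`-clopen equivalence relations on `X` with finite
sets `K_n ⊆ G` such that `[x]_{F_n} ⊆ K_n·x` for all `n` and `x`. Then the relation
`x F y ⇔ ∃ m, ∀ n ≥ m, x F_n y` continuously embeds into `E_0` on Cantor space. -/
theorem embed_into_E0 {G X : Type*} [Group G] [Countable G]
    [TopologicalSpace X] [PolishSpace X] [MulAction G X]
    (hbasis : TopologicalSpace.IsTopologicalBasis {U : Set X | IsClopen U})
    (hcont : ∀ g : G, Continuous fun x : X => g • x)
    (hfree : ∀ (g : G) (x : X), g • x = x → g = 1)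
    (F : ℕ → X → X → Prop) (hFeq : ∀ n, Equivalence (F n))
    (hFfin : ∀ n, ∀ x : X, {y | F n x y}.Finite)
    (hGclopen : ∀ n, ∀ g : G, IsClopen {x : X | F n x (g • x)})
    (K : ℕ → Finset G) (hK : ∀ n, ∀ x y : X, F n x y → ∃ g ∈ K n, g • x = y) :
    ∃ f : X → (ℕ → Bool), Continuous f ∧ Function.Injective f ∧
      ∀ x y : X, (∃ m : ℕ, ∀ n ≥ m, F n x y) ↔
        (∀ᶠ k in Filter.atTop, f x k = f y k) := by
  obtain ⟨e, he, heinj⟩ := exists_continuous_injective_cantor hbasis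
  have hrinj := (Cardinal.cantorFunction_injective (c := 1 / 3) (by norm_num)
    (by norm_num)).comp heinj
  have hr := (continuous_cantorFunction (c := 1 / 3) (by norm_num) (by norm_num)).comp he
  choose a ha haK haF using fun n =>
    exists_isLocallyConstant_selector hcont hfree hr hrinj (hFeq n) (hGclopen n) (hK n)
  obtain ⟨f, hf, hfinj, hfE⟩ := exists_embedding_of_selectors hcont hfree he heinj
    (a := fun n => Nat.casesOn n (fun _ => 1) a) (K := fun n => Nat.casesOn n {1} K)
    (by rintro (_ | n); exacts [IsLocallyConstant.const 1, ha n]) (fun _ => rfl)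
    (by rintro (_ | n) x; exacts [Finset.mem_singleton_self 1, haK n x])
  refine ⟨f, hf, hfinj, fun x y => ?_⟩
  rw [← hfE, ← eventually_atTop]
  conv_rhs => rw [← map_add_atTop_eq_nat 1, eventually_map]
  simp only [haF]
end
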